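/- Let ϑ_P = (ϑ, P) be a primitive recognisable random substitution of constant length ℓ, and assume that at least one of the following holds: (i) ϑ(a) has the same cardinality for all a ∈ A; (ii) ϑ_P is compatible and ℓ is the only non-zero eigenvalue of the substitution matrix. Then the system (X_ϑ, S) is intrinsically ergodic: it has a unique measure of maximal entropy, and this measure is the frequency measure corresponding to uniform probabilities (P[ϑ_P(a) = s] = 1/#ϑ(a) for all a ∈ A and s ∈ ϑ(a)). -/

import Mathlib

open Filter MeasureTheory

namespace RandomSubstitutionTheory

variable {A : Type*} [Fintype A] [DecidableEq A]

/-- The set of realisations of `ϑ(u)` for a word `u`. -/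
def reals (θ : A → Finset (List A)) : List A → Finset (List A)
  | [] => {[]}
  | a :: u => (θ a).biUnion fun v => (reals θ u).image fun w => v ++ w

/-- The set of realisations of `ϑ^n(u)` for a word `u`. -/
def realsIter (θ : A → Finset (List A)) : ℕ → List A → Finset (List A)
  | 0, u => {u}
  | n + 1, u => (reals θ u).biUnion fun v => realsIter θ n v

/-- `wordProb θ P u w` is the probability `P[ϑ_P(u) = w]`, each letter of `u` being
substituted independently. -/
noncomputable def wordProb (θ : A → Finset (List A)) (P : A → List A → ℝ) :
    List A → List A → ℝ
  | [], w => if w = [] then 1 else 0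
  | a :: u, w =>
      ∑ v ∈ θ a, P a v * (if v <+: w then wordProb θ P u (w.drop v.length) else 0)

/-- `iterProb θ P n u w` is the probability `P[ϑ_P^n(u) = w]` of the induced Markov chain. -/
noncomputable def iterProb (θ : A → Finset (List A)) (P : A → List A → ℝ) :
    ℕ → List A → List A → ℝ
  | 0, u, w => if u = w then 1 else 0
  | n + 1, u, w => ∑ v ∈ reals θ u, wordProb θ P u v * iterProb θ P n v w

/-- The substitution matrix `M_{ij} = E[|ϑ_P(a_j)|_{a_i}]`. -/
noncomputable def substM (θ : A → Finset (List A)) (P : A → List A → ℝ) :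
    Matrix A A ℝ :=
  Matrix.of fun i j => ∑ w ∈ θ j, P j w * (w.count i : ℝ)

/-- The defining data of a random substitution: nonempty finite sets of nonempty words
and strictly positive probability vectors. -/
def IsRandomSubstitution (θ : A → Finset (List A)) (P : A → List A → ℝ) : Prop :=
  (∀ a, (θ a).Nonempty) ∧ (∀ a, ∀ w ∈ θ a, w ≠ []) ∧
    (∀ a, ∀ w ∈ θ a, 0 < P a w) ∧ (∀ a w, w ∉ θ a → P a w = 0) ∧
    ∀ a, ∑ w ∈ θ a, P a w = 1

/-- Primitivity of the substitution matrix: some power has strictly positive entries. -/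
def IsPrimitive (θ : A → Finset (List A)) (P : A → List A → ℝ) : Prop :=
  ∃ k : ℕ, ∀ i j : A, 0 < (substM θ P ^ k) i j

/-- The Perron–Frobenius eigenvalue is `> 1` (witnessed by a positive right eigenvector). -/
def IsExpanding (θ : A → Finset (List A)) (P : A → List A → ℝ) : Prop :=
  ∃ lam : ℝ, 1 < lam ∧ ∃ R : A → ℝ, (∀ a, 0 < R a) ∧ (substM θ P).mulVec R = lam • R

/-- A word is legal if it occurs as a subword of some level-`k` inflation word. -/
def Legal (θ : A → Finset (List A)) (u : List A) : Prop :=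
  ∃ (a : A) (k : ℕ) (w : List A), w ∈ realsIter θ k [a] ∧ u <:+: w

/-- All words of length `n` over the alphabet. -/
def allWords (A : Type*) [Fintype A] [DecidableEq A] (n : ℕ) : Finset (List A) :=
  (Finset.univ : Finset (Fin n → A)).image List.ofFn

/-- All legal words of length `n`. -/
noncomputable def legalWords (θ : A → Finset (List A)) (n : ℕ) : Finset (List A) :=
  letI := Classical.decPred (Legal θ)
  (allWords A n).filter (Legal θ)

/-- The left shift on bi-infinite sequences. -/
def shift : (ℤ → A) → ℤ → A := fun x i => x (i + 1)

/-- The finite word of length `n` read off a bi-infinite sequence starting at position `m`. -/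
def window (x : ℤ → A) (m : ℤ) (n : ℕ) : List A :=
  (List.range n).map fun t => x (m + (t : ℤ))

/-- The random substitution subshift `X_ϑ`. -/
def Xtheta (θ : A → Finset (List A)) : Set (ℤ → A) :=
  {x | ∀ (m : ℤ) (n : ℕ), Legal θ (window x m n)}

/-- The cylinder set of the word `v` at position `m`. -/
def cylinder (v : List A) (m : ℤ) : Set (ℤ → A) :=
  {x | window x m v.length = v}

/-- The number `|w|_v` of (possibly overlapping) occurrences of `v` in `w`. -/
def occCount (v w : List A) : ℕ :=
  ((List.range w.length).filter fun i => decide (v <+: w.drop i)).length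

/-- Expected length `E[|ϑ_P^k(a)|]`. -/
noncomputable def expLen (θ : A → Finset (List A)) (P : A → List A → ℝ)
    (k : ℕ) (a : A) : ℝ :=
  ∑ w ∈ realsIter θ k [a], iterProb θ P k [a] w * (w.length : ℝ)

/-- Expected number of occurrences `E[|ϑ_P^k(a)|_v]`. -/
noncomputable def expCount (θ : A → Finset (List A)) (P : A → List A → ℝ)
    (k : ℕ) (a : A) (v : List A) : ℝ :=
  ∑ w ∈ realsIter θ k [a], iterProb θ P k [a] w * (occCount v w : ℝ)

/-- `μ` is the frequency measure of `(ϑ, P)`: a shift-invariant Borel probability measure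
supported on `X_ϑ` whose cylinder values are the expected word frequencies. -/
def IsFrequencyMeasure [MeasurableSpace A] (θ : A → Finset (List A))
    (P : A → List A → ℝ) (μ : Measure (ℤ → A)) : Prop :=
  IsProbabilityMeasure μ ∧
    (∀ s : Set (ℤ → A), MeasurableSet s → μ (shift ⁻¹' s) = μ s) ∧
    μ (Xtheta θ) = 1 ∧
    ∀ v : List A, Legal θ v → ∀ (m : ℤ) (a : A),
      Tendsto (fun k : ℕ => expCount θ P k a v / expLen θ P k a) atTop
        (nhds ((μ (cylinder v m)).toReal))

/-- The `n`-th entropy sum `∑_{u ∈ L_ϑ^n} -μ[u] log μ[u]`. -/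
noncomputable def entropySeq [MeasurableSpace A] (θ : A → Finset (List A))
    (μ : Measure (ℤ → A)) (n : ℕ) : ℝ :=
  ∑ u ∈ legalWords θ n, Real.negMulLog ((μ (cylinder u 0)).toReal)

/-- The measure-theoretic (Kolmogorov–Sinai) entropy of the shift with respect to `μ`,
computed along cylinder partitions. -/
noncomputable def measEntropy [MeasurableSpace A] (θ : A → Finset (List A))
    (μ : Measure (ℤ → A)) : ℝ :=
  limsup (fun n : ℕ => entropySeq θ μ n / (n : ℝ)) atTop

/-- The topological entropy of the subshift `X_ϑ`. -/
noncomputable def topEntropy (θ : A → Finset (List A)) : ℝ :=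
  limsup (fun n : ℕ => Real.log ((legalWords θ n).card) / (n : ℝ)) atTop

/-- The entropy vector `H_{k,a} = H(ϑ_P^k(a))`. -/
noncomputable def Hvec (θ : A → Finset (List A)) (P : A → List A → ℝ)
    (k : ℕ) (a : A) : ℝ :=
  ∑ w ∈ realsIter θ k [a], Real.negMulLog (iterProb θ P k [a] w)

/-- The inner product `H_k^T R`. -/
noncomputable def HdotR (θ : A → Finset (List A)) (P : A → List A → ℝ)
    (R : A → ℝ) (k : ℕ) : ℝ :=
  ∑ a, Hvec θ P k a * R a

/-- Binary entropy `H(p) = -p log p - (1-p) log (1-p)`. -/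
noncomputable def binEnt (p : ℝ) : ℝ := Real.negMulLog p + Real.negMulLog (1 - p)

/-- Unique realisation paths: concatenation of level-`k` inflation words of the letters of a
legal word is injective. -/
def UniqueRealisationPaths (θ : A → Finset (List A)) : Prop :=
  ∀ v : List A, Legal θ v → ∀ k : ℕ, ∀ f g : Fin v.length → List A,
    (∀ i, f i ∈ realsIter θ k [v.get i]) → (∀ i, g i ∈ realsIter θ k [v.get i]) →
      (List.ofFn f).flatten = (List.ofFn g).flatten → f = g

/-- The disjoint set condition. -/
def DisjointSetCondition (θ : A → Finset (List A)) : Prop :=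
  ∀ (a : A) (k : ℕ), ∀ u ∈ θ a, ∀ v ∈ θ a, u ≠ v →
    ∀ w, w ∈ realsIter θ k u → w ∉ realsIter θ k v

/-- The identical set condition. -/
def IdenticalSetCondition (θ : A → Finset (List A)) : Prop :=
  ∀ (a : A) (k : ℕ), ∀ u ∈ θ a, ∀ v ∈ θ a, realsIter θ k u = realsIter θ k v

/-- Identical production probabilities. -/
def IdenticalProductionProbabilities (θ : A → Finset (List A))
    (P : A → List A → ℝ) : Prop :=
  ∀ a : A, ∀ u ∈ θ a, ∀ v ∈ θ a, ∀ (k : ℕ) (w : List A),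
    iterProb θ P k u w = iterProb θ P k v w

/-- The disjoint set condition for the `k`-th power `ϑ^k`. -/
def DisjointSetConditionPow (θ : A → Finset (List A)) (k : ℕ) : Prop :=
  ∀ (a : A) (j : ℕ), ∀ u ∈ realsIter θ k [a], ∀ v ∈ realsIter θ k [a], u ≠ v →
    ∀ w, w ∈ realsIter θ (k * j) u → w ∉ realsIter θ (k * j) v

/-- The identical set condition for the `k`-th power `ϑ^k`. -/
def IdenticalSetConditionPow (θ : A → Finset (List A)) (k : ℕ) : Prop :=
  ∀ (a : A) (j : ℕ), ∀ u ∈ realsIter θ k [a], ∀ v ∈ realsIter θ k [a],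
    realsIter θ (k * j) u = realsIter θ (k * j) v

/-- Identical production probabilities for the `k`-th power `ϑ^k`. -/
def IdenticalProductionProbabilitiesPow (θ : A → Finset (List A))
    (P : A → List A → ℝ) (k : ℕ) : Prop :=
  ∀ a : A, ∀ u ∈ realsIter θ k [a], ∀ v ∈ realsIter θ k [a], ∀ (j : ℕ) (w : List A),
    iterProb θ P (k * j) u w = iterProb θ P (k * j) v w

/-- Compatibility: all realisations of a letter have the same abelianisation. -/
def Compatible (θ : A → Finset (List A)) : Prop :=
  ∀ a : A, ∀ u ∈ θ a, ∀ v ∈ θ a, ∀ b : A, u.count b = v.count b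

/-- Constant length `ℓ ≥ 2`. -/
def ConstantLength (θ : A → Finset (List A)) (ℓ : ℕ) : Prop :=
  2 ≤ ℓ ∧ ∀ a : A, ∀ w ∈ θ a, w.length = ℓ

/-- The set `ϑ(y)` of bi-infinite sequences obtained by substituting each letter of `y`,
with the image of `y 0` beginning at position `0`. -/
def substSeq (θ : A → Finset (List A)) (y : ℤ → A) : Set (ℤ → A) :=
  {x | ∃ v : ℤ → List A, (∀ j, v j ∈ θ (y j)) ∧
    ∃ p : ℤ → ℤ, p 0 = 0 ∧ (∀ j, p (j + 1) = p j + (v j).length) ∧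
      ∀ (j : ℤ) (t : ℕ) (ht : t < (v j).length), x (p j + (t : ℤ)) = (v j).get ⟨t, ht⟩}

/-- `ϑ(X)` for a set of bi-infinite sequences. -/
def substImage (θ : A → Finset (List A)) (X : Set (ℤ → A)) : Set (ℤ → A) :=
  ⋃ y ∈ X, substSeq θ y

/-- The set `ϑ^m(y)` of bi-infinite sequences. -/
def substSeqPow (θ : A → Finset (List A)) : ℕ → (ℤ → A) → Set (ℤ → A)
  | 0, y => {y}
  | m + 1, y => ⋃ z ∈ substSeq θ y, substSeqPow θ m z

/-- The maximal length of an inflation word of the letter `a` (equals the common length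
when lengths are well-defined). -/
def maxLen (θ : A → Finset (List A)) (a : A) : ℕ := (θ a).sup List.length

/-- Recognisability: every `x ∈ X_ϑ` has a unique inflation-word decomposition. -/
def Recognisable (θ : A → Finset (List A)) : Prop :=
  ∀ x ∈ Xtheta θ, ∃! p : (ℤ → A) × ℕ,
    p.1 ∈ Xtheta θ ∧ p.2 < maxLen θ (p.1 0) ∧
      (fun i => x (i - (p.2 : ℤ))) ∈ substSeq θ p.1

/-- Recognisability of the `m`-th power of a constant length-`ℓ` substitution. -/
def RecognisablePow (θ : A → Finset (List A)) (m ℓ : ℕ) : Prop :=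
  ∀ x ∈ Xtheta θ, ∃! p : (ℤ → A) × ℕ,
    p.1 ∈ Xtheta θ ∧ p.2 < ℓ ^ m ∧
      (fun i => x (i - (p.2 : ℤ))) ∈ substSeqPow θ m p.1

/-- The set `ϑ^m([a])` of exact images of sequences in the cylinder `[a] ⊆ X_ϑ`. -/
def inflCylPow (θ : A → Finset (List A)) (m : ℕ) (a : A) : Set (ℤ → A) :=
  ⋃ y ∈ {w ∈ Xtheta θ | w 0 = a}, substSeqPow θ m y

/-- `r` is a radius of local recognisability for `ϑ^m`. -/
def RecogPropPow (θ : A → Finset (List A)) (m r : ℕ) : Prop :=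
  ∀ (a : A) (x : ℤ → A), x ∈ inflCylPow θ m a → ∀ y ∈ Xtheta θ,
    (∀ t : ℤ, -(r : ℤ) ≤ t → t ≤ (r : ℤ) → x t = y t) → y ∈ inflCylPow θ m a

/-- The recognisability radius `κ(ϑ^m)`. -/
noncomputable def recogRadiusPow (θ : A → Finset (List A)) (m : ℕ) : ℕ :=
  sInf {r | RecogPropPow θ m r}

/-- The recognisability radius `κ(ϑ)`. -/
noncomputable def recogRadius (θ : A → Finset (List A)) : ℕ := recogRadiusPow θ 1

/-- The random word `ϑ_P^n(a)` is (a.s.) completely determined by `ϑ_P^{n+k}(a)`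
in the Markov chain. -/
def DeterminedBy (θ : A → Finset (List A)) (P : A → List A → ℝ)
    (a : A) (n k : ℕ) : Prop :=
  ∀ v₁ v₂ w : List A, v₁ ∈ realsIter θ n [a] → v₂ ∈ realsIter θ n [a] →
    0 < iterProb θ P n [a] v₁ * iterProb θ P k v₁ w →
      0 < iterProb θ P n [a] v₂ * iterProb θ P k v₂ w → v₁ = v₂

/-- The random words `ϑ_P^n(a)` and `ϑ_P^{n+k}(a)` are independent in the Markov chain. -/
def IndepSteps (θ : A → Finset (List A)) (P : A → List A → ℝ)
    (a : A) (n k : ℕ) : Prop :=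
  ∀ v w : List A,
    iterProb θ P n [a] v * iterProb θ P k v w =
      iterProb θ P n [a] v * iterProb θ P (n + k) [a] w

/-- The substitution matrix of a marginal (deterministic) substitution. -/
def marginalM (ρ : A → List A) : Matrix A A ℝ :=
  Matrix.of fun i j => ((ρ j).count i : ℝ)

/-- Geometric compatibility: a single positive left eigenvector with eigenvalue `λ > 1`
for all marginals. -/
def GeometricallyCompatible (θ : A → Finset (List A)) : Prop :=
  ∃ lam : ℝ, 1 < lam ∧ ∃ L : A → ℝ, (∀ a, 0 < L a) ∧
    ∀ ρ : A → List A, (∀ a, ρ a ∈ θ a) → Matrix.vecMul L (marginalM ρ) = lam • L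


set_option linter.unusedSectionVars false

section Words

variable {θ : A → Finset (List A)} {ℓ : ℕ}

theorem mem_reals_cons {a : A} {u w : List A} :
    w ∈ reals θ (a :: u) ↔ ∃ v ∈ θ a, ∃ w' ∈ reals θ u, v ++ w' = w := by
  simp [reals]

theorem mem_reals_append {u v w : List A} :
    w ∈ reals θ (u ++ v) ↔ ∃ w₁ ∈ reals θ u, ∃ w₂ ∈ reals θ v, w₁ ++ w₂ = w := by
  induction u generalizing w with
  | nil => simp [reals]
  | cons a u ih =>
    simp only [List.cons_append, mem_reals_cons, ih]
    constructor
    · rintro ⟨s, hs, _, ⟨w₁, h₁, w₂, h₂, rfl⟩, rfl⟩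
      exact ⟨s ++ w₁, ⟨s, hs, w₁, h₁, rfl⟩, w₂, h₂, by simp⟩
    · rintro ⟨_, ⟨s, hs, w₁, h₁, rfl⟩, w₂, h₂, rfl⟩
      exact ⟨s, hs, w₁ ++ w₂, ⟨w₁, h₁, w₂, h₂, rfl⟩, by simp⟩

theorem reals_nonempty (hne : ∀ a, (θ a).Nonempty) (u : List A) : (reals θ u).Nonempty := by
  induction u with
  | nil => exact ⟨[], by simp [reals]⟩
  | cons a u ih =>
    obtain ⟨v, hv⟩ := hne a
    obtain ⟨w, hw⟩ := ih
    exact ⟨v ++ w, mem_reals_cons.2 ⟨v, hv, w, hw, rfl⟩⟩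

theorem length_of_mem_reals (hl : ∀ a, ∀ w ∈ θ a, w.length = ℓ) {u w : List A}
    (h : w ∈ reals θ u) : w.length = ℓ * u.length := by
  induction u generalizing w with
  | nil => simp_all [reals]
  | cons a u ih =>
    obtain ⟨v, hv, w', hw', rfl⟩ := mem_reals_cons.1 h
    simp [hl a v hv, ih hw', Nat.mul_add, add_comm]

theorem mem_realsIter_succ {n : ℕ} {u w : List A} :
    w ∈ realsIter θ (n + 1) u ↔ ∃ v ∈ reals θ u, w ∈ realsIter θ n v := by
  simp [realsIter]

theorem mem_realsIter_add {n m : ℕ} {u w : List A} :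
    w ∈ realsIter θ (n + m) u ↔ ∃ v ∈ realsIter θ n u, w ∈ realsIter θ m v := by
  induction n generalizing u with
  | zero => simp [realsIter]
  | succ n ih =>
    rw [Nat.add_right_comm]
    simp only [mem_realsIter_succ, ih]
    constructor
    · rintro ⟨v, hv, s, hs, h⟩
      exact ⟨s, ⟨v, hv, hs⟩, h⟩
    · rintro ⟨s, ⟨v, hv, hs⟩, h⟩
      exact ⟨v, hv, s, hs, h⟩

theorem length_of_mem_realsIter (hl : ∀ a, ∀ w ∈ θ a, w.length = ℓ) {n : ℕ} {u w : List A}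
    (h : w ∈ realsIter θ n u) : w.length = ℓ ^ n * u.length := by
  induction n generalizing u with
  | zero => simp_all [realsIter]
  | succ n ih =>
    obtain ⟨v, hv, hw⟩ := mem_realsIter_succ.1 h
    rw [ih hw, length_of_mem_reals hl hv, pow_succ, mul_assoc]

theorem Legal.of_isInfix {u v : List A} (h : Legal θ v) (huv : u <:+: v) : Legal θ u := by
  obtain ⟨a, k, w, hw, hv⟩ := h
  exact ⟨a, k, w, hw, huv.trans hv⟩

theorem Legal.of_mem_reals (hne : ∀ a, (θ a).Nonempty) {u w : List A} (h : Legal θ u)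
    (hw : w ∈ reals θ u) : Legal θ w := by
  obtain ⟨a, k, t, ht, s₁, s₂, rfl⟩ := h
  obtain ⟨r₁, h₁⟩ := reals_nonempty hne s₁
  obtain ⟨r₂, h₂⟩ := reals_nonempty hne s₂
  refine ⟨a, k + 1, r₁ ++ w ++ r₂, mem_realsIter_add.2 ⟨_, ht, ?_⟩, r₁, r₂, rfl⟩
  refine mem_realsIter_succ.2 ⟨r₁ ++ w ++ r₂, ?_, by simp [realsIter]⟩
  exact mem_reals_append.2 ⟨_, mem_reals_append.2 ⟨_, h₁, _, hw, rfl⟩, _, h₂, rfl⟩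

theorem Legal.of_mem_realsIter {a : A} {n : ℕ} {w : List A} (h : w ∈ realsIter θ n [a]) :
    Legal θ w := ⟨a, n, w, h, List.infix_rfl⟩

theorem legal_singleton (a : A) : Legal θ [a] :=
  Legal.of_mem_realsIter (n := 0) (a := a) (by simp [realsIter])

theorem mem_allWords {n : ℕ} {w : List A} : w ∈ allWords A n ↔ w.length = n := by
  constructor
  · intro h
    obtain ⟨f, -, rfl⟩ := Finset.mem_image.1 h
    simp
  · rintro rfl
    exact Finset.mem_image.2 ⟨w.get, Finset.mem_univ _, by simp⟩

theorem mem_legalWords {n : ℕ} {w : List A} :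
    w ∈ legalWords θ n ↔ w.length = n ∧ Legal θ w := by
  classical
  simp [legalWords, mem_allWords]

theorem sum_allWords_add {M : Type*} [AddCommMonoid M] (m n : ℕ) (f : List A → M) :
    ∑ u ∈ allWords A (m + n), f u = ∑ u ∈ allWords A m, ∑ v ∈ allWords A n, f (u ++ v) := by
  rw [← Finset.sum_product']
  symm
  refine Finset.sum_bij' (fun p _ => p.1 ++ p.2) (fun u _ => (u.take m, u.drop m)) ?_ ?_ ?_ ?_ ?_
  · rintro ⟨u, v⟩ h
    simp_all [mem_allWords]
  · intro u h
    simp_all [mem_allWords]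
  · rintro ⟨u, v⟩ h
    simp only [Finset.mem_product, mem_allWords] at h
    simp [← h.1]
  · intro u h
    simp
  · simp

/-- Sums over realisations of a concatenation split when inflation words have equal lengths. -/
theorem sum_reals_cons {M : Type*} [AddCommMonoid M] (hl : ∀ a, ∀ w ∈ θ a, w.length = ℓ)
    (a : A) (u : List A) (f : List A → M) :
    ∑ w ∈ reals θ (a :: u), f w = ∑ v ∈ θ a, ∑ w ∈ reals θ u, f (v ++ w) := by
  rw [reals, Finset.sum_biUnion]
  · refine Finset.sum_congr rfl fun v _ => ?_
    rw [Finset.sum_image]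
    intro x _ y _ h
    simpa using h
  · intro v hv v' hv' hne
    refine Finset.disjoint_left.2 fun w h h' => hne ?_
    obtain ⟨s, _, rfl⟩ := Finset.mem_image.1 h
    obtain ⟨s', _, h'⟩ := Finset.mem_image.1 h'
    exact ((List.append_inj h' (by rw [hl a _ hv, hl a _ hv'])).1).symm

end Words

section Expectation

variable (θ : A → Finset (List A)) (P : A → List A → ℝ)

/-- The expectation of `f (ϑ_P(u))`. -/
noncomputable def expOne : List A → (List A → ℝ) → ℝ
  | [], f => f []
  | a :: u, f => ∑ v ∈ θ a, P a v * expOne u fun w => f (v ++ w)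

/-- The expectation of `f (ϑ_P^n(u))`. -/
noncomputable def expIter : ℕ → List A → (List A → ℝ) → ℝ
  | 0, u, f => f u
  | n + 1, u, f => expOne θ P u fun v => expIter n v f

variable {θ P}

theorem wordProb_eq_zero {u w : List A} (h : w ∉ reals θ u) : wordProb θ P u w = 0 := by
  induction u generalizing w with
  | nil => simp_all [reals, wordProb]
  | cons a u ih =>
    rw [wordProb]
    refine Finset.sum_eq_zero fun v hv => ?_
    split_ifs with hp
    · obtain ⟨t, rfl⟩ := hp
      rw [List.drop_left, ih, mul_zero]
      exact fun ht => h (mem_reals_cons.2 ⟨v, hv, t, ht, rfl⟩)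
    · simp

theorem sum_wordProb_mul (u : List A) (f : List A → ℝ) :
    ∑ w ∈ reals θ u, wordProb θ P u w * f w = expOne θ P u f := by
  induction u generalizing f with
  | nil => simp [reals, wordProb, expOne]
  | cons a u ih =>
    simp only [wordProb, expOne, Finset.sum_mul]
    rw [Finset.sum_comm]
    refine Finset.sum_congr rfl fun v hv => ?_
    rw [← ih, Finset.mul_sum]
    symm
    refine Finset.sum_of_injOn (fun w => v ++ w) (by simp) ?_ ?_ ?_
    · intro w hw
      exact mem_reals_cons.2 ⟨v, hv, w, hw, rfl⟩
    · intro w _ hw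
      split_ifs with hp
      · obtain ⟨t, rfl⟩ := hp
        have : t ∉ reals θ u := fun ht => hw ⟨t, ht, rfl⟩
        simp [wordProb_eq_zero this]
      · simp
    · intro w _
      simp [mul_assoc]

theorem iterProb_eq_zero {n : ℕ} {u w : List A} (h : w ∉ realsIter θ n u) :
    iterProb θ P n u w = 0 := by
  induction n generalizing u with
  | zero =>
    rw [iterProb, if_neg]
    rintro rfl
    simp [realsIter] at h
  | succ n ih =>
    rw [iterProb]
    refine Finset.sum_eq_zero fun v hv => ?_
    rw [ih, mul_zero]
    exact fun hw => h (mem_realsIter_succ.2 ⟨v, hv, hw⟩)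

theorem sum_iterProb_mul (n : ℕ) (u : List A) (f : List A → ℝ) :
    ∑ w ∈ realsIter θ n u, iterProb θ P n u w * f w = expIter θ P n u f := by
  induction n generalizing u with
  | zero => simp [realsIter, iterProb, expIter]
  | succ n ih =>
    simp only [iterProb, expIter, Finset.sum_mul]
    rw [Finset.sum_comm, ← sum_wordProb_mul]
    refine Finset.sum_congr rfl fun v hv => ?_
    rw [← ih, Finset.mul_sum]
    symm
    refine Finset.sum_subset_zero_on_sdiff ?_ ?_ ?_
    · intro w hw
      exact mem_realsIter_succ.2 ⟨v, hv, hw⟩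
    · intro w hw
      simp [iterProb_eq_zero (Finset.mem_sdiff.1 hw).2]
    · intro w _
      ring

theorem expIter_sum {ι : Type*} (s : Finset ι) (n : ℕ) (u : List A) (c : ι → ℝ)
    (f : ι → List A → ℝ) :
    expIter θ P n u (fun w => ∑ i ∈ s, c i * f i w) = ∑ i ∈ s, c i * expIter θ P n u (f i) := by
  simp only [← sum_iterProb_mul, Finset.mul_sum]
  rw [Finset.sum_comm]
  exact Finset.sum_congr rfl fun _ _ => Finset.sum_congr rfl fun _ _ => by ring

theorem expIter_mul_left (n : ℕ) (u : List A) (c : ℝ) (f : List A → ℝ) :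
    expIter θ P n u (fun w => c * f w) = c * expIter θ P n u f := by
  simpa using expIter_sum (θ := θ) (P := P) {()} n u (fun _ => c) (fun _ => f)

theorem expIter_finsum {ι : Type*} (s : Finset ι) (n : ℕ) (u : List A)
    (f : ι → List A → ℝ) :
    expIter θ P n u (fun w => ∑ i ∈ s, f i w) = ∑ i ∈ s, expIter θ P n u (f i) := by
  simpa using expIter_sum (θ := θ) (P := P) s n u (fun _ => 1) f

theorem expIter_add (n : ℕ) (u : List A) (f g : List A → ℝ) :
    expIter θ P n u (fun w => f w + g w) = expIter θ P n u f + expIter θ P n u g := by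
  simp only [← sum_iterProb_mul, mul_add, Finset.sum_add_distrib]

theorem expOne_congr {u : List A} {f g : List A → ℝ} (h : ∀ w ∈ reals θ u, f w = g w) :
    expOne θ P u f = expOne θ P u g := by
  simp only [← sum_wordProb_mul]
  exact Finset.sum_congr rfl fun w hw => by rw [h w hw]

theorem expIter_congr {n : ℕ} {u : List A} {f g : List A → ℝ}
    (h : ∀ w ∈ realsIter θ n u, f w = g w) : expIter θ P n u f = expIter θ P n u g := by
  simp only [← sum_iterProb_mul]
  exact Finset.sum_congr rfl fun w hw => by rw [h w hw]

theorem wordProb_nonneg (hP : ∀ a, ∀ w ∈ θ a, 0 < P a w) (u w : List A) :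
    0 ≤ wordProb θ P u w := by
  induction u generalizing w with
  | nil =>
    rw [wordProb]
    split_ifs <;> norm_num
  | cons a u ih =>
    rw [wordProb]
    refine Finset.sum_nonneg fun v hv => mul_nonneg (hP a v hv).le ?_
    split_ifs
    · exact ih _
    · exact le_rfl

theorem iterProb_nonneg (hP : ∀ a, ∀ w ∈ θ a, 0 < P a w) (n : ℕ) (u w : List A) :
    0 ≤ iterProb θ P n u w := by
  induction n generalizing u with
  | zero =>
    rw [iterProb]
    split_ifs <;> norm_num
  | succ n ih =>
    rw [iterProb]
    exact Finset.sum_nonneg fun v _ => mul_nonneg (wordProb_nonneg hP u v) (ih v)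

theorem wordProb_pos (hP : ∀ a, ∀ w ∈ θ a, 0 < P a w) {u w : List A} (h : w ∈ reals θ u) :
    0 < wordProb θ P u w := by
  induction u generalizing w with
  | nil => simp_all [reals, wordProb]
  | cons a u ih =>
    obtain ⟨v, hv, t, ht, rfl⟩ := mem_reals_cons.1 h
    rw [wordProb]
    refine Finset.sum_pos' (fun s hs => mul_nonneg (hP a s hs).le ?_) ⟨v, hv, ?_⟩
    · split_ifs
      · exact wordProb_nonneg hP _ _
      · exact le_rfl
    · simpa using mul_pos (hP a v hv) (ih ht)

theorem iterProb_pos (hP : ∀ a, ∀ w ∈ θ a, 0 < P a w) {n : ℕ} {u w : List A}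
    (h : w ∈ realsIter θ n u) : 0 < iterProb θ P n u w := by
  induction n generalizing u with
  | zero => simp_all [realsIter, iterProb]
  | succ n ih =>
    obtain ⟨v, hv, hw⟩ := mem_realsIter_succ.1 h
    rw [iterProb]
    exact Finset.sum_pos'
      (fun s _ => mul_nonneg (wordProb_nonneg hP u s) (iterProb_nonneg hP n s w))
      ⟨v, hv, mul_pos (wordProb_pos hP hv) (ih hw)⟩

theorem expIter_mono (hP : ∀ a, ∀ w ∈ θ a, 0 < P a w) {n : ℕ} {u : List A} {f g : List A → ℝ}
    (h : ∀ w ∈ realsIter θ n u, f w ≤ g w) : expIter θ P n u f ≤ expIter θ P n u g := by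
  simp only [← sum_iterProb_mul]
  exact Finset.sum_le_sum fun w hw => mul_le_mul_of_nonneg_left (h w hw) (iterProb_nonneg hP n u w)

theorem expOne_const (hs : ∀ a, ∑ w ∈ θ a, P a w = 1) (u : List A) (c : ℝ) :
    expOne θ P u (fun _ => c) = c := by
  induction u with
  | nil => rfl
  | cons a u ih => rw [expOne]; simp [ih, ← Finset.sum_mul, hs]

theorem expIter_const (hs : ∀ a, ∑ w ∈ θ a, P a w = 1) (n : ℕ) (u : List A) (c : ℝ) :
    expIter θ P n u (fun _ => c) = c := by
  induction n generalizing u with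
  | zero => rfl
  | succ n ih => simp [expIter, ih, expOne_const hs]

theorem expOne_append (u v : List A) (f : List A → ℝ) :
    expOne θ P (u ++ v) f = expOne θ P u fun s => expOne θ P v fun t => f (s ++ t) := by
  induction u generalizing f with
  | nil => rfl
  | cons a u ih => simp [expOne, ih]

theorem expIter_append (n : ℕ) (u v : List A) (f : List A → ℝ) :
    expIter θ P n (u ++ v) f = expIter θ P n u fun s => expIter θ P n v fun t => f (s ++ t) := by
  induction n generalizing u v f with
  | zero => rfl
  | succ n ih =>
    simp only [expIter, expOne_append, ih]
    congr 1
    funext s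
    simp only [← sum_wordProb_mul, ← expIter_sum]

theorem expIter_comp (n m : ℕ) (u : List A) (f : List A → ℝ) :
    expIter θ P (n + m) u f = expIter θ P n u fun v => expIter θ P m v f := by
  induction n generalizing u with
  | zero => simp [expIter]
  | succ n ih => rw [Nat.add_right_comm]; simp [expIter, ih]

theorem expIter_one (u : List A) (f : List A → ℝ) : expIter θ P 1 u f = expOne θ P u f := rfl

theorem expCount_eq (k : ℕ) (a : A) (v : List A) :
    expCount θ P k a v = expIter θ P k [a] fun w => (occCount v w : ℝ) :=
  sum_iterProb_mul k [a] _

theorem expLen_eq {ℓ : ℕ} (hl : ∀ a, ∀ w ∈ θ a, w.length = ℓ)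
    (hs : ∀ a, ∑ w ∈ θ a, P a w = 1) (k : ℕ) (a : A) : expLen θ P k a = (ℓ : ℝ) ^ k := by
  rw [expLen, sum_iterProb_mul k [a], expIter_congr (g := fun _ => (ℓ : ℝ) ^ k),
    expIter_const hs]
  intro w hw
  simp [length_of_mem_realsIter hl hw]

/-- The number of choices `∏ #ϑ(u_i)` for realisations of `ϑ(u)`. -/
def numReals (θ : A → Finset (List A)) (u : List A) : ℕ := (u.map fun a => (θ a).card).prod

theorem expOne_uniform {ℓ : ℕ} (hl : ∀ a, ∀ w ∈ θ a, w.length = ℓ)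
    (hunif : ∀ a : A, ∀ s ∈ θ a, P a s = ((θ a).card : ℝ)⁻¹) (u : List A) (f : List A → ℝ) :
    expOne θ P u f = (numReals θ u : ℝ)⁻¹ * ∑ w ∈ reals θ u, f w := by
  induction u generalizing f with
  | nil => simp [expOne, numReals, reals]
  | cons a u ih =>
    rw [expOne, sum_reals_cons hl, Finset.mul_sum]
    refine Finset.sum_congr rfl fun v hv => ?_
    rw [ih, hunif a v hv]
    simp [numReals, mul_assoc, mul_comm]

theorem numReals_pos (hne : ∀ a, (θ a).Nonempty) (u : List A) : 0 < numReals θ u := by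
  refine List.prod_pos ?_
  intro n hn
  obtain ⟨a, -, rfl⟩ := List.mem_map.1 hn
  exact (hne a).card_pos

theorem card_reals {ℓ : ℕ} (hl : ∀ a, ∀ w ∈ θ a, w.length = ℓ) (u : List A) :
    (reals θ u).card = numReals θ u := by
  induction u with
  | nil => simp [numReals, reals]
  | cons a u ih =>
    rw [Finset.card_eq_sum_ones, sum_reals_cons hl]
    simp [ih, numReals]

end Expectation

section Windows

variable {θ : A → Finset (List A)} {ℓ : ℕ}

@[simp] theorem length_window (x : ℤ → A) (m : ℤ) (n : ℕ) : (window x m n).length = n := by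
  simp [window]

theorem getElem_window (x : ℤ → A) (m : ℤ) (n i : ℕ) (h : i < (window x m n).length) :
    (window x m n)[i] = x (m + i) := by
  have hf : ∀ l : List ℕ, List.flatMap (fun a : ℕ => [(a : ℤ)]) l = l.map fun a : ℕ => (a : ℤ) := by
    intro l
    induction l with
    | nil => rfl
    | cons a l ih => simp [ih]
  simp [window, hf]

theorem window_eq_iff {x : ℤ → A} {m : ℤ} {n : ℕ} {w : List A} :
    window x m n = w ↔ w.length = n ∧ ∀ (t : ℕ) (ht : t < w.length), x (m + t) = w[t] := by
  constructor
  · rintro rfl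
    exact ⟨by simp, fun t ht => (getElem_window x m n t ht).symm⟩
  · rintro ⟨hn, h⟩
    refine List.ext_getElem (by simp [hn]) fun i h₁ h₂ => ?_
    rw [getElem_window, h i h₂]

theorem window_add (x : ℤ → A) (m : ℤ) (a b : ℕ) :
    window x m (a + b) = window x m a ++ window x (m + a) b := by
  refine List.ext_getElem (by simp) fun i h₁ h₂ => ?_
  rw [getElem_window, List.getElem_append]
  split_ifs with h
  · rw [getElem_window]
  · rw [getElem_window]
    simp only [length_window] at h ⊢
    congr 1
    omega

theorem window_succ (x : ℤ → A) (m : ℤ) (n : ℕ) :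
    window x m (n + 1) = x m :: window x (m + 1) n := by
  rw [add_comm, window_add]
  simp [window]

theorem window_translate (x : ℤ → A) (c m : ℤ) (n : ℕ) :
    window (fun i => x (i + c)) m n = window x (m + c) n := by
  refine List.ext_getElem (by simp) fun i h₁ h₂ => ?_
  simp only [getElem_window]
  congr 1
  ring

theorem window_isInfix (x : ℤ → A) {m m' : ℤ} {n n' : ℕ} (h : m' ≤ m) (h' : m + n ≤ m' + n') :
    window x m n <:+: window x m' n' := by
  obtain ⟨a, rfl⟩ := Int.le.dest h
  obtain ⟨b, rfl⟩ : ∃ b : ℕ, n' = a + n + b := ⟨n' - (a + n), by omega⟩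
  rw [window_add, window_add]
  exact ⟨_, _, rfl⟩

theorem prefix_drop_window {x : ℤ → A} {m : ℤ} {a b : ℕ} {v : List A} (h : a + v.length ≤ b) :
    v <+: (window x m b).drop a ↔ window x (m + a) v.length = v := by
  obtain ⟨c, rfl⟩ := Nat.exists_eq_add_of_le h
  rw [add_assoc, window_add, List.drop_left' (by simp), window_add]
  constructor
  · intro h
    exact ((List.prefix_of_prefix_length_le h (List.prefix_append _ _) (by simp)).eq_of_length
      (by simp)).symm
  · intro h
    rw [h]
    exact List.prefix_append _ _

theorem mem_substSeq_iff (hl : ∀ a, ∀ w ∈ θ a, w.length = ℓ) {x y : ℤ → A} :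
    x ∈ substSeq θ y ↔ ∀ j : ℤ, window x (j * ℓ) ℓ ∈ θ (y j) := by
  constructor
  · rintro ⟨v, hv, p, hp0, hp, hx⟩ j
    have hpj : ∀ j, p j = j * ℓ := by
      have hstep : ∀ j, p (j + 1) = p j + ℓ := fun j => by rw [hp, hl _ _ (hv j)]
      intro j
      induction j using Int.induction_on with
      | zero => simp [hp0]
      | succ i ih => rw [hstep, ih]; ring
      | pred i ih =>
        have := hstep (-(i : ℤ) - 1)
        rw [sub_add_cancel, ih] at this
        linarith
    have : window x (j * ℓ) ℓ = v j :=
      window_eq_iff.2 ⟨hl _ _ (hv j), fun t ht => by simpa [hpj] using hx j t ht⟩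
    rw [this]
    exact hv j
  · intro h
    refine ⟨fun j => window x (j * ℓ) ℓ, h, fun j => j * ℓ, by simp, fun j => by simp; ring, ?_⟩
    intro j t ht
    simp [getElem_window]

theorem window_mem_reals {x y : ℤ → A} {c : ℤ} (h : ∀ j : ℤ, window x (j * ℓ + c) ℓ ∈ θ (y j))
    (j : ℤ) (n : ℕ) : window x (j * ℓ + c) (ℓ * n) ∈ reals θ (window y j n) := by
  induction n generalizing j with
  | zero => simp [window, reals]
  | succ n ih =>
    rw [window_succ, Nat.mul_succ, add_comm (ℓ * n), window_add]
    refine mem_reals_cons.2 ⟨_, h j, _, ?_, rfl⟩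
    convert ih (j + 1) using 2
    ring

theorem substSeq_subset (hne : ∀ a, (θ a).Nonempty) (hℓ : 2 ≤ ℓ) {x y : ℤ → A}
    (hy : y ∈ Xtheta θ) (h : ∀ j : ℤ, window x (j * ℓ) ℓ ∈ θ (y j)) : x ∈ Xtheta θ := by
  intro m n
  have h' := window_mem_reals (c := 0) (by simpa using h) (m / ℓ) (n + 1)
  refine ((hy (m / ℓ) (n + 1)).of_mem_reals hne h').of_isInfix (window_isInfix x ?_ ?_)
  · simpa using Int.ediv_mul_le m (by omega)
  · have h1 := Int.emod_lt_of_pos m (show (0 : ℤ) < ℓ by omega)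
    have h2 := Int.mul_ediv_add_emod m ℓ
    have h3 : (n : ℤ) ≤ ℓ * n := by nlinarith
    push_cast
    nlinarith

/-- `x` is, up to shifting by `k < ℓ`, a realisation of the substitution applied to `y`. -/
def Decodes (θ : A → Finset (List A)) (ℓ : ℕ) (x y : ℤ → A) (k : ℕ) : Prop :=
  y ∈ Xtheta θ ∧ k < ℓ ∧ ∀ j : ℤ, window x (j * ℓ - k) ℓ ∈ θ (y j)

theorem decodes_iff (hne : ∀ a, (θ a).Nonempty) (hl : ∀ a, ∀ w ∈ θ a, w.length = ℓ)
    {x y : ℤ → A} {k : ℕ} :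
    (y ∈ Xtheta θ ∧ k < maxLen θ (y 0) ∧ (fun i => x (i - (k : ℤ))) ∈ substSeq θ y) ↔
      Decodes θ ℓ x y k := by
  have hmax : maxLen θ (y 0) = ℓ := by
    refine le_antisymm (Finset.sup_le fun w hw => (hl _ w hw).le) ?_
    obtain ⟨w, hw⟩ := hne (y 0)
    rw [← hl _ w hw]
    exact Finset.le_sup (f := List.length) hw
  rw [Decodes, hmax, mem_substSeq_iff hl]
  simp only [sub_eq_add_neg, window_translate]

theorem Recognisable.exists_decodes (hrec : Recognisable θ) (hne : ∀ a, (θ a).Nonempty)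
    (hl : ∀ a, ∀ w ∈ θ a, w.length = ℓ) {x : ℤ → A} (hx : x ∈ Xtheta θ) :
    ∃ y k, Decodes θ ℓ x y k := by
  obtain ⟨⟨y, k⟩, h, -⟩ := hrec x hx
  exact ⟨y, k, (decodes_iff hne hl).1 h⟩

theorem Recognisable.decodes_unique (hrec : Recognisable θ) (hne : ∀ a, (θ a).Nonempty)
    (hl : ∀ a, ∀ w ∈ θ a, w.length = ℓ) {x y y' : ℤ → A} {k k' : ℕ} (hx : x ∈ Xtheta θ)
    (h : Decodes θ ℓ x y k) (h' : Decodes θ ℓ x y' k') : y = y' ∧ k = k' := by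
  have := (hrec x hx).unique (y₁ := (y, k)) (y₂ := (y', k')) ((decodes_iff hne hl).2 h)
    ((decodes_iff hne hl).2 h')
  simpa using this

theorem translate_mem {x : ℤ → A} (hx : x ∈ Xtheta θ) (c : ℤ) :
    (fun i => x (i + c)) ∈ Xtheta θ := by
  intro m n
  rw [window_translate]
  exact hx _ _

/-- Prescribe the realisation of the first `m` letters of `z`, and use `g` elsewhere. -/
theorem exists_realisation (hne : ∀ a, (θ a).Nonempty) (hℓ : 2 ≤ ℓ)
    (hl : ∀ a, ∀ w ∈ θ a, w.length = ℓ) :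
    ∃ G : (ℤ → A) → List A → ℤ → A, ∀ (z : ℤ → A) (m : ℕ), z ∈ Xtheta θ →
      ∀ t ∈ reals θ (window z 0 m), (∀ j : ℤ, window (G z t) (j * ℓ) ℓ ∈ θ (z j)) ∧
        window (G z t) 0 (ℓ * m) = t ∧
        ∀ (z' : ℤ → A) (t' : List A), t' ∈ reals θ (window z' 0 m) →
          (∀ i : ℤ, i < 0 ∨ (m : ℤ) ≤ i → z i = z' i) →
          ∀ i : ℤ, i < 0 ∨ ((ℓ * m : ℕ) : ℤ) ≤ i → G z t i = G z' t' i := by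
  choose g hg using hne
  have hlen : ∀ a, (g a).length = ℓ := fun a => hl a _ (hg a)
  have hℓ' : (0 : ℤ) < ℓ := by omega
  refine ⟨fun z t i => if h : 0 ≤ i ∧ i.toNat < t.length then t[i.toNat]'h.2 else
    (g (z (i / ℓ)))[(i % ℓ).toNat]'(by
      rw [hlen]
      have h1 := Int.emod_nonneg i hℓ'.ne'
      have h2 := Int.emod_lt_of_pos i hℓ'
      omega), ?_⟩
  intro z m hz t ht
  have htl : t.length = ℓ * m := by simpa using length_of_mem_reals hl ht
  refine ⟨fun j => ?_, ?_, ?_⟩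
  · by_cases hj : 0 ≤ j ∧ j < m
    · obtain ⟨n, rfl⟩ := Int.eq_ofNat_of_zero_le hj.1
      obtain ⟨d, rfl⟩ : ∃ d, m = n + 1 + d := ⟨m - (n + 1), by omega⟩
      rw [window_add, window_add] at ht
      obtain ⟨_, h1, t₃, h3, rfl⟩ := mem_reals_append.1 ht
      obtain ⟨t₁, h1', t₂, h2, rfl⟩ := mem_reals_append.1 h1
      have e1 : t₁.length = ℓ * n := by simpa using length_of_mem_reals hl h1'
      have e2 : t₂ ∈ θ (z n) := by simpa [window, reals] using h2
      convert e2
      refine window_eq_iff.2 ⟨hl _ _ e2, fun i hi => ?_⟩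
      have hi' : i < ℓ := by rwa [hl _ _ e2] at hi
      have key : ((n : ℤ) * ℓ + i).toNat = t₁.length + i := by
        rw [e1, ← Nat.cast_mul, ← Nat.cast_add, Int.toNat_natCast, mul_comm]
      have hnn : (0:ℤ) ≤ (n : ℤ) * ℓ + i := by positivity
      beta_reduce
      rw [dif_pos ⟨hnn, by rw [key]; simp; omega⟩]
      simp only [key]
      rw [List.getElem_append_left (by simp; omega), List.getElem_append_right (by omega)]
      simp
    · have : window (fun i : ℤ => if h : 0 ≤ i ∧ i.toNat < t.length then t[i.toNat]'h.2 else
        (g (z (i / ℓ)))[(i % ℓ).toNat]'(by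
          rw [hlen]
          have h1 := Int.emod_nonneg i hℓ'.ne'
          have h2 := Int.emod_lt_of_pos i hℓ'
          omega)) (j * ℓ) ℓ = g (z j) := by
        refine window_eq_iff.2 ⟨hlen _, fun i hi => ?_⟩
        have hi' : i < ℓ := by rwa [hlen] at hi
        have hi'' : (i : ℤ) < ℓ := by omega
        have hnot : ¬ (0 ≤ j * ℓ + (i : ℤ) ∧ (j * ℓ + (i : ℤ)).toNat < t.length) := by
          rintro ⟨h0, h1⟩
          rw [htl, Int.toNat_lt h0] at h1
          push_cast at h1
          refine hj ⟨?_, ?_⟩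
          · by_contra hc
            nlinarith
          · by_contra hc
            nlinarith
        rw [dif_neg hnot]
        have e1 : (j * ℓ + (i : ℤ)) / ℓ = j := by
          rw [add_comm, Int.add_mul_ediv_right _ _ hℓ'.ne', Int.ediv_eq_zero_of_lt (by omega) hi'']
          simp
        have e2 : (j * ℓ + (i : ℤ)) % ℓ = i := by
          rw [add_comm, Int.add_mul_emod_self_right, Int.emod_eq_of_lt (by omega) hi'']
        simp only [e1, e2, Int.toNat_natCast]
      rw [this]
      exact hg _
  · refine window_eq_iff.2 ⟨htl, fun i hi => ?_⟩
    simp [hi]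
  · intro z' t' ht' hzz i hi
    have htl' : t'.length = ℓ * m := by simpa using length_of_mem_reals hl ht'
    have hnot : ∀ n : ℕ, n = ℓ * m → ¬ (0 ≤ i ∧ i.toNat < n) := by
      rintro _ rfl ⟨h0, h1⟩
      omega
    beta_reduce
    rw [dif_neg (hnot _ htl), dif_neg (hnot _ htl')]
    have : z (i / ℓ) = z' (i / ℓ) := by
      apply hzz
      rcases hi with hi | hi
      · left
        exact Int.ediv_lt_of_lt_mul hℓ' (by simpa using hi)
      · right
        refine Int.le_ediv_of_mul_le hℓ' ?_
        push_cast at hi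
        linarith
    simp only [this]

/-- Level-`n` images of two words placed in otherwise equal sequences determine the words. -/
theorem Recognisable.eq_of_common_image (hrec : Recognisable θ) (hne : ∀ a, (θ a).Nonempty)
    (hℓ : 2 ≤ ℓ) (hl : ∀ a, ∀ w ∈ θ a, w.length = ℓ) (n m : ℕ) (z z' : ℤ → A)
    (hz : z ∈ Xtheta θ) (hz' : z' ∈ Xtheta θ)
    (hzz : ∀ i : ℤ, i < 0 ∨ (m : ℤ) ≤ i → z i = z' i) (w : List A)
    (hw : w ∈ realsIter θ n (window z 0 m)) (hw' : w ∈ realsIter θ n (window z' 0 m)) :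
    window z 0 m = window z' 0 m := by
  induction n generalizing m z z' with
  | zero =>
    simp only [realsIter, Finset.mem_singleton] at hw hw'
    rw [← hw, ← hw']
  | succ n ih =>
    obtain ⟨G, hG⟩ := exists_realisation hne hℓ hl
    obtain ⟨t, ht, hwt⟩ := mem_realsIter_succ.1 hw
    obtain ⟨t', ht', hwt'⟩ := mem_realsIter_succ.1 hw'
    obtain ⟨h1, h2, h3⟩ := hG z m hz t ht
    obtain ⟨h1', h2', -⟩ := hG z' m hz' t' ht'
    have hX := substSeq_subset hne hℓ hz h1
    have hX' := substSeq_subset hne hℓ hz' h1'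
    have hout := h3 z' t' ht' hzz
    have heq := ih (ℓ * m) (G z t) (G z' t') hX hX' hout (by rwa [h2]) (by rwa [h2'])
    have hGG : G z t = G z' t' := by
      funext i
      by_cases hi : i < 0 ∨ ((ℓ * m : ℕ) : ℤ) ≤ i
      · exact hout i hi
      · push Not at hi
        obtain ⟨k, rfl⟩ := Int.eq_ofNat_of_zero_le hi.1
        have hk : k < ℓ * m := by exact_mod_cast hi.2
        have e1 := getElem_window (G z t) 0 (ℓ * m) k (by simpa using hk)
        have e2 := getElem_window (G z' t') 0 (ℓ * m) k (by simpa using hk)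
        simp only [zero_add] at e1 e2
        rw [← e1, ← e2]
        simp only [heq]
    have := (hrec.decodes_unique hne hl hX (k := 0) (k' := 0) ⟨hz, by omega, by simpa using h1⟩
      ⟨hz', by omega, by rw [hGG]; simpa using h1'⟩).1
    rw [this]

/-- Distinct realisations of a word occurring in `X_ϑ` have disjoint sets of images. -/
theorem Recognisable.reals_unique (hrec : Recognisable θ) (hne : ∀ a, (θ a).Nonempty)
    (hℓ : 2 ≤ ℓ) (hl : ∀ a, ∀ w ∈ θ a, w.length = ℓ) {y : ℤ → A} (hy : y ∈ Xtheta θ)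
    {m n : ℕ} {v v' w : List A} (hv : v ∈ reals θ (window y 0 m))
    (hv' : v' ∈ reals θ (window y 0 m)) (hw : w ∈ realsIter θ n v)
    (hw' : w ∈ realsIter θ n v') : v = v' := by
  obtain ⟨G, hG⟩ := exists_realisation hne hℓ hl
  obtain ⟨h1, h2, h3⟩ := hG y m hy v hv
  obtain ⟨h1', h2', -⟩ := hG y m hy v' hv'
  have := hrec.eq_of_common_image hne hℓ hl n (ℓ * m) (G y v) (G y v')
    (substSeq_subset hne hℓ hy h1) (substSeq_subset hne hℓ hy h1')
    (h3 y v' hv' fun _ _ => rfl) w (by rwa [h2]) (by rwa [h2'])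
  rwa [h2, h2'] at this

end Windows

section Frequencies

variable {θ : A → Finset (List A)} {P : A → List A → ℝ} {ℓ : ℕ}

/-- Indicator that `v` occurs at position `i`. -/
def occAt (v : List A) (i : ℕ) (w : List A) : ℝ := if v <+: w.drop i then 1 else 0

theorem occAt_nonneg (v : List A) (i : ℕ) (w : List A) : 0 ≤ occAt v i w := by
  rw [occAt]; split_ifs <;> norm_num

theorem occAt_append_left (v : List A) (i : ℕ) (s w : List A) :
    occAt v (s.length + i) (s ++ w) = occAt v i w := by
  simp [occAt]

theorem occAt_append_right {v : List A} {i : ℕ} {w : List A} (h : i + v.length ≤ w.length)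
    (t : List A) : occAt v i (w ++ t) = occAt v i w := by
  have : v <+: (w ++ t).drop i ↔ v <+: w.drop i := by
    rw [List.drop_append_of_le_length (by omega)]
    exact ⟨fun h' => List.prefix_of_prefix_length_le h' (List.prefix_append _ _)
      (by simp; omega), fun h' => h'.trans (List.prefix_append _ _)⟩
  simp only [occAt, this]

theorem occAt_le_append {v : List A} {i : ℕ} {w : List A} (h : i < w.length)
    (t : List A) : occAt v i w ≤ occAt v i (w ++ t) := by
  by_cases hp : v <+: w.drop i
  · have : v <+: (w ++ t).drop i := by
      rw [List.drop_append_of_le_length (by omega)]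
      exact hp.trans (List.prefix_append _ _)
    simp [occAt, hp, this]
  · simpa [occAt, hp] using occAt_nonneg v i (w ++ t)

theorem occCount_eq_sum (v w : List A) :
    (occCount v w : ℝ) = ∑ i ∈ Finset.range w.length, occAt v i w := by
  simp only [occAt]
  rw [Finset.sum_boole]
  norm_cast

theorem occCount_append_le (v s t : List A) :
    (occCount v s : ℝ) + occCount v t ≤ occCount v (s ++ t) := by
  simp only [occCount_eq_sum, List.length_append, Finset.sum_range_add, occAt_append_left]
  gcongr with i hi
  exact occAt_le_append (by simpa using hi) t

theorem occCount_singleton (b : A) (w : List A) : occCount [b] w = w.count b := by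
  have : (occCount [b] w : ℝ) = w.count b := by
    rw [occCount_eq_sum]
    induction w with
    | nil => simp
    | cons a w ih =>
      rw [List.length_cons, Finset.sum_range_succ', List.count_cons]
      have : ∀ i, occAt [b] (i + 1) (a :: w) = occAt [b] i w := fun i => by simp [occAt]
      simp only [this, ih]
      rcases eq_or_ne a b with h | h
      · simp [occAt, h]
      · simp [occAt, h, h.symm]
  exact_mod_cast this

theorem expIter_additive {f : List A → ℝ} (hnil : f [] = 0)
    (hf : ∀ s t, f (s ++ t) = f s + f t) (hs : ∀ a, ∑ w ∈ θ a, P a w = 1) (n : ℕ) (v : List A) :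
    expIter θ P n v f = (v.map fun a => expIter θ P n [a] f).sum := by
  induction v with
  | nil =>
    have : ∀ n, expIter θ P n [] f = f [] := by
      intro n
      induction n with
      | zero => rfl
      | succ n ih => simpa [expIter, expOne] using ih
    simp [this, hnil]
  | cons a v ih =>
    rw [← List.singleton_append, expIter_append]
    simp only [hf, expIter_add, expIter_const hs, ih]
    simp

theorem expIter_superadditive {f : List A → ℝ} (hnil : 0 ≤ f [])
    (hf : ∀ s t, f s + f t ≤ f (s ++ t)) (hP : ∀ a, ∀ w ∈ θ a, 0 < P a w)
    (hs : ∀ a, ∑ w ∈ θ a, P a w = 1) (n : ℕ) (v : List A) :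
    (v.map fun a => expIter θ P n [a] f).sum ≤ expIter θ P n v f := by
  induction v with
  | nil =>
    have : ∀ n, expIter θ P n [] f = f [] := by
      intro n
      induction n with
      | zero => rfl
      | succ n ih => simpa [expIter, expOne] using ih
    simp [this, hnil]
  | cons a v ih =>
    rw [← List.singleton_append, expIter_append, List.map_append, List.sum_append]
    calc _ ≤ expIter θ P n [a] f + expIter θ P n v f := by simpa using ih
      _ = expIter θ P n [a] fun s => expIter θ P n v fun t => f s + f t := by
        simp only [expIter_add, expIter_const hs]
      _ ≤ _ := expIter_mono hP fun s _ => expIter_mono hP fun t _ => hf s t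

theorem expIter_count (hs : ∀ a, ∑ w ∈ θ a, P a w = 1) (n : ℕ) (a b : A) :
    expIter θ P n [a] (fun w => (w.count b : ℝ)) = (substM θ P ^ n) b a := by
  induction n generalizing a with
  | zero =>
    by_cases h : a = b
    · simp [expIter, h]
    · simp [expIter, h, Ne.symm h]
  | succ n ih =>
    have hadd : ∀ v : List A, expIter θ P n v (fun w => (w.count b : ℝ)) =
        ∑ d, (substM θ P ^ n) b d * v.count d := by
      intro v
      rw [expIter_additive (by simp) (by simp) hs]
      simp only [ih]
      rw [Finset.sum_list_map_count, Finset.sum_subset (Finset.subset_univ _)]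
      · simp [mul_comm]
      · intro d _ hd
        simp at hd
        simp [List.count_eq_zero.2 hd]
    rw [expIter, pow_succ, Matrix.mul_apply]
    simp only [hadd, expOne, List.append_nil, Finset.mul_sum]
    rw [Finset.sum_comm]
    simp only [substM, Matrix.of_apply, Finset.mul_sum]
    exact Finset.sum_congr rfl fun d _ => Finset.sum_congr rfl fun w _ => by ring

theorem exists_expCount_letter_lower (hRS : IsRandomSubstitution θ P) (hprim : IsPrimitive θ P)
    (hl : ∀ a, ∀ w ∈ θ a, w.length = ℓ) [Nonempty A] :
    ∃ j : ℕ, ∃ m > 0, ∀ n (a b : A), m * (ℓ : ℝ) ^ n ≤ expCount θ P (n + j) a [b] := by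
  obtain ⟨-, -, hP, -, hs⟩ := hRS
  obtain ⟨j, hj⟩ := hprim
  obtain ⟨p, -, hp⟩ := Finset.exists_min_image (Finset.univ : Finset (A × A))
    (fun p => (substM θ P ^ j) p.1 p.2) Finset.univ_nonempty
  refine ⟨j, (substM θ P ^ j) p.1 p.2, hj _ _, fun n a b => ?_⟩
  rw [expCount_eq, expIter_comp]
  simp only [occCount_singleton]
  calc _ = expIter θ P n [a] (fun _ => (substM θ P ^ j) p.1 p.2 * (ℓ : ℝ) ^ n) :=
        (expIter_const hs _ _ _).symm
    _ ≤ _ := expIter_mono hP fun v hv => ?_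
  rw [expIter_additive (by simp) (by simp) hs]
  simp only [expIter_count hs]
  have hlen : ((v.length : ℕ) : ℝ) = (ℓ : ℝ) ^ n := by
    rw [length_of_mem_realsIter hl hv]; simp
  rw [← hlen]
  have := List.sum_le_sum (l := v) (f := fun _ => (substM θ P ^ j) p.1 p.2)
    (g := fun d => (substM θ P ^ j) b d) (fun d _ => hp (b, d) (Finset.mem_univ _))
  simpa [mul_comm] using this

/-- Legal words have positive asymptotic frequency. -/
theorem exists_expCount_lower (hRS : IsRandomSubstitution θ P) (hprim : IsPrimitive θ P)
    (hl : ∀ a, ∀ w ∈ θ a, w.length = ℓ) (hℓ : 2 ≤ ℓ) [Nonempty A] {u : List A}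
    (hu : Legal θ u) :
    ∃ j : ℕ, ∃ m > 0, ∀ n (a : A), m * (ℓ : ℝ) ^ (n + j) ≤ expCount θ P (n + j) a u := by
  obtain ⟨j, m, hm, h⟩ := exists_expCount_letter_lower hRS hprim hl
  obtain ⟨-, -, hP, -, hs⟩ := hRS
  obtain ⟨b, k, w, hw, s, t, rfl⟩ := hu
  have hℓ0 : (0 : ℝ) < ℓ := by positivity
  have hone : ∀ u : List A, u ≠ [] → 1 ≤ (occCount u (s ++ u ++ t) : ℝ) := by
    intro u hu0
    rw [occCount_eq_sum]
    have hmem : s.length ∈ Finset.range (s ++ u ++ t).length := by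
      have := List.length_pos_of_ne_nil hu0
      simp; omega
    refine le_trans ?_ (Finset.single_le_sum (fun i _ => occAt_nonneg _ _ _) hmem)
    simp [occAt]
  by_cases hu0 : u = []
  · subst hu0
    refine ⟨0, 1, one_pos, fun n a => ?_⟩
    rw [expCount_eq, expIter_congr (g := fun _ => (ℓ : ℝ) ^ n), expIter_const hs]
    · simp
    · intro w hw
      rw [occCount_eq_sum]
      simp [occAt, length_of_mem_realsIter hl hw]
  have hp0 := iterProb_pos hP hw
  set p₀ := iterProb θ P k [b] (s ++ u ++ t)
  refine ⟨j + k, m * p₀ / ℓ ^ (j + k), by positivity, fun n a => ?_⟩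
  have hb : p₀ ≤ expIter θ P k [b] fun w => (occCount u w : ℝ) := by
    rw [← sum_iterProb_mul]
    calc p₀ ≤ p₀ * (occCount u (s ++ u ++ t) : ℝ) := by nlinarith [hone u hu0]
      _ ≤ _ := Finset.single_le_sum (f := fun w => iterProb θ P k [b] w * (occCount u w : ℝ))
        (fun w _ => mul_nonneg (iterProb_nonneg hP _ _ _) (by positivity)) hw
  rw [expCount_eq, ← add_assoc, expIter_comp]
  calc m * p₀ / ℓ ^ (j + k) * (ℓ : ℝ) ^ (n + j + k) = p₀ * (m * ℓ ^ n) := by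
        field_simp; ring
    _ ≤ p₀ * expCount θ P (n + j) a [b] := by
      gcongr
      exact h n a b
    _ = expIter θ P (n + j) [a] fun v => p₀ * (v.count b : ℝ) := by
      rw [expCount_eq, expIter_mul_left]
      simp only [occCount_singleton]
    _ ≤ _ := expIter_mono hP fun v _ => ?_
  refine le_trans ?_ (expIter_superadditive (by positivity) (occCount_append_le u) hP hs k v)
  have hnn : ∀ d, 0 ≤ expIter θ P k [d] fun w => (occCount u w : ℝ) := by
    intro d
    have := expIter_mono (θ := θ) (P := P) hP (n := k) (u := [d]) (f := fun _ => 0)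
      (g := fun w => (occCount u w : ℝ)) (fun w _ => by positivity)
    rwa [expIter_const hs] at this
  clear * - hb hnn hp0
  induction v with
  | nil => simp
  | cons d v ih =>
    rw [List.count_cons, List.map_cons, List.sum_cons]
    by_cases hd : d = b
    · subst hd
      simp only [beq_self_eq_true, if_true]
      push_cast
      linarith
    · simp only [beq_iff_eq, hd, if_false, add_zero]
      linarith [hnn d]

variable [MeasurableSpace A] {μ : Measure (ℤ → A)}

theorem IsFrequencyMeasure.nonempty (hμ : IsFrequencyMeasure θ P μ) : Nonempty A := by
  have := hμ.1
  obtain ⟨x⟩ : Nonempty (ℤ → A) := by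
    by_contra h
    rw [not_nonempty_iff] at h
    have := measure_univ (μ := μ)
    simp [Set.univ_eq_empty_iff.2 h] at this
  exact ⟨x 0⟩

theorem IsFrequencyMeasure.tendsto (hμ : IsFrequencyMeasure θ P μ)
    (hRS : IsRandomSubstitution θ P) (hl : ∀ a, ∀ w ∈ θ a, w.length = ℓ) {v : List A}
    (hv : Legal θ v) (m : ℤ) (a : A) :
    Tendsto (fun k : ℕ => expCount θ P k a v / (ℓ : ℝ) ^ k) atTop
      (nhds ((μ (cylinder v m)).toReal)) := by
  have := hμ.2.2.2 v hv m a
  simpa only [expLen_eq hl hRS.2.2.2.2] using this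

theorem IsFrequencyMeasure.cylinder_pos (hμ : IsFrequencyMeasure θ P μ)
    (hRS : IsRandomSubstitution θ P) (hprim : IsPrimitive θ P)
    (hl : ∀ a, ∀ w ∈ θ a, w.length = ℓ) (hℓ : 2 ≤ ℓ) {v : List A} (hv : Legal θ v) (m : ℤ) :
    0 < (μ (cylinder v m)).toReal := by
  have := hμ.nonempty
  obtain ⟨a⟩ := hμ.nonempty
  obtain ⟨j, c, hc, h⟩ := exists_expCount_lower (θ := θ) hRS hprim hl hℓ hv
  refine hc.trans_le ?_
  refine ge_of_tendsto (hμ.tendsto hRS hl hv m a) ?_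
  filter_upwards [eventually_ge_atTop j] with k hk
  have hℓ0 : (0 : ℝ) < ℓ := by positivity
  rw [le_div_iff₀ (by positivity)]
  have := h (k - j) a
  rwa [Nat.sub_add_cancel hk] at this

theorem IsFrequencyMeasure.sum_letters (hμ : IsFrequencyMeasure θ P μ)
    (hRS : IsRandomSubstitution θ P) (hl : ∀ a, ∀ w ∈ θ a, w.length = ℓ) (hℓ : 2 ≤ ℓ) :
    ∑ b, (μ (cylinder [b] 0)).toReal = 1 := by
  obtain ⟨a⟩ := hμ.nonempty
  refine tendsto_nhds_unique (tendsto_finsetSum _ fun b _ =>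
    hμ.tendsto hRS hl (legal_singleton b) 0 a) ?_
  refine tendsto_const_nhds.congr fun k => ?_
  have hℓ0 : (0 : ℝ) < ℓ := by positivity
  rw [← Finset.sum_div, eq_div_iff (by positivity), one_mul]
  simp only [expCount_eq, occCount_singleton]
  rw [← expIter_finsum, expIter_congr (g := fun _ => (ℓ : ℝ) ^ k), expIter_const hRS.2.2.2.2]
  intro w hw
  have h1 : w.length = ∑ b, w.count b := by
    rw [← List.sum_toFinset_count_eq_length, Finset.sum_subset (Finset.subset_univ _)]
    intro d _ hd
    simp at hd
    simp [List.count_eq_zero.2 hd]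
  have h2 := length_of_mem_realsIter hl hw
  rw [h1] at h2
  simp only [List.length_singleton, mul_one] at h2
  exact_mod_cast h2

end Frequencies

section Language

variable {θ : A → Finset (List A)} {P : A → List A → ℝ} {ℓ : ℕ}
variable [MeasurableSpace A] {μ : Measure (ℤ → A)}

/-- A frequency measure can only live on the discrete measurable structure. -/
theorem IsFrequencyMeasure.measurableSingletonClass (hμ : IsFrequencyMeasure θ P μ)
    (hRS : IsRandomSubstitution θ P) (hprim : IsPrimitive θ P)
    (hl : ∀ a, ∀ w ∈ θ a, w.length = ℓ) (hℓ : 2 ≤ ℓ) : MeasurableSingletonClass A := by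
  have hprob := hμ.1
  have hcyl : ∀ (c : A) (x : ℤ → A), x ∈ cylinder [c] 0 ↔ x 0 = c := by
    intro c x
    simp [cylinder, window]
  have hsep : ∀ b b' : A, b' ≠ b → ∃ s : Set A, MeasurableSet s ∧ b ∈ s ∧ b' ∉ s := by
    intro b b' hne
    by_contra! hcon
    have hiff : ∀ s : Set A, MeasurableSet s → (b ∈ s ↔ b' ∈ s) := fun s hs =>
      ⟨hcon s hs, fun h => by_contra fun h' => hcon sᶜ hs.compl h' h⟩
    set σ : (ℤ → A) → ℤ → A := fun x => Function.update x 0 (Equiv.swap b b' (x 0))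
    have hσ : ∀ T : Set (ℤ → A), MeasurableSet T → ∀ x, x ∈ T ↔ σ x ∈ T := by
      let m₀ : MeasurableSpace (ℤ → A) :=
        { MeasurableSet' := fun T => ∀ x, x ∈ T ↔ σ x ∈ T
          measurableSet_empty := by simp
          measurableSet_compl := fun T hT x => by simp [← hT x]
          measurableSet_iUnion := fun f hf x => by simp [← hf _ x] }
      have hle : (MeasurableSpace.pi : MeasurableSpace (ℤ → A)) ≤ m₀ := by
        refine iSup_le fun i => ?_
        rintro _ ⟨s, hs, rfl⟩ x
        by_cases hi : i = 0
        · subst hi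
          simp only [σ, Set.mem_preimage, Function.update_self]
          rcases eq_or_ne (x 0) b with h | h
          · rw [h, Equiv.swap_apply_left]; exact hiff s hs
          rcases eq_or_ne (x 0) b' with h' | h'
          · rw [h', Equiv.swap_apply_right]; exact (hiff s hs).symm
          · rw [Equiv.swap_apply_of_ne_of_ne h h']
        · simp [σ, hi]
      exact fun T hT => hle T hT
    have hcover : (Set.univ : Set (ℤ → A)) ⊆
        ⋃ c ∈ (Finset.univ.erase b : Finset A), toMeasurable μ (cylinder [c] 0) := by
      intro x _
      simp only [Set.mem_iUnion]
      rcases eq_or_ne (x 0) b with h | h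
      · refine ⟨b', by simp [hne], ?_⟩
        rw [hσ _ (measurableSet_toMeasurable _ _)]
        apply subset_toMeasurable
        rw [hcyl]
        simp [σ, h]
      · exact ⟨x 0, by simp [h], subset_toMeasurable _ _ ((hcyl _ _).2 rfl)⟩
    have h1 : (1 : ℝ) ≤ ∑ c ∈ (Finset.univ.erase b : Finset A), (μ (cylinder [c] 0)).toReal := by
      calc (1 : ℝ) = μ.real Set.univ := by simp
        _ ≤ μ.real (⋃ c ∈ (Finset.univ.erase b : Finset A), toMeasurable μ (cylinder [c] 0)) :=
          measureReal_mono hcover (measure_ne_top _ _)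
        _ ≤ ∑ c ∈ (Finset.univ.erase b : Finset A), μ.real (toMeasurable μ (cylinder [c] 0)) :=
          measureReal_biUnion_finset_le _ _
        _ = _ := by simp [Measure.real, measure_toMeasurable]
    have h2 := hμ.sum_letters hRS hl hℓ
    rw [← Finset.add_sum_erase _ _ (Finset.mem_univ b)] at h2
    have h3 := hμ.cylinder_pos hRS hprim hl hℓ (legal_singleton b) 0
    linarith
  refine ⟨fun b => ?_⟩
  choose! s hs hb hb' using hsep b
  have : ({b} : Set A) = ⋂ b' ∈ {c | c ≠ b}, s b' := by
    ext c
    simp only [Set.mem_singleton_iff, Set.mem_iInter, Set.mem_ofPred_eq]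
    constructor
    · rintro rfl d hd
      exact hb d hd
    · intro h
      by_contra hc
      exact hb' c hc (h c hc)
  rw [this]
  exact MeasurableSet.biInter (Set.to_countable _) fun c hc => hs c hc

theorem cylinder_eq (v : List A) (m : ℤ) :
    cylinder v m = ⋂ t : Fin v.length, {x : ℤ → A | x (m + (t : ℕ)) = v[t]} := by
  ext x
  simp only [cylinder, Set.mem_ofPred_eq, window_eq_iff, true_and, Set.mem_iInter]
  exact ⟨fun h t => h t t.2, fun h t ht => h ⟨t, ht⟩⟩

theorem measurableSet_cylinder [MeasurableSingletonClass A] (v : List A) (m : ℤ) :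
    MeasurableSet (cylinder v m) := by
  rw [cylinder_eq]
  exact MeasurableSet.iInter fun t => measurableSet_eq_fun (measurable_pi_apply _) measurable_const

theorem measurableSet_window [MeasurableSingletonClass A] (m : ℤ) (n : ℕ) (p : List A → Prop) :
    MeasurableSet {x : ℤ → A | p (window x m n)} := by
  classical
  have : {x : ℤ → A | p (window x m n)} = ⋃ v ∈ (allWords A n).filter p, cylinder v m := by
    ext x
    simp only [Set.mem_ofPred_eq, Set.mem_iUnion, Finset.mem_filter, mem_allWords, cylinder]
    constructor
    · intro h
      exact ⟨window x m n, ⟨by simp, h⟩, by simp⟩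
    · rintro ⟨v, ⟨rfl, h⟩, hv⟩
      rwa [hv]
  rw [this]
  exact Finset.measurableSet_biUnion _ fun v _ => measurableSet_cylinder v m

theorem measurableSet_Xtheta [MeasurableSingletonClass A] : MeasurableSet (Xtheta θ) := by
  have : Xtheta θ = ⋂ (m : ℤ) (n : ℕ), {x | Legal θ (window x m n)} := by
    ext x; simp [Xtheta]
  rw [this]
  exact MeasurableSet.iInter fun m => MeasurableSet.iInter fun n => measurableSet_window m n _

/-- Every legal word occurs in the subshift. -/
theorem IsFrequencyMeasure.exists_mem_Xtheta (hμ : IsFrequencyMeasure θ P μ)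
    (hRS : IsRandomSubstitution θ P) (hprim : IsPrimitive θ P)
    (hl : ∀ a, ∀ w ∈ θ a, w.length = ℓ) (hℓ : 2 ≤ ℓ) {u : List A} (hu : Legal θ u) :
    ∃ x ∈ Xtheta θ, window x 0 u.length = u := by
  have hsing := hμ.measurableSingletonClass hRS hprim hl hℓ
  have hprob := hμ.1
  by_contra! hcon
  have hX : μ (Xtheta θ)ᶜ = 0 := (prob_compl_eq_zero_iff measurableSet_Xtheta).2 hμ.2.2.1
  have h0 : μ (cylinder u 0) = 0 := measure_mono_null (fun x hx hx' => hcon x hx' hx) hX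
  have := hμ.cylinder_pos hRS hprim hl hℓ hu 0
  simp [h0] at this

end Language

section Weights

variable {θ : A → Finset (List A)} {P : A → List A → ℝ} {ℓ : ℕ}

/-- Legal words are subwords of realisations of legal words of any prescribed large length. -/
theorem Recognisable.exists_parse (hrec : Recognisable θ) (hne : ∀ a, (θ a).Nonempty)
    (hl : ∀ a, ∀ w ∈ θ a, w.length = ℓ)
    (hext : ∀ u, Legal θ u → ∃ x ∈ Xtheta θ, window x 0 u.length = u)
    {u : List A} (hu : Legal θ u) {m : ℕ} (hm : ℓ + u.length ≤ ℓ * m) :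
    ∃ v, Legal θ v ∧ v.length = m ∧ ∃ s t, s.length < ℓ ∧ s ++ u ++ t ∈ reals θ v := by
  obtain ⟨x, hx, hxu⟩ := hext u hu
  obtain ⟨y, k, hy, hk, h⟩ := hrec.exists_decodes hne hl hx
  refine ⟨window y 0 m, hy 0 m, by simp, ?_⟩
  have hmem := window_mem_reals (c := -(k : ℤ)) (by simpa only [sub_eq_add_neg] using h) 0 m
  obtain ⟨d, hd⟩ : ∃ d, ℓ * m = k + u.length + d := ⟨ℓ * m - (k + u.length), by omega⟩
  rw [hd, window_add, window_add] at hmem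
  simp only [zero_mul, zero_add, neg_add_cancel, hxu] at hmem
  exact ⟨_, _, by simpa using hk, hmem⟩

/-- The total weight of a word. -/
def weight (ψ : A → ℝ) (u : List A) : ℝ := (u.map ψ).sum

@[simp] theorem weight_nil (ψ : A → ℝ) : weight ψ [] = 0 := rfl

@[simp] theorem weight_cons (ψ : A → ℝ) (a : A) (u : List A) :
    weight ψ (a :: u) = ψ a + weight ψ u := by simp [weight]

@[simp] theorem weight_append (ψ : A → ℝ) (u v : List A) :
    weight ψ (u ++ v) = weight ψ u + weight ψ v := by simp [weight]

theorem abs_weight_sub_le {ψ : A → ℝ} {c B : ℝ} (h : ∀ a, |ψ a - c| ≤ B) (u : List A) :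
    |weight ψ u - c * u.length| ≤ B * u.length := by
  induction u with
  | nil => simp
  | cons a u ih =>
    simp only [weight_cons, List.length_cons, Nat.cast_add, Nat.cast_one]
    have : ψ a + weight ψ u - c * (u.length + 1) = (ψ a - c) + (weight ψ u - c * u.length) := by
      ring
    rw [this]
    linarith [abs_add_le (ψ a - c) (weight ψ u - c * u.length), h a]

theorem weight_eq_sum_count (ψ : A → ℝ) (u : List A) :
    weight ψ u = ∑ b, ψ b * u.count b := by
  rw [weight, Finset.sum_list_map_count, Finset.sum_subset (Finset.subset_univ _)]
  · simp [mul_comm]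
  · intro d _ hd
    simp at hd
    simp [List.count_eq_zero.2 hd]

/-- The logarithm of the number of realisations of a letter. -/
noncomputable def logCard (θ : A → Finset (List A)) (a : A) : ℝ := Real.log (θ a).card

theorem log_numReals (hne : ∀ a, (θ a).Nonempty) (u : List A) :
    Real.log (numReals θ u) = weight (logCard θ) u := by
  induction u with
  | nil => simp [numReals]
  | cons a u ih =>
    have h1 : (0 : ℝ) < (θ a).card := by exact_mod_cast (hne a).card_pos
    have h2 : (0 : ℝ) < numReals θ u := by exact_mod_cast numReals_pos hne u
    rw [weight_cons, ← ih, logCard, ← Real.log_mul h1.ne' h2.ne']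
    simp [numReals]

/-- The weight `ψ` has uniform average `c` along legal words. -/
def UniformWeight (θ : A → Finset (List A)) (ψ : A → ℝ) (c : ℝ) : Prop :=
  ∀ ε > 0, ∃ N : ℕ, ∀ u, Legal θ u → N ≤ u.length → |weight ψ u - c * u.length| ≤ ε * u.length

theorem uniformWeight_const {ψ : A → ℝ} {c : ℝ} (h : ∀ a, ψ a = c) : UniformWeight θ ψ c := by
  intro ε hε
  refine ⟨0, fun u _ _ => abs_weight_sub_le (fun a => ?_) u⟩
  simp [h a, hε.le]

theorem weight_of_mem_reals_compatible (hcomp : Compatible θ)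
    (hs : ∀ a, ∑ w ∈ θ a, P a w = 1) (ψ : A → ℝ) {u w : List A} (h : w ∈ reals θ u) :
    weight ψ w = weight (fun a => expOne θ P [a] (weight ψ)) u := by
  induction u generalizing w with
  | nil => simp_all [reals]
  | cons a u ih =>
    obtain ⟨v, hv, t, ht, rfl⟩ := mem_reals_cons.1 h
    rw [weight_append, weight_cons, ih ht]
    congr 1
    have : expOne θ P [a] (weight ψ) = expOne θ P [a] fun _ => weight ψ v := by
      refine expOne_congr fun s hs => ?_
      have hs' : s ∈ θ a := by simpa [reals] using hs
      simp only [weight_eq_sum_count, hcomp a s hs' v hv]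
    rw [this, expOne_const hs]

theorem exists_ancestor (hrec : Recognisable θ) (hne : ∀ a, (θ a).Nonempty) (hℓ : 2 ≤ ℓ)
    (hl : ∀ a, ∀ w ∈ θ a, w.length = ℓ) (hs : ∀ a, ∑ w ∈ θ a, P a w = 1)
    (hext : ∀ u, Legal θ u → ∃ x ∈ Xtheta θ, window x 0 u.length = u)
    (hcomp : Compatible θ) (ψ : A → ℝ) (n : ℕ) :
    ∃ C : ℝ, ∀ u, Legal θ u → ∃ v, Legal θ v ∧
      |weight ψ u - weight (fun a => expIter θ P n [a] (weight ψ)) v| ≤ C ∧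
      |(u.length : ℝ) - ℓ ^ n * v.length| ≤ C := by
  induction n with
  | zero =>
    refine ⟨0, fun u hu => ⟨u, hu, ?_, by simp⟩⟩
    simp [expIter, weight]
  | succ n ih =>
    obtain ⟨C, hC⟩ := ih
    set ψn : A → ℝ := fun a => expIter θ P n [a] (weight ψ) with hψn
    have hstep : ∀ a, expIter θ P (n + 1) [a] (weight ψ) = expOne θ P [a] (weight ψn) := by
      intro a
      rw [expIter]
      congr 1
      funext v
      exact expIter_additive (by simp) (by simp) hs n v
    set B : ℝ := ∑ a, |ψn a| with hB
    have hB0 : 0 ≤ B := Finset.sum_nonneg fun _ _ => abs_nonneg _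
    have hψB : ∀ a, |ψn a - 0| ≤ B := fun a => by
      rw [sub_zero]
      exact Finset.single_le_sum (f := fun a => |ψn a|) (fun _ _ => abs_nonneg _)
        (Finset.mem_univ a)
    refine ⟨C + B * (2 * ℓ) + ℓ ^ n * (2 * ℓ), fun u hu => ?_⟩
    obtain ⟨v, hv, h1, h2⟩ := hC u hu
    have hdiv := Nat.div_add_mod v.length ℓ
    have hmod := Nat.mod_lt v.length (show 0 < ℓ by omega)
    obtain ⟨v', hv', hlen, s, t, -, hst⟩ := hrec.exists_parse hne hl hext hv
      (m := v.length / ℓ + 2) (by rw [Nat.mul_add]; omega)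
    have hw := weight_of_mem_reals_compatible (P := P) hcomp hs ψn hst
    have hL := length_of_mem_reals hl hst
    simp only [List.length_append] at hL
    have hst' : s.length + t.length ≤ 2 * ℓ := by
      rw [hlen, Nat.mul_add] at hL; omega
    have hst'' : (s.length : ℝ) + t.length ≤ 2 * ℓ := by exact_mod_cast hst'
    have hC0 : 0 ≤ C := (abs_nonneg _).trans h1
    refine ⟨v', hv', ?_, ?_⟩
    · simp only [hstep]
      rw [← hw]
      simp only [weight_append]
      have e1 := abs_weight_sub_le hψB s
      have e2 := abs_weight_sub_le hψB t
      simp only [zero_mul, sub_zero] at e1 e2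
      rw [abs_le] at *
      have : B * s.length + B * t.length ≤ B * (2 * ℓ) := by rw [← mul_add]; gcongr
      have : (0:ℝ) ≤ ℓ ^ n * (2 * ℓ) := by positivity
      constructor <;> linarith
    · have hL' : (s.length : ℝ) + v.length + t.length = ℓ * v'.length := by exact_mod_cast hL
      have e : (u.length : ℝ) - ℓ ^ (n + 1) * v'.length =
          (u.length - ℓ ^ n * v.length) - ℓ ^ n * (s.length + t.length) := by
        rw [pow_succ, mul_assoc, ← hL']; ring
      have : (ℓ : ℝ) ^ n * (s.length + t.length) ≤ ℓ ^ n * (2 * ℓ) := by gcongr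
      have : (0 : ℝ) ≤ (ℓ : ℝ) ^ n * (s.length + t.length) := by positivity
      have : 0 ≤ B * (2 * ℓ) := by positivity
      rw [e]
      rw [abs_le] at *
      constructor <;> linarith

theorem IsFrequencyMeasure.exists_uniformWeight [MeasurableSpace A] {μ : Measure (ℤ → A)}
    (hμ : IsFrequencyMeasure θ P μ) (hRS : IsRandomSubstitution θ P) (hrec : Recognisable θ)
    (hℓ : 2 ≤ ℓ) (hl : ∀ a, ∀ w ∈ θ a, w.length = ℓ)
    (hext : ∀ u, Legal θ u → ∃ x ∈ Xtheta θ, window x 0 u.length = u)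
    (hcomp : Compatible θ) (ψ : A → ℝ) : ∃ c, UniformWeight θ ψ c := by
  have hs := hRS.2.2.2.2
  have hℓ0 : (0 : ℝ) < ℓ := by positivity
  set c := ∑ b, ψ b * (μ (cylinder [b] 0)).toReal with hc
  refine ⟨c, fun ε hε => ?_⟩
  have hlim : ∀ a, Tendsto (fun n => expIter θ P n [a] (weight ψ) / (ℓ : ℝ) ^ n) atTop
      (nhds c) := by
    intro a
    have : ∀ n, expIter θ P n [a] (weight ψ) / (ℓ : ℝ) ^ n =
        ∑ b, ψ b * (expCount θ P n a [b] / (ℓ : ℝ) ^ n) := by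
      intro n
      have : weight ψ = fun w => ∑ b, ψ b * (w.count b : ℝ) := funext (weight_eq_sum_count ψ)
      rw [this, expIter_sum, Finset.sum_div]
      simp only [expCount_eq, occCount_singleton, mul_div_assoc]
    simp only [this]
    exact tendsto_finsetSum _ fun b _ =>
      (hμ.tendsto hRS hl (legal_singleton b) 0 a).const_mul _
  have hev : ∀ᶠ n in atTop, ∀ a, |expIter θ P n [a] (weight ψ) / (ℓ : ℝ) ^ n - c| ≤ ε / 4 := by
    rw [eventually_all]
    intro a
    have := (hlim a).sub_const c
    rw [sub_self] at this
    filter_upwards [this.abs.eventually (eventually_le_nhds (b := ε / 4) (by simpa using hε))]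
      with n hn
    exact hn
  obtain ⟨n, hn⟩ := hev.exists
  obtain ⟨C, hC⟩ := exists_ancestor (P := P) hrec hRS.1 hℓ hl hs hext hcomp ψ n
  obtain ⟨N, hN⟩ := exists_nat_ge ((C + |c| * C + ε / 4 * C) / (ε / 2))
  refine ⟨N, fun u hu hNu => ?_⟩
  obtain ⟨v, -, h1, h2⟩ := hC u hu
  have h3 := abs_weight_sub_le (ψ := fun a => expIter θ P n [a] (weight ψ)) (c := c * ℓ ^ n)
    (B := ε / 4 * ℓ ^ n) (fun a => by
      have := hn a
      rw [show expIter θ P n [a] (weight ψ) - c * ℓ ^ n =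
        (expIter θ P n [a] (weight ψ) / (ℓ : ℝ) ^ n - c) * ℓ ^ n by field_simp, abs_mul,
        abs_of_pos (show (0 : ℝ) < (ℓ : ℝ) ^ n by positivity)]
      gcongr) v
  have hbig : C + |c| * C + ε / 4 * C ≤ ε / 2 * u.length := by
    rw [div_le_iff₀ (by positivity)] at hN
    have : (N : ℝ) ≤ u.length := by exact_mod_cast hNu
    nlinarith
  have h4 : |c * (ℓ ^ n * v.length - u.length)| ≤ |c| * C := by
    rw [abs_mul, abs_sub_comm]
    gcongr
  have h5 : ε / 4 * (ℓ ^ n * v.length) ≤ ε / 4 * (u.length + C) := by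
    rw [abs_le] at h2
    gcongr
    linarith
  have h6 : (0 : ℝ) ≤ ε * u.length := by positivity
  rw [abs_le] at *
  constructor <;> linarith

end Weights

theorem negMulLog_add_mul_log_le {p q : ℝ} (hp : 0 ≤ p) (hq : 0 ≤ q) (hpq : q = 0 → p = 0) :
    Real.negMulLog p + p * Real.log q ≤ q - p := by
  rcases hp.eq_or_lt with rfl | hp
  · simpa using hq
  have hq : 0 < q := hq.lt_of_ne fun h => hp.ne' (hpq h.symm)
  have h := mul_le_mul_of_nonneg_left (Real.log_le_sub_one_of_pos (div_pos hq hp)) hp.le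
  rw [Real.log_div hq.ne' hp.ne', mul_sub, mul_sub, mul_div_cancel₀ _ hp.ne', mul_one] at h
  rw [Real.negMulLog]
  linarith

theorem eq_of_negMulLog_add_mul_log_eq {p q : ℝ} (hp : 0 ≤ p) (hq : 0 ≤ q) (hpq : q = 0 → p = 0)
    (h : Real.negMulLog p + p * Real.log q = q - p) : p = q := by
  rcases hp.eq_or_lt with rfl | hp
  · simp at h
    exact h
  have hq : 0 < q := hq.lt_of_ne fun h => hp.ne' (hpq h.symm)
  by_contra hne
  have h1 : q / p ≠ 1 := by
    intro h1
    rw [div_eq_one_iff_eq hp.ne'] at h1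
    exact hne h1.symm
  have h2 := mul_lt_mul_of_pos_left (Real.log_lt_sub_one_of_pos (div_pos hq hp) h1) hp
  rw [Real.log_div hq.ne' hp.ne', mul_sub, mul_sub, mul_div_cancel₀ _ hp.ne', mul_one] at h2
  rw [Real.negMulLog] at h
  linarith

/-- Gibbs' inequality. -/
theorem sum_negMulLog_le {ι : Type*} {s : Finset ι} {p q : ι → ℝ} (hp : ∀ i ∈ s, 0 ≤ p i)
    (hq : ∀ i ∈ s, 0 ≤ q i) (hpq : ∀ i ∈ s, q i = 0 → p i = 0)
    (hsum : ∑ i ∈ s, q i ≤ ∑ i ∈ s, p i) :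
    ∑ i ∈ s, Real.negMulLog (p i) ≤ -∑ i ∈ s, p i * Real.log (q i) := by
  have := Finset.sum_le_sum fun i hi => negMulLog_add_mul_log_le (hp i hi) (hq i hi) (hpq i hi)
  rw [Finset.sum_add_distrib, Finset.sum_sub_distrib] at this
  linarith

/-- The equality case of Gibbs' inequality. -/
theorem eq_of_sum_negMulLog_ge {ι : Type*} {s : Finset ι} {p q : ι → ℝ}
    (hp : ∀ i ∈ s, 0 ≤ p i) (hq : ∀ i ∈ s, 0 ≤ q i) (hpq : ∀ i ∈ s, q i = 0 → p i = 0)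
    (hsum : ∑ i ∈ s, q i ≤ ∑ i ∈ s, p i)
    (h : -∑ i ∈ s, p i * Real.log (q i) ≤ ∑ i ∈ s, Real.negMulLog (p i)) :
    ∀ i ∈ s, p i = q i := by
  have hle := fun i hi => negMulLog_add_mul_log_le (hp i hi) (hq i hi) (hpq i hi)
  have hsle := Finset.sum_le_sum hle
  have heq : ∑ i ∈ s, (Real.negMulLog (p i) + p i * Real.log (q i)) = ∑ i ∈ s, (q i - p i) := by
    refine le_antisymm hsle ?_
    rw [Finset.sum_add_distrib, Finset.sum_sub_distrib]
    linarith
  exact fun i hi => eq_of_negMulLog_add_mul_log_eq (hp i hi) (hq i hi) (hpq i hi)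
    ((Finset.sum_eq_sum_iff_of_le hle).1 heq i hi)

theorem negMulLog_sum_le {ι : Type*} {s : Finset ι} {p : ι → ℝ} (hp : ∀ i ∈ s, 0 ≤ p i) :
    Real.negMulLog (∑ i ∈ s, p i) ≤ ∑ i ∈ s, Real.negMulLog (p i) := by
  have h : Real.negMulLog (∑ i ∈ s, p i) = ∑ i ∈ s, -(p i * Real.log (∑ j ∈ s, p j)) := by
    rw [Finset.sum_neg_distrib, ← Finset.sum_mul, Real.negMulLog, neg_mul]
  rw [h]
  refine Finset.sum_le_sum fun i hi => ?_
  rw [Real.negMulLog, neg_mul, neg_le_neg_iff]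
  rcases (hp i hi).eq_or_lt with h0 | h0
  · simp [← h0]
  · exact mul_le_mul_of_nonneg_left
      (Real.log_le_log h0 (Finset.single_le_sum hp hi)) h0.le

theorem sum_negMulLog_le_log_card {ι : Type*} {s : Finset ι} {p : ι → ℝ}
    (hp : ∀ i ∈ s, 0 ≤ p i) (hsum : ∑ i ∈ s, p i = 1) :
    ∑ i ∈ s, Real.negMulLog (p i) ≤ Real.log s.card := by
  have hs : s.Nonempty := by
    rw [Finset.nonempty_iff_ne_empty]
    rintro rfl
    simp at hsum
  have hc : (0 : ℝ) < s.card := by exact_mod_cast hs.card_pos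
  have h := sum_negMulLog_le (s := s) (p := p) (q := fun _ => (s.card : ℝ)⁻¹) hp
    (fun _ _ => by positivity) (fun _ _ h => absurd h (by positivity))
    (by rw [Finset.sum_const, nsmul_eq_mul, mul_inv_cancel₀ hc.ne', hsum])
  rwa [← Finset.sum_mul, hsum, one_mul, Real.log_inv, neg_neg] at h

theorem isBoundedUnder_div_of_le {b : ℕ → ℝ} {B : ℝ} (hb : ∀ n : ℕ, b n ≤ B * n) :
    IsBoundedUnder (· ≤ ·) atTop fun n : ℕ => b n / (n : ℝ) := by
  refine isBoundedUnder_of_eventually_le (a := B) ?_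
  filter_upwards [eventually_gt_atTop 0] with n hn
  have : (0 : ℝ) < n := by exact_mod_cast hn
  rw [div_le_iff₀ this]
  exact hb n

theorem isCoboundedUnder_div_of_nonneg {b : ℕ → ℝ} (hb : ∀ n : ℕ, 0 ≤ b n) :
    IsCoboundedUnder (· ≤ ·) atTop fun n : ℕ => b n / (n : ℝ) :=
  (isBoundedUnder_of_eventually_ge (a := 0)
    (Eventually.of_forall fun n => div_nonneg (hb n) n.cast_nonneg)).isCoboundedUnder_le

theorem limsup_div_nonneg {b : ℕ → ℝ} {B : ℝ} (hb : ∀ n : ℕ, 0 ≤ b n)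
    (hB : ∀ n : ℕ, b n ≤ B * n) : 0 ≤ limsup (fun n : ℕ => b n / (n : ℝ)) atTop :=
  le_limsup_of_frequently_le
    (Frequently.of_forall fun n => div_nonneg (hb n) n.cast_nonneg) (isBoundedUnder_div_of_le hB)

/-- Comparison of growth rates at scales differing by a factor `ℓ`. -/
theorem limsup_div_le_of_scale {a b : ℕ → ℝ} {ℓ k : ℕ} {B C d : ℝ} (hℓ : 0 < ℓ) (hk : 0 < k)
    (hd : 0 ≤ d) (ha : ∀ n, 0 ≤ a n) (hb : ∀ n, 0 ≤ b n) (hB : ∀ n : ℕ, b n ≤ B * n)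
    (hab : ∀ᶠ n in atTop, a n ≤ C + b (k * (n / (ℓ * k) + 2))
      + d * (k * (n / (ℓ * k) + 2) : ℕ)) :
    limsup (fun n : ℕ => a n / (n : ℝ)) atTop
      ≤ (limsup (fun n : ℕ => b n / (n : ℝ)) atTop + d) / ℓ := by
  have ht0 := limsup_div_nonneg hb hB
  generalize ht : limsup (fun n : ℕ => b n / (n : ℝ)) atTop = t at ht0 ⊢
  have hℓ' : (0 : ℝ) < ℓ := by exact_mod_cast hℓ
  have hk' : (0 : ℝ) < k := by exact_mod_cast hk
  refine le_of_forall_pos_le_add fun ε hε => ?_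
  refine limsup_le_of_le (isCoboundedUnder_div_of_nonneg ha) ?_
  have hbm : ∀ᶠ m : ℕ in atTop, b m / m < t + ℓ * (ε / 2) :=
    eventually_lt_of_limsup_lt (ht.trans_lt (lt_add_of_pos_right _ (by positivity)))
      (isBoundedUnder_div_of_le hB)
  have hm : Tendsto (fun n => k * (n / (ℓ * k) + 2)) atTop atTop := by
    refine tendsto_atTop_mono (fun n => ?_)
      (Nat.tendsto_div_const_atTop (n := ℓ * k) (mul_pos hℓ hk).ne')
    exact (Nat.le_add_right _ 2).trans (Nat.le_mul_of_pos_left _ hk)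
  obtain ⟨N, hN⟩ := exists_nat_ge ((C + (t + ℓ * (ε / 2) + d) * (2 * k)) / (ε / 2))
  filter_upwards [hab, hm.eventually hbm, eventually_gt_atTop 0, eventually_ge_atTop N]
    with n h1 h2 hn hNn
  have hn' : (0 : ℝ) < n := by exact_mod_cast hn
  set m := k * (n / (ℓ * k) + 2) with hmdef
  have hm0 : (0 : ℝ) < m := by
    have : 0 < m := by positivity
    exact_mod_cast this
  have hmle : (m : ℝ) ≤ n / ℓ + 2 * k := by
    have h3 : (n / (ℓ * k) : ℕ) * (ℓ * k) ≤ n := Nat.div_mul_le_self _ _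
    have h4 : ((n / (ℓ * k) : ℕ) : ℝ) * (ℓ * k) ≤ n := by exact_mod_cast h3
    have h5 : (k : ℝ) * (n / (ℓ * k) : ℕ) ≤ n / ℓ := by
      rw [le_div_iff₀ hℓ']
      linarith
    rw [hmdef]
    push_cast
    linarith
  rw [div_lt_iff₀ hm0] at h2
  rw [div_le_iff₀ hn']
  have h6 : a n ≤ C + (t + ℓ * (ε / 2) + d) * (n / ℓ + 2 * k) := by
    have : (t + ℓ * (ε / 2) + d) * m ≤ (t + ℓ * (ε / 2) + d) * (n / ℓ + 2 * k) :=
      mul_le_mul_of_nonneg_left hmle (by positivity)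
    linarith
  have h7 : C + (t + ℓ * (ε / 2) + d) * (2 * k) ≤ ε / 2 * n := by
    have : (C + (t + ℓ * (ε / 2) + d) * (2 * k)) / (ε / 2) ≤ n := hN.trans (by exact_mod_cast hNn)
    rw [div_le_iff₀ (half_pos hε)] at this
    linarith
  have h8 : (t + ℓ * (ε / 2) + d) * (n / ℓ) = ((t + d) / ℓ + ε / 2) * n := by
    field_simp
    ring
  nlinarith

theorem log_card_legalWords_le (θ : A → Finset (List A)) (n : ℕ) :
    Real.log (legalWords θ n).card ≤ Real.log (Fintype.card A) * n := by
  have h1 : (legalWords θ n).card ≤ Fintype.card A ^ n := by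
    calc (legalWords θ n).card ≤ (allWords A n).card :=
          Finset.card_le_card fun v hv => mem_allWords.2 (mem_legalWords.1 hv).1
      _ ≤ (Finset.univ : Finset (Fin n → A)).card := Finset.card_image_le
      _ = Fintype.card A ^ n := by simp
  rcases Nat.eq_zero_or_pos (legalWords θ n).card with h | h
  · rw [h]
    simp only [Nat.cast_zero, Real.log_zero]
    positivity
  · have : Real.log (legalWords θ n).card ≤ Real.log ((Fintype.card A : ℝ) ^ n) :=
      Real.log_le_log (by exact_mod_cast h) (by exact_mod_cast h1)
    rwa [Real.log_pow, mul_comm] at this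

section Measures

variable [MeasurableSpace A] {θ : A → Finset (List A)} {ℓ : ℕ} {ν : Measure (ℤ → A)}

theorem sum_measureReal_inter_fiber {Ω β : Type*} [MeasurableSpace Ω] (ν : Measure Ω)
    [IsFiniteMeasure ν] (S : Finset β) (f : Ω → β) (hf : ∀ b ∈ S, MeasurableSet {x | f x = b})
    {B : Set Ω} (hB : MeasurableSet B) (hBS : ∀ x ∈ B, f x ∈ S) :
    ∑ b ∈ S, ν.real (B ∩ {x | f x = b}) = ν.real B := by
  rw [← measureReal_biUnion_finset (s := S) (f := fun b => B ∩ {x | f x = b})]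
  · congr 1
    ext x
    simp only [Set.mem_iUnion, Set.mem_inter_iff, Set.mem_ofPred_eq, exists_prop]
    exact ⟨fun ⟨_, _, h, _⟩ => h, fun h => ⟨f x, hBS x h, h, rfl⟩⟩
  · intro b _ b' _ hne
    refine Set.disjoint_left.2 fun x hx hx' => hne ?_
    exact hx.2.symm.trans hx'.2
  · exact fun b hb => hB.inter (hf b hb)

variable [MeasurableSingletonClass A]

theorem measurableSet_window_eq (m : ℤ) (n : ℕ) (v : List A) :
    MeasurableSet {x : ℤ → A | window x m n = v} :=
  measurableSet_window m n (· = v)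

theorem sum_measureReal_window [IsFiniteMeasure ν] {B : Set (ℤ → A)} (hB : MeasurableSet B)
    (m : ℤ) (n : ℕ) :
    ∑ v ∈ allWords A n, ν.real (B ∩ {x | window x m n = v}) = ν.real B :=
  sum_measureReal_inter_fiber ν _ _ (fun _ _ => measurableSet_window_eq m n _) hB
    fun x _ => mem_allWords.2 (length_window x m n)

theorem sum_cylinder [IsProbabilityMeasure ν] (m : ℤ) (n : ℕ) :
    ∑ v ∈ allWords A n, (ν (cylinder v m)).toReal = 1 := by
  rw [← probReal_univ (μ := ν), ← sum_measureReal_window MeasurableSet.univ m n]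
  refine Finset.sum_congr rfl fun v hv => ?_
  rw [Set.univ_inter, ← mem_allWords.1 hv]
  rfl

theorem cylinder_eq_zero [IsProbabilityMeasure ν] (hν : ν (Xtheta θ) = 1) {v : List A}
    (hv : ¬Legal θ v) (m : ℤ) : ν (cylinder v m) = 0 := by
  refine measure_mono_null (t := (Xtheta θ)ᶜ) (fun x hx hxX => hv ?_)
    ((prob_compl_eq_zero_iff measurableSet_Xtheta).2 hν)
  have := hxX m v.length
  rwa [show window x m v.length = v from hx] at this

theorem sum_cylinder_legal [IsProbabilityMeasure ν] (hν : ν (Xtheta θ) = 1) (m : ℤ) (n : ℕ) :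
    ∑ v ∈ legalWords θ n, (ν (cylinder v m)).toReal = 1 := by
  rw [← sum_cylinder (ν := ν) m n]
  refine Finset.sum_subset (fun v hv => mem_allWords.2 (mem_legalWords.1 hv).1) fun v hv hv' => ?_
  rw [cylinder_eq_zero hν fun h => hv' (mem_legalWords.2 ⟨mem_allWords.1 hv, h⟩)]
  rfl

theorem entropySeq_eq [IsProbabilityMeasure ν] (hν : ν (Xtheta θ) = 1) (n : ℕ) :
    entropySeq θ ν n = ∑ u ∈ allWords A n, Real.negMulLog ((ν (cylinder u 0)).toReal) := by
  refine Finset.sum_subset (fun v hv => mem_allWords.2 (mem_legalWords.1 hv).1) fun v hv hv' => ?_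
  rw [cylinder_eq_zero hν fun h => hv' (mem_legalWords.2 ⟨mem_allWords.1 hv, h⟩)]
  simp

theorem toReal_cylinder_le_one [IsProbabilityMeasure ν] (v : List A) (m : ℤ) :
    (ν (cylinder v m)).toReal ≤ 1 := by
  have := prob_le_one (μ := ν) (s := cylinder v m)
  exact ENNReal.toReal_le_of_le_ofReal zero_le_one (by simpa using this)

theorem entropySeq_nonneg [IsProbabilityMeasure ν] (n : ℕ) : 0 ≤ entropySeq θ ν n :=
  Finset.sum_nonneg fun _ _ =>
    Real.negMulLog_nonneg ENNReal.toReal_nonneg (toReal_cylinder_le_one _ _)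

theorem entropySeq_le_log_card [IsProbabilityMeasure ν] (hν : ν (Xtheta θ) = 1) (n : ℕ) :
    entropySeq θ ν n ≤ Real.log (legalWords θ n).card :=
  sum_negMulLog_le_log_card (fun _ _ => ENNReal.toReal_nonneg) (sum_cylinder_legal hν 0 n)

theorem measEntropy_le_topEntropy [IsProbabilityMeasure ν] (hν : ν (Xtheta θ) = 1) :
    measEntropy θ ν ≤ topEntropy θ := by
  refine limsup_le_limsup (Eventually.of_forall fun n => ?_)
    (isCoboundedUnder_div_of_nonneg entropySeq_nonneg)
    (isBoundedUnder_div_of_le (log_card_legalWords_le θ))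
  exact div_le_div_of_nonneg_right (entropySeq_le_log_card hν n) n.cast_nonneg

end Measures

section TopologicalEntropy

variable {θ : A → Finset (List A)} {ℓ : ℕ}

theorem logCard_nonneg (θ : A → Finset (List A)) (a : A) : 0 ≤ logCard θ a :=
  Real.log_natCast_nonneg _

theorem weight_nonneg {ψ : A → ℝ} (h : ∀ a, 0 ≤ ψ a) (u : List A) : 0 ≤ weight ψ u := by
  refine List.sum_nonneg fun r hr => ?_
  obtain ⟨a, -, rfl⟩ := List.mem_map.1 hr
  exact h a

theorem UniformWeight.nonneg {ψ : A → ℝ} {c : ℝ} (h : UniformWeight θ ψ c) (hψ : ∀ a, 0 ≤ ψ a)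
    (hX : (Xtheta θ).Nonempty) : 0 ≤ c := by
  obtain ⟨x, hx⟩ := hX
  refine le_of_forall_pos_le_add fun ε hε => ?_
  obtain ⟨N, hN⟩ := h ε hε
  have h1 := hN (window x 0 (N + 1)) (hx 0 _) (by simp)
  have h2 := weight_nonneg hψ (window x 0 (N + 1))
  rw [length_window] at h1
  have h3 : (0 : ℝ) < (N + 1 : ℕ) := by positivity
  have h4 := (abs_le.1 h1).2
  by_contra! h5
  nlinarith

theorem card_legalWords_le (hrec : Recognisable θ) (hne : ∀ a, (θ a).Nonempty)
    (hl : ∀ a, ∀ w ∈ θ a, w.length = ℓ)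
    (hext : ∀ u, Legal θ u → ∃ x ∈ Xtheta θ, window x 0 u.length = u)
    {m n : ℕ} (hmn : ℓ + n ≤ ℓ * m) :
    (legalWords θ n).card ≤ ℓ * ∑ v ∈ legalWords θ m, numReals θ v := by
  classical
  have hsub : legalWords θ n ⊆
      (Finset.range ℓ ×ˢ (legalWords θ m).biUnion (reals θ)).image
        fun p => (p.2.drop p.1).take n := by
    intro u hu
    obtain ⟨hun, hu⟩ := mem_legalWords.1 hu
    obtain ⟨v, hv, hvm, s, t, hs, hst⟩ := hrec.exists_parse hne hl hext hu (hun ▸ hmn)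
    refine Finset.mem_image.2 ⟨(s.length, s ++ u ++ t), Finset.mem_product.2
      ⟨Finset.mem_range.2 hs, Finset.mem_biUnion.2 ⟨v, mem_legalWords.2 ⟨hvm, hv⟩, hst⟩⟩, ?_⟩
    simp [← hun]
  calc (legalWords θ n).card ≤ _ := Finset.card_le_card hsub
    _ ≤ _ := Finset.card_image_le
    _ = ℓ * ((legalWords θ m).biUnion (reals θ)).card := by simp
    _ ≤ ℓ * ∑ v ∈ legalWords θ m, (reals θ v).card :=
      Nat.mul_le_mul_left _ Finset.card_biUnion_le
    _ = _ := by simp [card_reals hl]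

theorem legalWords_nonempty (hX : (Xtheta θ).Nonempty) (n : ℕ) : (legalWords θ n).Nonempty := by
  obtain ⟨x, hx⟩ := hX
  exact ⟨window x 0 n, mem_legalWords.2 ⟨length_window x 0 n, hx 0 n⟩⟩

theorem numReals_eq_exp (hne : ∀ a, (θ a).Nonempty) (u : List A) :
    (numReals θ u : ℝ) = Real.exp (weight (logCard θ) u) := by
  rw [← log_numReals hne, Real.exp_log (by exact_mod_cast numReals_pos hne u)]

theorem topEntropy_le (hrec : Recognisable θ) (hne : ∀ a, (θ a).Nonempty) (hℓ : 2 ≤ ℓ)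
    (hl : ∀ a, ∀ w ∈ θ a, w.length = ℓ)
    (hext : ∀ u, Legal θ u → ∃ x ∈ Xtheta θ, window x 0 u.length = u)
    (hX : (Xtheta θ).Nonempty) {c : ℝ} (hc : UniformWeight θ (logCard θ) c) :
    topEntropy θ ≤ c / (ℓ - 1) := by
  have hc0 := hc.nonneg (logCard_nonneg θ) hX
  have hℓ' : (2 : ℝ) ≤ ℓ := by exact_mod_cast hℓ
  have hcard : ∀ n, (0 : ℝ) < (legalWords θ n).card := fun n => by
    exact_mod_cast (legalWords_nonempty hX n).card_pos
  rw [le_div_iff₀ (by linarith)]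
  refine le_of_forall_pos_le_add fun ε hε => ?_
  obtain ⟨N, hN⟩ := hc ε hε
  have hlim : topEntropy θ ≤ (topEntropy θ + (c + ε)) / ℓ := by
    refine limsup_div_le_of_scale (k := 1) (C := Real.log ℓ) (by lia) one_pos (by linarith)
      (fun n => Real.log_natCast_nonneg _) (fun n => Real.log_natCast_nonneg _)
      (log_card_legalWords_le θ) ?_
    filter_upwards [eventually_ge_atTop (ℓ * N)] with n hn
    simp only [one_mul, mul_one]
    set m := n / ℓ + 2 with hm
    have hNm : N ≤ m := by
      have : N ≤ n / ℓ := (Nat.le_div_iff_mul_le (by lia)).2 (by linarith)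
      lia
    have hmn : ℓ + n ≤ ℓ * m := by
      have h1 := Nat.lt_div_mul_add (a := n) (b := ℓ) (by lia)
      rw [hm]
      nlinarith
    have h1 : ((legalWords θ n).card : ℝ)
        ≤ ℓ * ((legalWords θ m).card * Real.exp ((c + ε) * m)) := by
      have h2 := card_legalWords_le hrec hne hl hext hmn
      have h3 : ((legalWords θ n).card : ℝ) ≤ ℓ * ∑ v ∈ legalWords θ m, (numReals θ v : ℝ) := by
        exact_mod_cast h2
      refine h3.trans (mul_le_mul_of_nonneg_left ?_ (by positivity))
      rw [← nsmul_eq_mul]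
      refine Finset.sum_le_card_nsmul _ _ _ fun v hv => ?_
      obtain ⟨hvm, hv⟩ := mem_legalWords.1 hv
      rw [numReals_eq_exp hne, Real.exp_le_exp]
      have := (abs_le.1 (hN v hv (hvm ▸ hNm))).2
      rw [hvm] at this
      linarith
    have h4 := Real.log_le_log (hcard n) h1
    rw [Real.log_mul (by positivity) (mul_pos (hcard m) (Real.exp_pos _)).ne',
      Real.log_mul (hcard m).ne' (Real.exp_pos _).ne', Real.log_exp] at h4
    linarith
  rw [le_div_iff₀ (by linarith)] at hlim
  linarith

end TopologicalEntropy

section FrequencyEntropy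

variable {θ : A → Finset (List A)} {P : A → List A → ℝ} {ℓ : ℕ}

theorem expIter_nonneg (hP : ∀ a, ∀ w ∈ θ a, 0 < P a w) (hs : ∀ a, ∑ w ∈ θ a, P a w = 1)
    {f : List A → ℝ} (hf : ∀ w, 0 ≤ f w) (n : ℕ) (u : List A) : 0 ≤ expIter θ P n u f := by
  rw [← expIter_const (P := P) hs n u 0]
  exact expIter_mono hP fun w _ => hf w

theorem expIter_le_of_le (hP : ∀ a, ∀ w ∈ θ a, 0 < P a w) (hs : ∀ a, ∑ w ∈ θ a, P a w = 1)
    {f : List A → ℝ} {C : ℝ} {n : ℕ} {u : List A} (hf : ∀ w ∈ realsIter θ n u, f w ≤ C) :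
    expIter θ P n u f ≤ C := by
  rw [← expIter_const (P := P) hs n u C]
  exact expIter_mono hP hf

theorem expIter_indicator_le (hrec : Recognisable θ) (hRS : IsRandomSubstitution θ P)
    (hℓ : 2 ≤ ℓ) (hl : ∀ a, ∀ w ∈ θ a, w.length = ℓ)
    (hunif : ∀ a : A, ∀ s ∈ θ a, P a s = ((θ a).card : ℝ)⁻¹)
    (hext : ∀ u, Legal θ u → ∃ x ∈ Xtheta θ, window x 0 u.length = u) {N : ℕ} {c : ℝ}
    (hN : ∀ u, Legal θ u → N ≤ u.length → c * u.length ≤ weight (logCard θ) u) (n : ℕ)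
    {u : List A} (hu : Legal θ u) (hNu : N ≤ u.length) (w : List A) :
    expIter θ P n u (fun w' => if w' = w then 1 else 0)
      ≤ Real.exp (-(c * u.length * ∑ i ∈ Finset.range n, (ℓ : ℝ) ^ i)) := by
  have hne := hRS.1
  have hs := hRS.2.2.2.2
  induction n generalizing u with
  | zero =>
    simp only [expIter, Finset.range_zero, Finset.sum_empty, mul_zero, neg_zero, Real.exp_zero]
    split_ifs <;> simp
  | succ n ih =>
    obtain ⟨y, hy, hyu⟩ := hext u hu
    have hzero : ∀ v, w ∉ realsIter θ n v →
        expIter θ P n v (fun w' => if w' = w then 1 else 0) = 0 := by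
      intro v hv
      refine (expIter_congr fun w' hw' => if_neg ?_).trans (expIter_const hs n v 0)
      rintro rfl
      exact hv hw'
    have hbound : ∑ v ∈ reals θ u, expIter θ P n v (fun w' => if w' = w then 1 else 0)
        ≤ Real.exp (-(c * (ℓ * u.length) * ∑ i ∈ Finset.range n, (ℓ : ℝ) ^ i)) := by
      by_cases hex : ∃ v ∈ reals θ u, w ∈ realsIter θ n v
      · obtain ⟨v, hv, hwv⟩ := hex
        rw [Finset.sum_eq_single_of_mem v hv]
        · have hlen := length_of_mem_reals hl hv
          have := ih (hu.of_mem_reals hne hv) (by rw [hlen]; nlinarith)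
          rwa [hlen, Nat.cast_mul] at this
        · intro v' hv' hvv
          refine hzero v' fun hwv' => hvv ?_
          rw [← hyu] at hv hv'
          exact hrec.reals_unique hne hℓ hl hy hv' hv hwv' hwv
      · rw [Finset.sum_eq_zero]
        · exact (Real.exp_pos _).le
        · exact fun v hv => hzero v fun h => hex ⟨v, hv, h⟩
    rw [expIter, expOne_uniform hl hunif, numReals_eq_exp hne, ← Real.exp_neg]
    calc _ ≤ Real.exp (-(c * u.length)) *
          Real.exp (-(c * (ℓ * u.length) * ∑ i ∈ Finset.range n, (ℓ : ℝ) ^ i)) := by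
          refine mul_le_mul ?_ hbound
            (Finset.sum_nonneg fun v _ => expIter_nonneg hRS.2.2.1 hs ?_ _ _) (Real.exp_pos _).le
          · rw [Real.exp_le_exp]
            linarith [hN u hu hNu]
          · intro w'
            split_ifs <;> simp
      _ = _ := by
          rw [← Real.exp_add, geom_sum_succ]
          congr 1
          ring

theorem occAt_le_indicator {w s m t : List A} {i : ℕ} (hi : i ≤ s.length)
    (hw : s.length + m.length ≤ i + w.length) :
    occAt w i (s ++ m ++ t) ≤ if m = (w.drop (s.length - i)).take m.length then 1 else 0 := by
  rw [occAt]
  split_ifs with h1 h2 h2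
  · exact le_rfl
  · refine absurd ?_ h2
    obtain ⟨z, hz⟩ := h1
    have h3 := congrArg (fun r => (r.drop (s.length - i)).take m.length) hz
    simp only [List.append_assoc] at h3
    rw [List.drop_append_of_le_length (by lia), List.take_append_of_le_length (by simp; lia),
      List.drop_append_of_le_length hi, List.drop_left' (by simp), List.take_left' rfl] at h3
    exact h3.symm
  · exact zero_le_one
  · exact le_rfl

theorem expIter_occAt_le (hrec : Recognisable θ) (hRS : IsRandomSubstitution θ P)
    (hℓ : 2 ≤ ℓ) (hl : ∀ a, ∀ w ∈ θ a, w.length = ℓ)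
    (hunif : ∀ a : A, ∀ s ∈ θ a, P a s = ((θ a).card : ℝ)⁻¹)
    (hext : ∀ u, Legal θ u → ∃ x ∈ Xtheta θ, window x 0 u.length = u) {N : ℕ} {c : ℝ}
    (hN : ∀ u, Legal θ u → N ≤ u.length → c * u.length ≤ weight (logCard θ) u) (n : ℕ) {L : ℕ}
    (hL : N ≤ L) {w : List A} (hw : w.length = (L + 1) * ℓ ^ n) {v : List A} (hv : Legal θ v)
    (i : ℕ) :
    expIter θ P n v (occAt w i)
      ≤ Real.exp (-(c * L * ∑ i ∈ Finset.range n, (ℓ : ℝ) ^ i)) := by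
  have hP := hRS.2.2.1
  have hs := hRS.2.2.2.2
  have hpos : 0 < ℓ ^ n := by positivity
  by_cases hi : i + w.length ≤ ℓ ^ n * v.length
  · set q := i / ℓ ^ n with hq
    have hqi : q * ℓ ^ n ≤ i := Nat.div_mul_le_self _ _
    have hiq : i < q * ℓ ^ n + ℓ ^ n := Nat.lt_div_mul_add hpos
    have hqL : q + 1 + L ≤ v.length := by
      have : (q + 1 + L) * ℓ ^ n ≤ v.length * ℓ ^ n := by rw [hw] at hi; nlinarith
      exact Nat.le_of_mul_le_mul_right this hpos
    set v₁ := v.take (q + 1) with hv₁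
    set u := (v.drop (q + 1)).take L with hu
    set v₂ := (v.drop (q + 1)).drop L with hv₂
    have hveq : v = v₁ ++ (u ++ v₂) := by
      rw [hu, hv₂, List.take_append_drop, hv₁, List.take_append_drop]
    have hv₁l : v₁.length = q + 1 := by simp [hv₁]; lia
    have hul : u.length = L := by simp [hu]; lia
    have hulegal : Legal θ u := hv.of_isInfix ⟨v₁, v₂, by rw [List.append_assoc]; exact hveq.symm⟩
    rw [hveq, expIter_append]
    refine expIter_le_of_le hP hs fun s hs' => ?_
    rw [expIter_append]
    have hsl := length_of_mem_realsIter hl hs'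
    rw [hv₁l] at hsl
    have hub := expIter_indicator_le hrec hRS hℓ hl hunif hext hN n hulegal (hul ▸ hL)
      ((w.drop (s.length - i)).take (ℓ ^ n * L))
    rw [hul] at hub
    refine le_trans (expIter_mono hP fun m hm => ?_) hub
    have hml := length_of_mem_realsIter hl hm
    rw [hul] at hml
    refine expIter_le_of_le hP hs fun t _ => ?_
    rw [← List.append_assoc, ← hml]
    refine occAt_le_indicator ?_ ?_
    · rw [hsl]; nlinarith
    · rw [hsl, hml, hw]; nlinarith
  · refine le_trans (expIter_le_of_le hP hs (C := 0) fun x hx => ?_) (Real.exp_pos _).le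
    rw [occAt, if_neg]
    intro h
    have h1 := h.length_le
    rw [List.length_drop, length_of_mem_realsIter hl hx] at h1
    have : 0 < w.length := by rw [hw]; positivity
    lia

variable [MeasurableSpace A] {μ : Measure (ℤ → A)}

theorem IsFrequencyMeasure.cylinder_le (hμ : IsFrequencyMeasure θ P μ) (hrec : Recognisable θ)
    (hRS : IsRandomSubstitution θ P) (hℓ : 2 ≤ ℓ) (hl : ∀ a, ∀ w ∈ θ a, w.length = ℓ)
    (hunif : ∀ a : A, ∀ s ∈ θ a, P a s = ((θ a).card : ℝ)⁻¹)
    (hext : ∀ u, Legal θ u → ∃ x ∈ Xtheta θ, window x 0 u.length = u) {N : ℕ} {c : ℝ}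
    (hN : ∀ u, Legal θ u → N ≤ u.length → c * u.length ≤ weight (logCard θ) u) (n : ℕ) {L : ℕ}
    (hL : N ≤ L) {w : List A} (hw : w.length = (L + 1) * ℓ ^ n) (hwl : Legal θ w) :
    (μ (cylinder w 0)).toReal
      ≤ Real.exp (-(c * L * ∑ i ∈ Finset.range n, (ℓ : ℝ) ^ i)) := by
  obtain ⟨a⟩ := hμ.nonempty
  refine le_of_tendsto (hμ.tendsto hRS hl hwl 0 a) ?_
  filter_upwards [eventually_ge_atTop n] with k hk
  obtain ⟨j, rfl⟩ := Nat.exists_eq_add_of_le' hk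
  have hℓ0 : (0 : ℝ) < (ℓ : ℝ) ^ (j + n) := by positivity
  rw [div_le_iff₀ hℓ0, expCount_eq, expIter_comp]
  refine expIter_le_of_le hRS.2.2.1 hRS.2.2.2.2 fun v hv => ?_
  have hvl := length_of_mem_realsIter hl hv
  rw [expIter_congr (g := fun x => ∑ i ∈ Finset.range (ℓ ^ (j + n)), occAt w i x), expIter_finsum]
  · refine (Finset.sum_le_card_nsmul _ _ _ fun i _ => expIter_occAt_le hrec hRS hℓ hl hunif hext
      hN n hL hw (Legal.of_mem_realsIter hv) i).trans ?_
    simp [mul_comm]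
  · intro x hx
    rw [occCount_eq_sum, length_of_mem_realsIter hl hx, hvl]
    simp [pow_add, mul_comm]

theorem IsFrequencyMeasure.le_measEntropy [MeasurableSingletonClass A]
    (hμ : IsFrequencyMeasure θ P μ) (hrec : Recognisable θ)
    (hRS : IsRandomSubstitution θ P) (hℓ : 2 ≤ ℓ) (hl : ∀ a, ∀ w ∈ θ a, w.length = ℓ)
    (hunif : ∀ a : A, ∀ s ∈ θ a, P a s = ((θ a).card : ℝ)⁻¹)
    (hext : ∀ u, Legal θ u → ∃ x ∈ Xtheta θ, window x 0 u.length = u) {c : ℝ}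
    (hc : UniformWeight θ (logCard θ) c) : c / (ℓ - 1) ≤ measEntropy θ μ := by
  have := hμ.1
  have hℓ' : (2 : ℝ) ≤ ℓ := by exact_mod_cast hℓ
  refine le_of_forall_lt fun κ hκ => ?_
  obtain ⟨κ', hκκ', hκ'⟩ := exists_between hκ
  refine hκκ'.trans_le ?_
  rw [lt_div_iff₀ (by linarith)] at hκ'
  set c' := (c + κ' * (ℓ - 1)) / 2 with hc'
  obtain ⟨N, hN⟩ := hc (c - c') (by rw [hc']; linarith)
  replace hN : ∀ u, Legal θ u → N ≤ u.length → c' * u.length ≤ weight (logCard θ) u := by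
    intro u hu hNu
    have := (abs_le.1 (hN u hu hNu)).1
    linarith
  have hg : Tendsto (fun n : ℕ => c' / (ℓ - 1) * ((n : ℝ) / (n + 1)) * (1 - ((ℓ : ℝ)⁻¹) ^ n)) atTop
      (nhds (c' / (ℓ - 1) * 1 * (1 - 0))) := by
    refine ((tendsto_const_nhds.mul (tendsto_natCast_div_add_atTop 1))).mul
      (tendsto_const_nhds.sub (tendsto_pow_atTop_nhds_zero_of_lt_one (by positivity) ?_))
    exact inv_lt_one_of_one_lt₀ (by linarith)
  have hκg : κ' < c' / (ℓ - 1) * 1 * (1 - 0) := by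
    rw [sub_zero, mul_one, mul_one, lt_div_iff₀ (by linarith), hc']
    linarith
  have hev := (hg.eventually (lt_mem_nhds hκg)).and (eventually_ge_atTop N)
  have hM : Tendsto (fun n : ℕ => (n + 1) * ℓ ^ n) atTop atTop :=
    tendsto_atTop_mono (fun n => (Nat.le_succ n).trans
      (Nat.le_mul_of_pos_right _ (by positivity))) tendsto_id
  refine le_limsup_of_frequently_le (hM.frequently (p := fun m => κ' ≤ entropySeq θ μ m / (m : ℝ))
      (Eventually.frequently ?_))
    (isBoundedUnder_div_of_le fun n => (entropySeq_le_log_card hμ.2.2.1 n).trans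
      (log_card_legalWords_le θ n))
  filter_upwards [hev] with n ⟨hn, hNn⟩
  refine hn.le.trans ?_
  have hent : c' * n * ∑ i ∈ Finset.range n, (ℓ : ℝ) ^ i ≤ entropySeq θ μ ((n + 1) * ℓ ^ n) := by
    set δ := c' * n * ∑ i ∈ Finset.range n, (ℓ : ℝ) ^ i with hδ
    calc δ = ∑ u ∈ legalWords θ ((n + 1) * ℓ ^ n), (μ (cylinder u 0)).toReal * δ := by
          rw [← Finset.sum_mul, sum_cylinder_legal hμ.2.2.1, one_mul]
      _ ≤ _ := Finset.sum_le_sum fun u hu => ?_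
    obtain ⟨hul, hu⟩ := mem_legalWords.1 hu
    have hle := hμ.cylinder_le hrec hRS hℓ hl hunif hext hN n hNn hul hu
    rcases (ENNReal.toReal_nonneg (a := μ (cylinder u 0))).eq_or_lt with h0 | h0
    · simp [← h0]
    · rw [Real.negMulLog, neg_mul, ← mul_neg]
      refine mul_le_mul_of_nonneg_left ?_ h0.le
      have := Real.log_le_log h0 hle
      rw [Real.log_exp] at this
      linarith
  have hpos : (0 : ℝ) < ((n + 1) * ℓ ^ n : ℕ) := by positivity
  rw [le_div_iff₀ hpos]
  refine le_of_eq_of_le ?_ hent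
  rw [geom_sum_eq (by linarith)]
  have h1 : (ℓ : ℝ) - 1 ≠ 0 := by linarith
  have h2 : (ℓ : ℝ) ≠ 0 := by linarith
  push_cast
  rw [inv_pow]
  field_simp

end FrequencyEntropy

section Desubstitution

variable {θ : A → Finset (List A)} {ℓ : ℕ}

theorem window_eq_ofFn (x : ℤ → A) (m : ℤ) (n : ℕ) :
    window x m n = List.ofFn fun i : Fin n => x (m + (i : ℕ)) := by
  rw [window_eq_iff]
  simp

theorem isClosed_window_rel [TopologicalSpace A] [DiscreteTopology A] (m m' : ℤ) (n n' : ℕ)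
    (Q : List A → List A → Prop) :
    IsClosed {p : (ℤ → A) × (ℤ → A) | Q (window p.1 m n) (window p.2 m' n')} := by
  have hcont : Continuous fun p : (ℤ → A) × (ℤ → A) =>
      ((fun i : Fin n => p.1 (m + (i : ℕ))), (fun i : Fin n' => p.2 (m' + (i : ℕ)))) := by
    fun_prop
  simp only [window_eq_ofFn]
  exact (isClosed_discrete
    {q : (Fin n → A) × (Fin n' → A) | Q (List.ofFn q.1) (List.ofFn q.2)}).preimage hcont

theorem measurableSet_decodes [MeasurableSpace A] [MeasurableSingletonClass A]
    (k : ℕ) (j : ℤ) (n : ℕ) (u : List A) :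
    MeasurableSet {x : ℤ → A | ∃ y, Decodes θ ℓ x y k ∧ window y j n = u} := by
  let : TopologicalSpace A := ⊥
  have : DiscreteTopology A := ⟨rfl⟩
  have : BorelSpace A := ⟨by
    rw [borel_eq_top_of_discrete]
    exact MeasurableSpace.ext fun s => by
      simp only [MeasurableSpace.measurableSet_top, iff_true]
      exact s.toFinite.measurableSet⟩
  by_cases hk : k < ℓ
  · set T : Set ((ℤ → A) × (ℤ → A)) :=
      (⋂ (m : ℤ) (n : ℕ), {p | Legal θ (window p.2 m n)}) ∩
      (⋂ i : ℤ, {p | window p.1 (i * ℓ - k) ℓ ∈ θ (p.2 i)}) ∩ {p | window p.2 j n = u} with hT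
    have hTc : IsClosed T := by
      refine ((isClosed_iInter fun m => isClosed_iInter fun n => ?_).inter
        (isClosed_iInter fun i => ?_)).inter ?_
      · exact isClosed_window_rel 0 m 0 n fun _ v => Legal θ v
      · have := isClosed_window_rel (A := A) (i * ℓ - k) i ℓ 1 fun w v => ∀ a, v = [a] → w ∈ θ a
        simpa [window] using this
      · exact isClosed_window_rel 0 j 0 n fun _ v => v = u
    have himg : {x : ℤ → A | ∃ y, Decodes θ ℓ x y k ∧ window y j n = u} = Prod.fst '' T := by
      ext x
      simp only [Set.mem_ofPred_eq, Set.mem_image, Prod.exists, exists_and_right, exists_eq_right,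
        hT, Set.mem_inter_iff, Set.mem_iInter, Decodes, Xtheta, hk, true_and]
    rw [himg]
    exact (hTc.isCompact.image continuous_fst).isClosed.measurableSet
  · convert MeasurableSet.empty
    simp [Decodes, hk]

/-- The set of sequences whose inflation word decomposition has a cut at position `-k`. -/
def cutSet (θ : A → Finset (List A)) (ℓ k : ℕ) : Set (ℤ → A) := {x | ∃ y, Decodes θ ℓ x y k}

open Classical in
/-- The desubstitution of a sequence with a cut at the origin. -/
noncomputable def decode (θ : A → Finset (List A)) (ℓ : ℕ) (x : ℤ → A) : ℤ → A :=
  if h : ∃ y, Decodes θ ℓ x y 0 then h.choose else x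

theorem decodes_decode {x : ℤ → A} (hx : x ∈ cutSet θ ℓ 0) :
    Decodes θ ℓ x (decode θ ℓ x) 0 := by
  have hx' : ∃ y, Decodes θ ℓ x y 0 := hx
  rw [decode, dif_pos hx']
  exact hx'.choose_spec

theorem Decodes.mem_Xtheta (hne : ∀ a, (θ a).Nonempty) (hℓ : 2 ≤ ℓ) {x y : ℤ → A} {k : ℕ}
    (h : Decodes θ ℓ x y k) : x ∈ Xtheta θ := by
  have : (fun i => x (i + -(k : ℤ))) ∈ Xtheta θ := by
    refine substSeq_subset hne hℓ h.1 fun j => ?_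
    rw [window_translate, ← sub_eq_add_neg]
    exact h.2.2 j
  simpa using translate_mem this k

theorem decodes_translate_iff {x y : ℤ → A} {k c : ℕ} (hc : k + c < ℓ) :
    Decodes θ ℓ (fun i => x (i + c)) y (k + c) ↔ Decodes θ ℓ x y k := by
  have h1 : k < ℓ := by lia
  simp only [Decodes, hc, h1, window_translate, Nat.cast_add, true_and]
  have h2 : ∀ j : ℤ, j * ℓ - (k + c) + c = j * ℓ - k := fun j => by ring
  simp only [h2]

theorem Decodes.translate_mul {x y : ℤ → A} {k : ℕ} (h : Decodes θ ℓ x y k) (c : ℤ) :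
    Decodes θ ℓ (fun i => x (i + ℓ * c)) (fun i => y (i + c)) k := by
  refine ⟨translate_mem h.1 c, h.2.1, fun j => ?_⟩
  rw [window_translate]
  convert h.2.2 (j + c) using 2
  ring

theorem measurableSet_cutSet [MeasurableSpace A] [MeasurableSingletonClass A] (k : ℕ) :
    MeasurableSet (cutSet θ ℓ k) := by
  have := measurableSet_decodes (θ := θ) (ℓ := ℓ) k 0 0 []
  convert this using 1
  ext x
  simp [cutSet, window]

theorem translate_mul_mem_cutSet_iff {x : ℤ → A} {k : ℕ} (c : ℤ) :
    (fun i => x (i + ℓ * c)) ∈ cutSet θ ℓ k ↔ x ∈ cutSet θ ℓ k := by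
  refine ⟨fun ⟨y, hy⟩ => ⟨fun i => y (i + -c), ?_⟩, fun ⟨y, hy⟩ => ⟨_, hy.translate_mul c⟩⟩
  simpa [add_assoc, ← mul_add] using hy.translate_mul (-c)

theorem decode_eq (hrec : Recognisable θ) (hne : ∀ a, (θ a).Nonempty) (hℓ : 2 ≤ ℓ)
    (hl : ∀ a, ∀ w ∈ θ a, w.length = ℓ) {x y : ℤ → A} (h : Decodes θ ℓ x y 0) :
    decode θ ℓ x = y :=
  (hrec.decodes_unique hne hl (h.mem_Xtheta hne hℓ) (decodes_decode ⟨y, h⟩) h).1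

theorem decode_translate (hrec : Recognisable θ) (hne : ∀ a, (θ a).Nonempty) (hℓ : 2 ≤ ℓ)
    (hl : ∀ a, ∀ w ∈ θ a, w.length = ℓ) {x : ℤ → A} (hx : x ∈ cutSet θ ℓ 0) (c : ℤ) :
    decode θ ℓ (fun i => x (i + ℓ * c)) = fun i => decode θ ℓ x (i + c) :=
  decode_eq hrec hne hℓ hl ((decodes_decode hx).translate_mul c)

theorem measurable_decode [MeasurableSpace A] [MeasurableSingletonClass A]
    (hrec : Recognisable θ) (hne : ∀ a, (θ a).Nonempty) (hℓ : 2 ≤ ℓ)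
    (hl : ∀ a, ∀ w ∈ θ a, w.length = ℓ) : Measurable (decode θ ℓ) := by
  refine measurable_pi_iff.2 fun i => measurable_to_countable' fun a => ?_
  have : (fun x => decode θ ℓ x i) ⁻¹' {a} =
      {x | ∃ y, Decodes θ ℓ x y 0 ∧ window y i 1 = [a]} ∪
        ((cutSet θ ℓ 0)ᶜ ∩ {x | window x i 1 = [a]}) := by
    ext x
    by_cases hx : x ∈ cutSet θ ℓ 0
    · have h1 : ∀ y, Decodes θ ℓ x y 0 ↔ y = decode θ ℓ x := fun y =>
        ⟨fun h => (decode_eq hrec hne hℓ hl h).symm, fun h => h ▸ decodes_decode hx⟩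
      simp [h1, hx, window]
    · have h1 : ∀ y, ¬Decodes θ ℓ x y 0 := fun y h => hx ⟨y, h⟩
      have h2 : decode θ ℓ x = x := dif_neg hx
      simp [h1, hx, h2, window]
  rw [this]
  exact (measurableSet_decodes 0 i 1 [a]).union
    ((measurableSet_cutSet 0).compl.inter (measurableSet_window_eq i 1 [a]))

end Desubstitution

section Coupling

variable [MeasurableSpace A] {θ : A → Finset (List A)} {ℓ : ℕ} {ν ν' : Measure (ℤ → A)}

/-- `J u w` is the joint law of words in a stationary sequence with law `ν'` and of their images
in a random substitution image, whose stationary version has law `ν`. -/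
structure IsCoupling (θ : A → Finset (List A)) (ℓ : ℕ) (ν ν' : Measure (ℤ → A))
    (J : List A → List A → ℝ) : Prop where
  nonneg : ∀ u w, 0 ≤ J u w
  mem_reals : ∀ u w, w.length = ℓ * u.length → J u w ≠ 0 → w ∈ reals θ u
  sum_image : ∀ u, ∑ w ∈ allWords A (ℓ * u.length), J u w = (ν' (cylinder u 0)).toReal
  extend_right : ∀ (u w : List A) (b : ℕ), w.length = ℓ * u.length →
    ∑ u₂ ∈ allWords A b, ∑ w₂ ∈ allWords A (ℓ * b), J (u ++ u₂) (w ++ w₂) = J u w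
  extend_left : ∀ (u w : List A) (b : ℕ), w.length = ℓ * u.length →
    ∑ u₁ ∈ allWords A b, ∑ w₁ ∈ allWords A (ℓ * b), J (u₁ ++ u) (w₁ ++ w) = J u w
  sum_occAt : ∀ (v : List A) (k : ℕ), ℓ + v.length ≤ ℓ * k →
    ℓ * (ν (cylinder v 0)).toReal =
      ∑ r ∈ Finset.range ℓ, ∑ u ∈ allWords A k, ∑ w ∈ allWords A (ℓ * k), J u w * occAt v r w

theorem measurable_translate (c : ℤ) : Measurable fun (x : ℤ → A) i => x (i + c) :=
  measurable_pi_iff.2 fun i => measurable_pi_apply (i + c)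

theorem measure_translate (hinv : ∀ s : Set (ℤ → A), MeasurableSet s → ν (shift ⁻¹' s) = ν s)
    (c : ℕ) {s : Set (ℤ → A)} (hs : MeasurableSet s) :
    ν {x | (fun i => x (i + c)) ∈ s} = ν s := by
  induction c with
  | zero => simp only [Nat.cast_zero, add_zero]; rfl
  | succ c ih =>
    have h : MeasurableSet {x : ℤ → A | (fun i => x (i + c)) ∈ s} :=
      measurable_translate (c : ℤ) hs
    rw [← ih, ← hinv _ h]
    congr 1
    ext x
    simp [shift, add_assoc]

variable [MeasurableSingletonClass A]

/-- Sequences with a cut at the origin which read `w` at position `i` and whose desubstitution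
reads `u` at position `j`. -/
def cutCylinder (θ : A → Finset (List A)) (ℓ : ℕ) (j : ℤ) (u : List A) (i : ℤ) (w : List A) :
    Set (ℤ → A) :=
  cutSet θ ℓ 0 ∩ {x | window (decode θ ℓ x) j u.length = u} ∩ {x | window x i w.length = w}

theorem measurableSet_window_decode (hrec : Recognisable θ) (hne : ∀ a, (θ a).Nonempty)
    (hℓ : 2 ≤ ℓ) (hl : ∀ a, ∀ w ∈ θ a, w.length = ℓ) (j : ℤ) (n : ℕ) (u : List A) :
    MeasurableSet {x | window (decode θ ℓ x) j n = u} :=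
  measurable_decode hrec hne hℓ hl (measurableSet_window_eq j n u)

theorem measurableSet_cutCylinder (hrec : Recognisable θ) (hne : ∀ a, (θ a).Nonempty)
    (hℓ : 2 ≤ ℓ) (hl : ∀ a, ∀ w ∈ θ a, w.length = ℓ) (j : ℤ) (u : List A) (i : ℤ) (w : List A) :
    MeasurableSet (cutCylinder θ ℓ j u i w) :=
  ((measurableSet_cutSet 0).inter (measurableSet_window_decode hrec hne hℓ hl j _ u)).inter
    (measurableSet_window_eq i _ w)

theorem sum_measureReal_windows [IsFiniteMeasure ν] (hrec : Recognisable θ)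
    (hne : ∀ a, (θ a).Nonempty) (hℓ : 2 ≤ ℓ) (hl : ∀ a, ∀ w ∈ θ a, w.length = ℓ)
    {B : Set (ℤ → A)} (hB : MeasurableSet B) (j : ℤ) (n : ℕ) (i : ℤ) (m : ℕ) :
    ∑ u ∈ allWords A n, ∑ w ∈ allWords A m,
      ν.real (B ∩ {x | window (decode θ ℓ x) j n = u} ∩ {x | window x i m = w}) = ν.real B := by
  rw [← sum_measureReal_inter_fiber ν (allWords A n) (fun x => window (decode θ ℓ x) j n)
    (fun _ _ => measurableSet_window_decode hrec hne hℓ hl j n _) hB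
    fun x _ => mem_allWords.2 (length_window _ _ _)]
  exact Finset.sum_congr rfl fun u _ =>
    sum_measureReal_window (hB.inter (measurableSet_window_decode hrec hne hℓ hl j n u)) i m

theorem measureReal_cutCylinder_translate (hrec : Recognisable θ)
    (hne : ∀ a, (θ a).Nonempty) (hℓ : 2 ≤ ℓ) (hl : ∀ a, ∀ w ∈ θ a, w.length = ℓ)
    (hinv : ∀ s : Set (ℤ → A), MeasurableSet s → ν (shift ⁻¹' s) = ν s) (c : ℕ)
    (u w : List A) :
    ν.real (cutCylinder θ ℓ c u (ℓ * c : ℕ) w) = ν.real (cutCylinder θ ℓ 0 u 0 w) := by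
  rw [Measure.real, Measure.real, ← measure_translate hinv (ℓ * c)
    (measurableSet_cutCylinder hrec hne hℓ hl 0 u 0 w)]
  congr 2
  ext x
  simp only [cutCylinder, Set.mem_inter_iff, Set.mem_ofPred_eq, window_translate, zero_add,
    Nat.cast_mul, translate_mul_mem_cutSet_iff]
  refine and_congr_left fun _ => and_congr_right fun hx => ?_
  rw [decode_translate hrec hne hℓ hl hx, window_translate, zero_add]

theorem sum_measure_cutSet [IsProbabilityMeasure ν] (hrec : Recognisable θ)
    (hne : ∀ a, (θ a).Nonempty) (hl : ∀ a, ∀ w ∈ θ a, w.length = ℓ) (hℓ : 2 ≤ ℓ)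
    (hinv : ∀ s : Set (ℤ → A), MeasurableSet s → ν (shift ⁻¹' s) = ν s)
    (hν : ν (Xtheta θ) = 1) {B : Set (ℤ → A)} (hB : MeasurableSet B) :
    ν.real B = ∑ r ∈ Finset.range ℓ, ν.real (cutSet θ ℓ 0 ∩ {x | (fun i => x (i + r)) ∈ B}) := by
  have h1 : ∀ r ∈ Finset.range ℓ, ν.real (cutSet θ ℓ 0 ∩ {x | (fun i => x (i + r)) ∈ B})
      = ν.real (cutSet θ ℓ r ∩ B) := by
    intro r hr
    rw [Measure.real, Measure.real, ← measure_translate hinv r ((measurableSet_cutSet r).inter hB)]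
    congr 2
    ext x
    have : (fun i => x (i + r)) ∈ cutSet θ ℓ r ↔ x ∈ cutSet θ ℓ 0 := by
      refine exists_congr fun y => ?_
      have := decodes_translate_iff (θ := θ) (x := x) (y := y) (k := 0) (c := r)
        (by simpa using hr)
      rwa [zero_add] at this
    simp [this]
  rw [Finset.sum_congr rfl h1, ← measureReal_biUnion_finset]
  · refine measureReal_congr ?_
    have hX : ∀ᵐ x ∂ν, x ∈ Xtheta θ :=
      (prob_compl_eq_zero_iff measurableSet_Xtheta).2 hν
    filter_upwards [hX] with x hx
    refine propext ⟨fun hxB => ?_, fun h => ?_⟩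
    · obtain ⟨y, k, h⟩ := hrec.exists_decodes hne hl hx
      exact Set.mem_iUnion₂.2 ⟨k, Finset.mem_range.2 h.2.1, ⟨y, h⟩, hxB⟩
    · obtain ⟨k, -, h⟩ := Set.mem_iUnion₂.1 h
      exact h.2
  · intro k _ k' _ hkk
    refine Set.disjoint_left.2 fun x ⟨⟨y, hy⟩, _⟩ ⟨⟨y', hy'⟩, _⟩ => hkk ?_
    exact (hrec.decodes_unique hne hl (hy.mem_Xtheta hne hℓ) hy hy').2
  · exact fun r _ => (measurableSet_cutSet r).inter hB

theorem mul_measureReal_cutSet [IsProbabilityMeasure ν] (hrec : Recognisable θ)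
    (hne : ∀ a, (θ a).Nonempty) (hl : ∀ a, ∀ w ∈ θ a, w.length = ℓ) (hℓ : 2 ≤ ℓ)
    (hinv : ∀ s : Set (ℤ → A), MeasurableSet s → ν (shift ⁻¹' s) = ν s)
    (hν : ν (Xtheta θ) = 1) : ℓ * ν.real (cutSet θ ℓ 0) = 1 := by
  have := sum_measure_cutSet hrec hne hl hℓ hinv hν MeasurableSet.univ
  simpa using this.symm

theorem exists_coupling [IsProbabilityMeasure ν] (hrec : Recognisable θ)
    (hne : ∀ a, (θ a).Nonempty) (hl : ∀ a, ∀ w ∈ θ a, w.length = ℓ) (hℓ : 2 ≤ ℓ)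
    (hinv : ∀ s : Set (ℤ → A), MeasurableSet s → ν (shift ⁻¹' s) = ν s)
    (hν : ν (Xtheta θ) = 1) :
    ∃ (ν' : Measure (ℤ → A)) (J : List A → List A → ℝ), IsProbabilityMeasure ν' ∧
      (∀ s : Set (ℤ → A), MeasurableSet s → ν' (shift ⁻¹' s) = ν' s) ∧ ν' (Xtheta θ) = 1 ∧
      IsCoupling θ ℓ ν ν' J := by
  have hD := measurable_decode hrec hne hℓ hl
  set ν' : Measure (ℤ → A) := ((ℓ : ENNReal) • ν.restrict (cutSet θ ℓ 0)).map (decode θ ℓ)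
    with hν'
  have hν'a : ∀ s, MeasurableSet s →
      ν' s = ℓ * ν (cutSet θ ℓ 0 ∩ decode θ ℓ ⁻¹' s) := by
    intro s hs
    rw [hν', Measure.map_apply hD hs, Measure.smul_apply, Measure.restrict_apply (hD hs),
      Set.inter_comm, smul_eq_mul]
  have hE : (ℓ : ENNReal) * ν (cutSet θ ℓ 0) = 1 := by
    rw [← ENNReal.toReal_eq_one_iff, ENNReal.toReal_mul, ENNReal.toReal_natCast]
    exact mul_measureReal_cutSet hrec hne hl hℓ hinv hν
  have hprob : IsProbabilityMeasure ν' := ⟨by rw [hν'a _ MeasurableSet.univ]; simpa using hE⟩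
  refine ⟨ν', fun u w => ℓ * ν.real (cutCylinder θ ℓ 0 u 0 w), hprob, fun s hs => ?_, ?_, ?_⟩
  · have hsh : Measurable (shift : (ℤ → A) → ℤ → A) := measurable_translate 1
    rw [hν'a _ (hsh hs), hν'a s hs,
      ← measure_translate hinv ℓ ((measurableSet_cutSet 0).inter (hD hs))]
    congr 2
    ext x
    have h1 := translate_mul_mem_cutSet_iff (θ := θ) (ℓ := ℓ) (x := x) (k := 0) 1
    rw [mul_one] at h1
    simp only [Set.mem_inter_iff, Set.mem_preimage, Set.mem_ofPred_eq, h1]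
    refine and_congr_right fun hx => ?_
    have h2 := decode_translate hrec hne hℓ hl hx 1
    rw [mul_one] at h2
    rw [h2]
    rfl
  · rw [hν'a _ measurableSet_Xtheta, ← hE, Set.inter_eq_left.2]
    exact fun x hx => (decodes_decode hx).1
  · constructor
    · intro u w
      positivity
    · intro u w hw h
      have h1 : ν.real (cutCylinder θ ℓ 0 u 0 w) ≠ 0 := right_ne_zero_of_mul h
      obtain ⟨x, ⟨hx, hxu⟩, hxw⟩ : (cutCylinder θ ℓ 0 u 0 w).Nonempty := by
        rw [Set.nonempty_iff_ne_empty]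
        intro h2
        simp [h2] at h1
      have h3 := window_mem_reals (θ := θ) (c := 0) (x := x) (y := decode θ ℓ x)
        (by simpa using (decodes_decode hx).2.2) 0 u.length
      rw [Set.mem_ofPred_eq] at hxu hxw
      rwa [hxu, zero_mul, add_zero, ← hw, hxw] at h3
    · intro u
      rw [← Finset.mul_sum]
      have h1 := sum_measureReal_window (ν := ν) ((measurableSet_cutSet (θ := θ) (ℓ := ℓ) 0).inter
        (measurableSet_window_decode hrec hne hℓ hl 0 u.length u)) 0 (ℓ * u.length)
      rw [hν'a _ (measurableSet_cylinder u 0), ENNReal.toReal_mul, ENNReal.toReal_natCast]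
      refine congrArg (fun r : ℝ => ℓ * r) (Eq.trans ?_ h1)
      refine Finset.sum_congr rfl fun w hw => ?_
      rw [cutCylinder, mem_allWords.1 hw]
    · intro u w b hw
      simp only [← Finset.mul_sum]
      congr 1
      rw [← sum_measureReal_windows hrec hne hℓ hl
        (measurableSet_cutCylinder hrec hne hℓ hl 0 u 0 w) u.length b w.length (ℓ * b)]
      refine Finset.sum_congr rfl fun u₂ hu₂ => Finset.sum_congr rfl fun w₂ hw₂ => ?_
      congr 1
      ext x
      simp only [cutCylinder, Set.mem_inter_iff, Set.mem_ofPred_eq, List.length_append, window_add,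
        mem_allWords.1 hu₂, mem_allWords.1 hw₂, zero_add]
      rw [List.append_eq_append_iff_of_size_eq_left (by simp),
        List.append_eq_append_iff_of_size_eq_left (by simp)]
      tauto
    · intro u w b hw
      simp only [← Finset.mul_sum]
      congr 1
      rw [← measureReal_cutCylinder_translate hrec hne hℓ hl hinv b u w,
        ← sum_measureReal_windows hrec hne hℓ hl
        (measurableSet_cutCylinder hrec hne hℓ hl b u (ℓ * b : ℕ) w) 0 b 0 (ℓ * b)]
      refine Finset.sum_congr rfl fun u₂ hu₂ => Finset.sum_congr rfl fun w₂ hw₂ => ?_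
      congr 1
      ext x
      simp only [cutCylinder, Set.mem_inter_iff, Set.mem_ofPred_eq, List.length_append, window_add,
        mem_allWords.1 hu₂, mem_allWords.1 hw₂, zero_add]
      rw [List.append_eq_append_iff_of_size_eq_left (by simp [mem_allWords.1 hu₂]),
        List.append_eq_append_iff_of_size_eq_left (by simp [mem_allWords.1 hw₂])]
      tauto
    · intro v k hk
      have h0 := sum_measure_cutSet hrec hne hl hℓ hinv hν (measurableSet_cylinder v 0)
      rw [Measure.real] at h0
      rw [h0, Finset.mul_sum]
      refine Finset.sum_congr rfl fun r hr => ?_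
      simp only [mul_assoc, ← Finset.mul_sum]
      congr 1
      have hB : MeasurableSet (cutSet θ ℓ 0 ∩ {x | (fun i => x (i + r)) ∈ cylinder v 0}) :=
        (measurableSet_cutSet 0).inter (measurable_translate (r : ℤ) (measurableSet_cylinder v 0))
      rw [← sum_measureReal_windows hrec hne hℓ hl hB 0 k 0 (ℓ * k)]
      refine Finset.sum_congr rfl fun u hu => Finset.sum_congr rfl fun w hw => ?_
      have hrv : r + v.length ≤ ℓ * k := by
        have := Finset.mem_range.1 hr
        lia
      rw [cutCylinder, mem_allWords.1 hu, mem_allWords.1 hw, occAt]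
      split_ifs with hocc
      · rw [mul_one]
        congr 1
        ext x
        simp only [Set.mem_inter_iff, Set.mem_ofPred_eq, cylinder, window_translate]
        refine ⟨fun h => ⟨⟨h.1.1.1, h.1.2⟩, h.2⟩,
          fun h => ⟨⟨⟨h.1.1, ?_⟩, h.1.2⟩, h.2⟩⟩
        rw [← h.2, prefix_drop_window hrv] at hocc
        exact hocc
      · rw [mul_zero, measureReal_eq_zero_iff]
        convert measure_empty (μ := ν)
        refine Set.eq_empty_of_forall_notMem fun x hx => hocc ?_
        rw [← hx.2, prefix_drop_window hrv]
        have := hx.1.1.2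
        simp only [Set.mem_ofPred_eq, cylinder, window_translate] at this
        exact this

end Coupling

/-- Subadditivity of conditional entropy: for finite random variables `(i, i', k, k')` with joint
law `p`, the entropy of `(k, k')` given `(i, i')` is at most the sum of the entropy of `k` given
`i` and of the entropy of `k'` given `i'`. -/
theorem condEntropy_subadditive {ι ι' κ κ' : Type*} (I : Finset ι) (I' : Finset ι') (K : Finset κ)
    (K' : Finset κ') (p : ι → ι' → κ → κ' → ℝ) (g : ι → ι' → ℝ) (J : ι → κ → ℝ) (J' : ι' → κ' → ℝ)
    (n : ι → ℝ) (n' : ι' → ℝ) (hp : ∀ i i' k k', 0 ≤ p i i' k k')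
    (hg : ∀ i ∈ I, ∀ i' ∈ I', ∑ k ∈ K, ∑ k' ∈ K', p i i' k k' = g i i')
    (hJ : ∀ i ∈ I, ∀ k ∈ K, ∑ i' ∈ I', ∑ k' ∈ K', p i i' k k' = J i k)
    (hJ' : ∀ i' ∈ I', ∀ k' ∈ K', ∑ i ∈ I, ∑ k ∈ K, p i i' k k' = J' i' k')
    (hn : ∀ i ∈ I, ∑ k ∈ K, J i k = n i) (hn' : ∀ i' ∈ I', ∑ k' ∈ K', J' i' k' = n' i') :
    ∑ i ∈ I, ∑ i' ∈ I', ∑ k ∈ K, ∑ k' ∈ K', Real.negMulLog (p i i' k k')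
        - ∑ i ∈ I, ∑ i' ∈ I', Real.negMulLog (g i i')
      ≤ (∑ i ∈ I, ∑ k ∈ K, Real.negMulLog (J i k) - ∑ i ∈ I, Real.negMulLog (n i))
        + (∑ i' ∈ I', ∑ k' ∈ K', Real.negMulLog (J' i' k')
          - ∑ i' ∈ I', Real.negMulLog (n' i')) := by
  have hpg : ∀ i ∈ I, ∀ i' ∈ I', ∀ k ∈ K, ∀ k' ∈ K', p i i' k k' ≤ g i i' := by
    intro i hi i' hi' k hk k' hk'
    rw [← hg i hi i' hi']
    exact (Finset.single_le_sum (f := fun k' => p i i' k k') (fun _ _ => hp _ _ _ _) hk').trans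
      (Finset.single_le_sum (f := fun k => ∑ k' ∈ K', p i i' k k')
        (fun _ _ => Finset.sum_nonneg fun _ _ => hp _ _ _ _) hk)
  have hpJ : ∀ i ∈ I, ∀ i' ∈ I', ∀ k ∈ K, ∀ k' ∈ K', p i i' k k' ≤ J i k := by
    intro i hi i' hi' k hk k' hk'
    rw [← hJ i hi k hk]
    exact (Finset.single_le_sum (f := fun k' => p i i' k k') (fun _ _ => hp _ _ _ _) hk').trans
      (Finset.single_le_sum (f := fun i' => ∑ k' ∈ K', p i i' k k')
        (fun _ _ => Finset.sum_nonneg fun _ _ => hp _ _ _ _) hi')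
  have hpJ' : ∀ i ∈ I, ∀ i' ∈ I', ∀ k ∈ K, ∀ k' ∈ K', p i i' k k' ≤ J' i' k' := by
    intro i hi i' hi' k hk k' hk'
    rw [← hJ' i' hi' k' hk']
    exact (Finset.single_le_sum (f := fun k => p i i' k k') (fun _ _ => hp _ _ _ _) hk).trans
      (Finset.single_le_sum (f := fun i => ∑ k ∈ K, p i i' k k')
        (fun _ _ => Finset.sum_nonneg fun _ _ => hp _ _ _ _) hi)
  have hg0 : ∀ i ∈ I, ∀ i' ∈ I', 0 ≤ g i i' := fun i hi i' hi' => by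
    rw [← hg i hi i' hi']
    exact Finset.sum_nonneg fun _ _ => Finset.sum_nonneg fun _ _ => hp _ _ _ _
  have hJ0 : ∀ i ∈ I, ∀ k ∈ K, 0 ≤ J i k := fun i hi k hk => by
    rw [← hJ i hi k hk]
    exact Finset.sum_nonneg fun _ _ => Finset.sum_nonneg fun _ _ => hp _ _ _ _
  have hJ0' : ∀ i' ∈ I', ∀ k' ∈ K', 0 ≤ J' i' k' := fun i' hi' k' hk' => by
    rw [← hJ' i' hi' k' hk']
    exact Finset.sum_nonneg fun _ _ => Finset.sum_nonneg fun _ _ => hp _ _ _ _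
  have hJn : ∀ i ∈ I, ∀ k ∈ K, J i k ≤ n i := fun i hi k hk => by
    rw [← hn i hi]
    exact Finset.single_le_sum (f := fun k => J i k) (fun k hk => hJ0 i hi k hk) hk
  have hJn' : ∀ i' ∈ I', ∀ k' ∈ K', J' i' k' ≤ n' i' := fun i' hi' k' hk' => by
    rw [← hn' i' hi']
    exact Finset.single_le_sum (f := fun k' => J' i' k') (fun k hk => hJ0' i' hi' k hk) hk'
  have hn0 : ∀ i ∈ I, 0 ≤ n i := fun i hi => by
    rw [← hn i hi]
    exact Finset.sum_nonneg fun k hk => hJ0 i hi k hk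
  have hn0' : ∀ i' ∈ I', 0 ≤ n' i' := fun i' hi' => by
    rw [← hn' i' hi']
    exact Finset.sum_nonneg fun k hk => hJ0' i' hi' k hk
  have hpt : ∀ i ∈ I, ∀ i' ∈ I', ∀ k ∈ K, ∀ k' ∈ K',
      Real.negMulLog (p i i' k k') ≤
        g i i' * (J i k / n i) * (J' i' k' / n' i') - p i i' k k'
        - p i i' k k' * Real.log (g i i')
        - (p i i' k k' * Real.log (J i k) - p i i' k k' * Real.log (n i))
        - (p i i' k k' * Real.log (J' i' k') - p i i' k k' * Real.log (n' i')) := by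
    intro i hi i' hi' k hk k' hk'
    rcases (hp i i' k k').eq_or_lt with h0 | h0
    · simp only [← h0, Real.negMulLog_zero, zero_mul, sub_zero]
      exact mul_nonneg (mul_nonneg (hg0 i hi i' hi') (div_nonneg (hJ0 i hi k hk) (hn0 i hi)))
        (div_nonneg (hJ0' i' hi' k' hk') (hn0' i' hi'))
    · have h1 := h0.trans_le (hpg i hi i' hi' k hk k' hk')
      have h2 := h0.trans_le (hpJ i hi i' hi' k hk k' hk')
      have h3 := h0.trans_le (hpJ' i hi i' hi' k hk k' hk')
      have h4 := h2.trans_le (hJn i hi k hk)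
      have h5 := h3.trans_le (hJn' i' hi' k' hk')
      have h6 := negMulLog_add_mul_log_le h0.le
        (q := g i i' * (J i k / n i) * (J' i' k' / n' i')) (by positivity)
        (fun h => absurd h (by positivity))
      rw [Real.log_mul (by positivity) (by positivity), Real.log_mul h1.ne' (by positivity),
        Real.log_div h2.ne' h4.ne', Real.log_div h3.ne' h5.ne'] at h6
      linarith
  have hsum := Finset.sum_le_sum fun i hi => Finset.sum_le_sum fun i' hi' =>
    Finset.sum_le_sum fun k hk => Finset.sum_le_sum fun k' hk' => hpt i hi i' hi' k hk k' hk'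
  simp only [Finset.sum_sub_distrib] at hsum
  have e1 : ∑ i ∈ I, ∑ i' ∈ I', ∑ k ∈ K, ∑ k' ∈ K', p i i' k k' = ∑ i ∈ I, ∑ i' ∈ I', g i i' :=
    Finset.sum_congr rfl fun i hi => Finset.sum_congr rfl fun i' hi' => hg i hi i' hi'
  have e2 : ∑ i ∈ I, ∑ i' ∈ I', ∑ k ∈ K, ∑ k' ∈ K', g i i' * (J i k / n i) * (J' i' k' / n' i')
      ≤ ∑ i ∈ I, ∑ i' ∈ I', g i i' := by
    refine Finset.sum_le_sum fun i hi => Finset.sum_le_sum fun i' hi' => ?_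
    simp only [← Finset.mul_sum, ← Finset.sum_mul, ← Finset.sum_div, hn i hi, hn' i' hi']
    rw [mul_assoc]
    exact mul_le_of_le_one_right (hg0 i hi i' hi')
      (mul_le_one₀ (div_self_le_one _) (div_nonneg (hn0' i' hi') (hn0' i' hi'))
        (div_self_le_one _))
  have e3 : ∑ i ∈ I, ∑ i' ∈ I', ∑ k ∈ K, ∑ k' ∈ K', p i i' k k' * Real.log (g i i')
      = -∑ i ∈ I, ∑ i' ∈ I', Real.negMulLog (g i i') := by
    simp only [← Finset.sum_neg_distrib]
    refine Finset.sum_congr rfl fun i hi => Finset.sum_congr rfl fun i' hi' => ?_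
    simp only [← Finset.sum_mul, hg i hi i' hi', Real.negMulLog]
    ring
  have swap : ∀ f : ι → ι' → κ → κ' → ℝ, ∑ i ∈ I, ∑ i' ∈ I', ∑ k ∈ K, ∑ k' ∈ K', f i i' k k'
      = ∑ i ∈ I, ∑ k ∈ K, ∑ i' ∈ I', ∑ k' ∈ K', f i i' k k' := fun f =>
    Finset.sum_congr rfl fun i _ => Finset.sum_comm
  have swap' : ∀ f : ι → ι' → κ → κ' → ℝ, ∑ i ∈ I, ∑ i' ∈ I', ∑ k ∈ K, ∑ k' ∈ K', f i i' k k'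
      = ∑ i' ∈ I', ∑ k' ∈ K', ∑ i ∈ I, ∑ k ∈ K, f i i' k k' := fun f => by
    rw [Finset.sum_comm]
    refine Finset.sum_congr rfl fun i' _ => ?_
    rw [Finset.sum_comm (s := K')]
    exact Finset.sum_congr rfl fun i _ => Finset.sum_comm
  have e4 : ∑ i ∈ I, ∑ i' ∈ I', ∑ k ∈ K, ∑ k' ∈ K', p i i' k k' * Real.log (J i k)
      = -∑ i ∈ I, ∑ k ∈ K, Real.negMulLog (J i k) := by
    rw [swap]
    simp only [← Finset.sum_neg_distrib]
    refine Finset.sum_congr rfl fun i hi => Finset.sum_congr rfl fun k hk => ?_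
    simp only [← Finset.sum_mul, hJ i hi k hk, Real.negMulLog]
    ring
  have e5 : ∑ i ∈ I, ∑ i' ∈ I', ∑ k ∈ K, ∑ k' ∈ K', p i i' k k' * Real.log (n i)
      = -∑ i ∈ I, Real.negMulLog (n i) := by
    rw [swap]
    simp only [← Finset.sum_neg_distrib]
    refine Finset.sum_congr rfl fun i hi => ?_
    simp only [← Finset.sum_mul, Finset.sum_congr rfl (hJ i hi), hn i hi, Real.negMulLog]
    ring
  have e6 : ∑ i ∈ I, ∑ i' ∈ I', ∑ k ∈ K, ∑ k' ∈ K', p i i' k k' * Real.log (J' i' k')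
      = -∑ i' ∈ I', ∑ k' ∈ K', Real.negMulLog (J' i' k') := by
    rw [swap']
    simp only [← Finset.sum_neg_distrib]
    refine Finset.sum_congr rfl fun i hi => Finset.sum_congr rfl fun k hk => ?_
    simp only [← Finset.sum_mul, hJ' i hi k hk, Real.negMulLog]
    ring
  have e7 : ∑ i ∈ I, ∑ i' ∈ I', ∑ k ∈ K, ∑ k' ∈ K', p i i' k k' * Real.log (n' i')
      = -∑ i' ∈ I', Real.negMulLog (n' i') := by
    rw [swap']
    simp only [← Finset.sum_neg_distrib]
    refine Finset.sum_congr rfl fun i hi => ?_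
    simp only [← Finset.sum_mul, Finset.sum_congr rfl (hJ' i hi), hn' i hi, Real.negMulLog]
    ring
  rw [e1, e3, e4, e5, e6, e7] at hsum
  linarith

section CouplingEntropy

theorem sum_occAt_mul {k q : ℕ} {s : List A} (h : q + k ≤ s.length) (g : List A → ℝ) :
    ∑ u ∈ allWords A k, occAt u q s * g u = g ((s.drop q).take k) := by
  have hlen : ((s.drop q).take k).length = k := by simp; omega
  rw [Finset.sum_eq_single ((s.drop q).take k)]
  · rw [occAt, if_pos ⟨_, List.take_append_drop _ _⟩, one_mul]
  · intro u hu hne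
    rw [occAt, if_neg, zero_mul]
    intro hp
    rw [mem_allWords] at hu
    exact hne (by rw [← hu]; exact List.prefix_iff_eq_take.1 hp)
  · intro hn
    exact absurd (mem_allWords.2 hlen) hn

variable [MeasurableSpace A] {θ : A → Finset (List A)} {ℓ : ℕ} {ν ν' : Measure (ℤ → A)}
  {J : List A → List A → ℝ}

/-- The conditional entropy of the image of a word of length `k` given this word, when the joint
law is `J` and the law of the word is given by `ν'`. -/
noncomputable def condEntropy (ℓ : ℕ) (ν' : Measure (ℤ → A)) (J : List A → List A → ℝ) (k : ℕ) :
    ℝ :=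
  ∑ u ∈ allWords A k, ∑ w ∈ allWords A (ℓ * k), Real.negMulLog (J u w)
    - ∑ u ∈ allWords A k, Real.negMulLog ((ν' (cylinder u 0)).toReal)

namespace IsCoupling

theorem sum_image_eq (h : IsCoupling θ ℓ ν ν' J) {k : ℕ} {u : List A} (hu : u ∈ allWords A k) :
    ∑ w ∈ allWords A (ℓ * k), J u w = (ν' (cylinder u 0)).toReal := by
  rw [← mem_allWords.1 hu]
  exact h.sum_image u

theorem sum_append_right (h : IsCoupling θ ℓ ν ν' J) (u : List A) (b : ℕ) :
    ∑ v ∈ allWords A b, (ν' (cylinder (u ++ v) 0)).toReal = (ν' (cylinder u 0)).toReal := by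
  rw [← h.sum_image u]
  have e : ∀ v ∈ allWords A b, (ν' (cylinder (u ++ v) 0)).toReal =
      ∑ w ∈ allWords A (ℓ * u.length), ∑ w₂ ∈ allWords A (ℓ * b), J (u ++ v) (w ++ w₂) := by
    intro v hv
    rw [← h.sum_image, List.length_append, mem_allWords.1 hv, mul_add, sum_allWords_add]
  rw [Finset.sum_congr rfl e, Finset.sum_comm]
  exact Finset.sum_congr rfl fun w hw => h.extend_right u w b (mem_allWords.1 hw)

theorem sum_append_left (h : IsCoupling θ ℓ ν ν' J) (u : List A) (b : ℕ) :
    ∑ v ∈ allWords A b, (ν' (cylinder (v ++ u) 0)).toReal = (ν' (cylinder u 0)).toReal := by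
  rw [← h.sum_image u]
  have e : ∀ v ∈ allWords A b, (ν' (cylinder (v ++ u) 0)).toReal =
      ∑ w ∈ allWords A (ℓ * u.length), ∑ w₂ ∈ allWords A (ℓ * b), J (v ++ u) (w₂ ++ w) := by
    intro v hv
    rw [← h.sum_image, List.length_append, mem_allWords.1 hv, mul_add, sum_allWords_add,
      Finset.sum_comm]
  rw [Finset.sum_congr rfl e, Finset.sum_comm]
  exact Finset.sum_congr rfl fun w hw => h.extend_left u w b (mem_allWords.1 hw)

theorem sum_weight_add (h : IsCoupling θ ℓ ν ν' J) (ψ : A → ℝ) (a b : ℕ) :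
    ∑ u ∈ allWords A (a + b), (ν' (cylinder u 0)).toReal * weight ψ u
      = ∑ u ∈ allWords A a, (ν' (cylinder u 0)).toReal * weight ψ u
        + ∑ u ∈ allWords A b, (ν' (cylinder u 0)).toReal * weight ψ u := by
  rw [sum_allWords_add]
  simp only [weight_append, mul_add, Finset.sum_add_distrib]
  congr 1
  · simp only [← Finset.sum_mul, h.sum_append_right]
  · rw [Finset.sum_comm]
    simp only [← Finset.sum_mul, h.sum_append_left]

theorem sum_weight (h : IsCoupling θ ℓ ν ν' J) (ψ : A → ℝ) (k : ℕ) :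
    ∑ u ∈ allWords A k, (ν' (cylinder u 0)).toReal * weight ψ u
      = k * ∑ u ∈ allWords A 1, (ν' (cylinder u 0)).toReal * weight ψ u := by
  induction k with
  | zero =>
    rw [Nat.cast_zero, zero_mul]
    refine Finset.sum_eq_zero fun u hu => ?_
    rw [List.length_eq_zero_iff.1 (mem_allWords.1 hu), weight_nil, mul_zero]
  | succ k ih => rw [h.sum_weight_add, ih]; push_cast; ring

theorem condEntropy_add_le (h : IsCoupling θ ℓ ν ν' J) (a b : ℕ) :
    condEntropy ℓ ν' J (a + b) ≤ condEntropy ℓ ν' J a + condEntropy ℓ ν' J b := by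
  have key := condEntropy_subadditive (allWords A a) (allWords A b) (allWords A (ℓ * a))
    (allWords A (ℓ * b)) (fun u v w z => J (u ++ v) (w ++ z))
    (fun u v => (ν' (cylinder (u ++ v) 0)).toReal) J J
    (fun u => (ν' (cylinder u 0)).toReal) (fun u => (ν' (cylinder u 0)).toReal)
    (fun _ _ _ _ => h.nonneg _ _)
    (fun u hu v hv => by
      rw [← h.sum_image, List.length_append, mem_allWords.1 hu, mem_allWords.1 hv, mul_add,
        sum_allWords_add])
    (fun u hu w hw => h.extend_right u w b (by rw [mem_allWords.1 hu, mem_allWords.1 hw]))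
    (fun u hu w hw => h.extend_left u w a (by rw [mem_allWords.1 hu, mem_allWords.1 hw]))
    (fun u hu => h.sum_image_eq hu) (fun u hu => h.sum_image_eq hu)
  simpa only [condEntropy, mul_add, sum_allWords_add] using key

theorem condEntropy_zero (h : IsCoupling θ ℓ ν ν' J) : condEntropy ℓ ν' J 0 ≤ 0 := by
  have e : allWords A 0 = {[]} := by ext w; simp [mem_allWords]
  have := h.sum_image []
  simp only [condEntropy, mul_zero, e, Finset.sum_singleton, List.length_nil] at this ⊢
  rw [this, sub_self]

theorem condEntropy_mul_le (h : IsCoupling θ ℓ ν ν' J) (k m : ℕ) :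
    condEntropy ℓ ν' J (k * m) ≤ m * condEntropy ℓ ν' J k := by
  induction m with
  | zero => simpa using h.condEntropy_zero
  | succ m ih =>
    have := h.condEntropy_add_le (k * m) k
    rw [mul_add, mul_one]
    push_cast
    linarith

theorem condEntropy_nonneg (h : IsCoupling θ ℓ ν ν' J) (k : ℕ) : 0 ≤ condEntropy ℓ ν' J k := by
  rw [condEntropy, sub_nonneg]
  refine Finset.sum_le_sum fun u hu => ?_
  rw [← h.sum_image_eq hu]
  exact negMulLog_sum_le fun w _ => h.nonneg u w

theorem sum_allWords_eq_sum_reals (h : IsCoupling θ ℓ ν ν' J)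
    (hl : ∀ a, ∀ w ∈ θ a, w.length = ℓ) {k : ℕ} {u : List A} (hu : u ∈ allWords A k)
    {f : List A → ℝ} (hf : ∀ w, J u w = 0 → f w = 0) :
    ∑ w ∈ allWords A (ℓ * k), f w = ∑ w ∈ reals θ u, f w := by
  have hul := mem_allWords.1 hu
  symm
  refine Finset.sum_subset (fun w hw => ?_) fun w hw hw' => hf w ?_
  · rw [mem_allWords, length_of_mem_reals hl hw, hul]
  · by_contra hne
    exact hw' (h.mem_reals u w (by rw [mem_allWords.1 hw, hul]) hne)

theorem neg_sum_mul_log_uniform (h : IsCoupling θ ℓ ν ν' J) (hne : ∀ a, (θ a).Nonempty)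
    (hl : ∀ a, ∀ w ∈ θ a, w.length = ℓ) {k : ℕ} {u : List A} (hu : u ∈ allWords A k) :
    -∑ w ∈ reals θ u, J u w * Real.log ((ν' (cylinder u 0)).toReal / numReals θ u)
      = Real.negMulLog ((ν' (cylinder u 0)).toReal)
        + (ν' (cylinder u 0)).toReal * weight (logCard θ) u := by
  have hsum := h.sum_image_eq hu
  rw [h.sum_allWords_eq_sum_reals hl hu fun _ => id] at hsum
  rw [← Finset.sum_mul, hsum, ← log_numReals hne]
  rcases eq_or_ne (ν' (cylinder u 0)).toReal 0 with h0 | h0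
  · simp [h0]
  · rw [Real.log_div h0 (by exact_mod_cast (numReals_pos hne u).ne'), Real.negMulLog]
    ring

theorem sum_uniform_le (h : IsCoupling θ ℓ ν ν' J) (hne : ∀ a, (θ a).Nonempty)
    (hl : ∀ a, ∀ w ∈ θ a, w.length = ℓ) {k : ℕ} {u : List A} (hu : u ∈ allWords A k) :
    (∀ w ∈ reals θ u, (ν' (cylinder u 0)).toReal / numReals θ u = 0 → J u w = 0) ∧
      ∑ _w ∈ reals θ u, (ν' (cylinder u 0)).toReal / numReals θ u ≤ ∑ w ∈ reals θ u, J u w := by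
  have hpos : (0 : ℝ) < numReals θ u := by exact_mod_cast numReals_pos hne u
  have hsum := h.sum_image_eq hu
  rw [h.sum_allWords_eq_sum_reals hl hu fun _ => id] at hsum
  constructor
  · intro w hw h0
    rw [div_eq_zero_iff, or_iff_left hpos.ne', ← hsum,
      Finset.sum_eq_zero_iff_of_nonneg fun w _ => h.nonneg u w] at h0
    exact h0 w hw
  · rw [Finset.sum_const, card_reals hl, hsum, nsmul_eq_mul, mul_div_cancel₀ _ hpos.ne']

theorem sum_negMulLog_image_le (h : IsCoupling θ ℓ ν ν' J) (hne : ∀ a, (θ a).Nonempty)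
    (hl : ∀ a, ∀ w ∈ θ a, w.length = ℓ) {k : ℕ} {u : List A} (hu : u ∈ allWords A k) :
    ∑ w ∈ allWords A (ℓ * k), Real.negMulLog (J u w)
      ≤ Real.negMulLog ((ν' (cylinder u 0)).toReal)
        + (ν' (cylinder u 0)).toReal * weight (logCard θ) u := by
  obtain ⟨h1, h2⟩ := h.sum_uniform_le hne hl hu
  rw [← h.neg_sum_mul_log_uniform hne hl hu,
    h.sum_allWords_eq_sum_reals hl hu fun w hw => by rw [hw, Real.negMulLog_zero]]
  exact sum_negMulLog_le (fun w _ => h.nonneg u w) (fun _ _ => by positivity) h1 h2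

theorem eq_of_sum_negMulLog_image_ge (h : IsCoupling θ ℓ ν ν' J) (hne : ∀ a, (θ a).Nonempty)
    (hl : ∀ a, ∀ w ∈ θ a, w.length = ℓ) {k : ℕ} {u : List A} (hu : u ∈ allWords A k)
    (hge : Real.negMulLog ((ν' (cylinder u 0)).toReal)
        + (ν' (cylinder u 0)).toReal * weight (logCard θ) u
      ≤ ∑ w ∈ allWords A (ℓ * k), Real.negMulLog (J u w)) :
    ∀ w ∈ reals θ u, J u w = (ν' (cylinder u 0)).toReal / numReals θ u := by
  obtain ⟨h1, h2⟩ := h.sum_uniform_le hne hl hu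
  rw [← h.neg_sum_mul_log_uniform hne hl hu,
    h.sum_allWords_eq_sum_reals hl hu fun w hw => by rw [hw, Real.negMulLog_zero]] at hge
  exact eq_of_sum_negMulLog_ge (fun w _ => h.nonneg u w) (fun _ _ => by positivity) h1 h2 hge

variable [MeasurableSingletonClass A]

theorem sum_weight_eq [IsProbabilityMeasure ν'] (h : IsCoupling θ ℓ ν ν' J)
    (hν' : ν' (Xtheta θ) = 1) {ψ : A → ℝ} {c : ℝ} (hc : UniformWeight θ ψ c) (k : ℕ) :
    ∑ u ∈ allWords A k, (ν' (cylinder u 0)).toReal * weight ψ u = k * c := by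
  rw [h.sum_weight]
  congr 1
  set F := ∑ u ∈ allWords A 1, (ν' (cylinder u 0)).toReal * weight ψ u with hF
  refine eq_of_abs_sub_le_all fun ε hε => ?_
  obtain ⟨N, hN⟩ := hc ε hε
  have hk : (0 : ℝ) < (N + 1 : ℕ) := by positivity
  have key : |((N + 1 : ℕ) : ℝ) * F - (N + 1 : ℕ) * c| ≤ (N + 1 : ℕ) * ε := by
    have e : (N + 1 : ℕ) * c = ∑ u ∈ allWords A (N + 1),
        (ν' (cylinder u 0)).toReal * ((N + 1 : ℕ) * c) := by
      rw [← Finset.sum_mul, sum_cylinder, one_mul]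
    have e' : (N + 1 : ℕ) * ε = ∑ u ∈ allWords A (N + 1),
        (ν' (cylinder u 0)).toReal * ((N + 1 : ℕ) * ε) := by
      rw [← Finset.sum_mul, sum_cylinder, one_mul]
    rw [hF, ← h.sum_weight, e, e', ← Finset.sum_sub_distrib]
    refine (Finset.abs_sum_le_sum_abs _ _).trans (Finset.sum_le_sum fun u hu => ?_)
    have hul := mem_allWords.1 hu
    rw [← mul_sub, abs_mul, abs_of_nonneg ENNReal.toReal_nonneg]
    by_cases hu' : Legal θ u
    · refine mul_le_mul_of_nonneg_left ?_ ENNReal.toReal_nonneg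
      have := hN u hu' (by omega)
      rw [hul] at this
      rwa [mul_comm _ c, mul_comm _ ε]
    · rw [cylinder_eq_zero hν' hu']; simp
  rw [← mul_sub, abs_mul, abs_of_pos hk] at key
  exact le_of_mul_le_mul_left key hk

theorem condEntropy_le [IsProbabilityMeasure ν'] (h : IsCoupling θ ℓ ν ν' J)
    (hν' : ν' (Xtheta θ) = 1) (hne : ∀ a, (θ a).Nonempty) (hl : ∀ a, ∀ w ∈ θ a, w.length = ℓ)
    {c : ℝ} (hc : UniformWeight θ (logCard θ) c) (k : ℕ) : condEntropy ℓ ν' J k ≤ k * c := by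
  rw [← h.sum_weight_eq hν' hc, condEntropy, sub_le_iff_le_add', ← Finset.sum_add_distrib]
  exact Finset.sum_le_sum fun u hu => h.sum_negMulLog_image_le hne hl hu

theorem eq_of_condEntropy_ge [IsProbabilityMeasure ν'] (h : IsCoupling θ ℓ ν ν' J)
    (hν' : ν' (Xtheta θ) = 1) (hne : ∀ a, (θ a).Nonempty) (hl : ∀ a, ∀ w ∈ θ a, w.length = ℓ)
    {c : ℝ} (hc : UniformWeight θ (logCard θ) c) {k : ℕ} (hk : k * c ≤ condEntropy ℓ ν' J k)
    {u : List A} (hu : u ∈ allWords A k) :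
    ∀ w ∈ reals θ u, J u w = (ν' (cylinder u 0)).toReal / numReals θ u := by
  rw [← h.sum_weight_eq hν' hc, condEntropy, le_sub_iff_add_le', ← Finset.sum_add_distrib] at hk
  have heq := (Finset.sum_eq_sum_iff_of_le
    fun u hu => h.sum_negMulLog_image_le hne hl hu).1
    (le_antisymm (Finset.sum_le_sum fun u hu => h.sum_negMulLog_image_le hne hl hu) hk)
  exact h.eq_of_sum_negMulLog_image_ge hne hl hu (heq u hu).ge

theorem entropySeq_le [IsProbabilityMeasure ν] [IsProbabilityMeasure ν']
    (h : IsCoupling θ ℓ ν ν' J) (hν : ν (Xtheta θ) = 1) (hν' : ν' (Xtheta θ) = 1) (hℓ : 0 < ℓ)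
    {n k : ℕ} (hnk : ℓ + n ≤ ℓ * k) :
    entropySeq θ ν n ≤ Real.log ℓ + entropySeq θ ν' k + condEntropy ℓ ν' J k := by
  have hℓ' : (0 : ℝ) < ℓ := by exact_mod_cast hℓ
  rw [entropySeq_eq hν, entropySeq_eq hν', condEntropy, add_assoc, add_sub_cancel]
  have hcyl : ∀ v ∈ allWords A n, (ν (cylinder v 0)).toReal =
      ∑ r ∈ Finset.range ℓ, ∑ u ∈ allWords A k, ∑ w ∈ allWords A (ℓ * k),
        (ℓ : ℝ)⁻¹ * (J u w * occAt v r w) := by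
    intro v hv
    have := h.sum_occAt v k (by rw [mem_allWords.1 hv]; exact hnk)
    simp only [← Finset.mul_sum]
    rw [← this, inv_mul_cancel_left₀ hℓ'.ne']
  have hneg : ∀ v r u w, Real.negMulLog ((ℓ : ℝ)⁻¹ * (J u w * occAt v r w)) =
      occAt v r w * ((ℓ : ℝ)⁻¹ * (Real.negMulLog (J u w) + J u w * Real.log ℓ)) := by
    intro v r u w
    rw [occAt]
    split_ifs
    · rw [mul_one, one_mul, Real.negMulLog_mul, Real.negMulLog, Real.log_inv]
      ring
    · simp
  calc ∑ v ∈ allWords A n, Real.negMulLog ((ν (cylinder v 0)).toReal)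
      ≤ ∑ v ∈ allWords A n, ∑ r ∈ Finset.range ℓ, ∑ u ∈ allWords A k,
          ∑ w ∈ allWords A (ℓ * k), occAt v r w *
            ((ℓ : ℝ)⁻¹ * (Real.negMulLog (J u w) + J u w * Real.log ℓ)) := by
        refine Finset.sum_le_sum fun v hv => ?_
        have hnn : ∀ r u w, 0 ≤ (ℓ : ℝ)⁻¹ * (J u w * occAt v r w) := fun r u w =>
          mul_nonneg (by positivity) (mul_nonneg (h.nonneg u w) (occAt_nonneg v r w))
        rw [hcyl v hv]
        refine (negMulLog_sum_le fun r _ => Finset.sum_nonneg fun u _ =>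
          Finset.sum_nonneg fun w _ => hnn r u w).trans (Finset.sum_le_sum fun r _ => ?_)
        refine (negMulLog_sum_le fun u _ =>
          Finset.sum_nonneg fun w _ => hnn r u w).trans (Finset.sum_le_sum fun u _ => ?_)
        refine (negMulLog_sum_le fun w _ => hnn r u w).trans (le_of_eq ?_)
        exact Finset.sum_congr rfl fun w _ => hneg v r u w
    _ = ∑ r ∈ Finset.range ℓ, ∑ u ∈ allWords A k, ∑ w ∈ allWords A (ℓ * k),
          (ℓ : ℝ)⁻¹ * (Real.negMulLog (J u w) + J u w * Real.log ℓ) := by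
        rw [Finset.sum_comm]
        refine Finset.sum_congr rfl fun r hr => ?_
        rw [Finset.sum_comm]
        refine Finset.sum_congr rfl fun u _ => ?_
        rw [Finset.sum_comm]
        refine Finset.sum_congr rfl fun w hw => ?_
        rw [Finset.mem_range] at hr
        rw [sum_occAt_mul (by rw [mem_allWords.1 hw]; omega)
          fun _ => (ℓ : ℝ)⁻¹ * (Real.negMulLog (J u w) + J u w * Real.log ℓ)]
    _ = ∑ u ∈ allWords A k, ∑ w ∈ allWords A (ℓ * k),
          (Real.negMulLog (J u w) + J u w * Real.log ℓ) := by
        rw [Finset.sum_const, Finset.card_range, nsmul_eq_mul]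
        simp only [← Finset.mul_sum]
        rw [mul_inv_cancel_left₀ hℓ'.ne']
    _ = Real.log ℓ + ∑ u ∈ allWords A k, ∑ w ∈ allWords A (ℓ * k), Real.negMulLog (J u w) := by
        simp only [Finset.sum_add_distrib, ← Finset.sum_mul]
        rw [Finset.sum_congr rfl fun u hu => h.sum_image_eq hu, sum_cylinder, one_mul, add_comm]

theorem measEntropy_le [IsProbabilityMeasure ν] [IsProbabilityMeasure ν']
    (h : IsCoupling θ ℓ ν ν' J) (hν : ν (Xtheta θ) = 1) (hν' : ν' (Xtheta θ) = 1) (hℓ : 0 < ℓ)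
    {k : ℕ} (hk : 0 < k) :
    measEntropy θ ν ≤ (measEntropy θ ν' + condEntropy ℓ ν' J k / k) / ℓ := by
  have hk' : (0 : ℝ) < k := by exact_mod_cast hk
  refine limsup_div_le_of_scale (C := Real.log ℓ) hℓ hk
    (div_nonneg (h.condEntropy_nonneg k) hk'.le) entropySeq_nonneg entropySeq_nonneg
    (fun n => (entropySeq_le_log_card hν' n).trans (log_card_legalWords_le θ n))
    (Eventually.of_forall fun n => ?_)
  have hn : ℓ + n ≤ ℓ * (k * (n / (ℓ * k) + 2)) := by
    have h1 := Nat.lt_mul_div_succ n (Nat.mul_pos hℓ hk)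
    have h2 : ℓ ≤ ℓ * k := Nat.le_mul_of_pos_right _ hk
    calc ℓ + n ≤ ℓ * k + ℓ * k * (n / (ℓ * k) + 1) := by omega
      _ = _ := by ring
  refine (h.entropySeq_le hν hν' hℓ hn).trans (add_le_add le_rfl ?_)
  refine (h.condEntropy_mul_le _ _).trans (le_of_eq ?_)
  rw [Nat.cast_mul]
  field_simp

end IsCoupling

end CouplingEntropy

section Uniqueness

variable {θ : A → Finset (List A)} {P : A → List A → ℝ} {ℓ : ℕ}

theorem sum_range_mul_eq (ℓ n : ℕ) (f : ℕ → ℝ) :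
    ∑ i ∈ Finset.range (ℓ * n), f i
      = ∑ q ∈ Finset.range n, ∑ r ∈ Finset.range ℓ, f (ℓ * q + r) := by
  induction n with
  | zero => simp
  | succ n ih => rw [mul_add, mul_one, Finset.sum_range_add, ih, Finset.sum_range_succ]

theorem expOne_drop_take_occAt (hl : ∀ a, ∀ w ∈ θ a, w.length = ℓ)
    (hs : ∀ a, ∑ w ∈ θ a, P a w = 1) {q k r : ℕ} {s v : List A} (hq : q + k ≤ s.length)
    (hr : r + v.length ≤ ℓ * k) :
    expOne θ P ((s.drop q).take k) (occAt v r) = expOne θ P s (occAt v (ℓ * q + r)) := by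
  have hlen : ((s.drop q).take k).length = k := by simp; omega
  have hlen' : (s.take q).length = q := by simp; omega
  conv_rhs => rw [← List.take_append_drop q s, expOne_append]
  have e : ∀ w ∈ reals θ (s.take q),
      expOne θ P (s.drop q) (fun t => occAt v (ℓ * q + r) (w ++ t))
        = expOne θ P ((s.drop q).take k) (occAt v r) := by
    intro w hw
    have hwl : w.length = ℓ * q := by rw [length_of_mem_reals hl hw, hlen']
    conv_lhs => rw [← List.take_append_drop k (s.drop q), expOne_append]
    refine expOne_congr fun z hz => ?_
    have hzl : z.length = ℓ * k := by rw [length_of_mem_reals hl hz, hlen]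
    rw [← expOne_const hs ((s.drop q).drop k) (occAt v r z)]
    refine expOne_congr fun z' _ => ?_
    rw [← hwl, occAt_append_left, occAt_append_right (by omega)]
  rw [expOne_congr e, expOne_const hs]

theorem expCount_le_sum_occAt (hl : ∀ a, ∀ w ∈ θ a, w.length = ℓ)
    (hP : ∀ a, ∀ w ∈ θ a, 0 < P a w) (hs : ∀ a, ∑ w ∈ θ a, P a w = 1) (n : ℕ) (a : A)
    (t v : List A) :
    expCount θ P n a v ≤ ∑ r ∈ Finset.range (ℓ ^ n), expIter θ P n (a :: t) (occAt v r) := by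
  rw [expCount_eq, ← expIter_finsum, ← List.singleton_append (l := t), expIter_append]
  refine expIter_mono hP fun w hw => ?_
  have hwl : w.length = ℓ ^ n := by simpa using length_of_mem_realsIter hl hw
  rw [← expIter_const hs n t (occCount v w : ℝ)]
  refine expIter_mono hP fun w' _ => ?_
  rw [occCount_eq_sum, hwl]
  refine Finset.sum_le_sum fun r hr => occAt_le_append ?_ w'
  rw [hwl]
  exact Finset.mem_range.1 hr

variable [MeasurableSpace A] {μ ν : Measure (ℤ → A)}

/-- `ν` is a measure of maximal entropy of `X_ϑ`. -/
def IsMaximalEntropyMeasure (θ : A → Finset (List A)) (ν : Measure (ℤ → A)) : Prop :=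
  IsProbabilityMeasure ν ∧ (∀ s : Set (ℤ → A), MeasurableSet s → ν (shift ⁻¹' s) = ν s) ∧
    ν (Xtheta θ) = 1 ∧ measEntropy θ ν = topEntropy θ

variable [MeasurableSingletonClass A]

theorem measure_cylinder_eq (hinv : ∀ s : Set (ℤ → A), MeasurableSet s → ν (shift ⁻¹' s) = ν s)
    (v : List A) (m : ℤ) : ν (cylinder v m) = ν (cylinder v 0) := by
  obtain ⟨c, rfl | rfl⟩ := Int.eq_nat_or_neg m
  · rw [← measure_translate hinv c (measurableSet_cylinder v 0)]
    congr 1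
    ext x
    simp [cylinder, window_translate]
  · rw [← measure_translate hinv c (measurableSet_cylinder v (-c))]
    congr 1
    ext x
    simp [cylinder, window_translate]

/-- A finite measure on sequences is determined by its values on cylinders. -/
theorem ext_of_cylinder [IsProbabilityMeasure μ] [IsProbabilityMeasure ν]
    (h : ∀ (v : List A) (m : ℤ), ν (cylinder v m) = μ (cylinder v m)) : ν = μ := by
  refine ext_of_generate_finite _ (generateFrom_measurableCylinders (α := fun _ : ℤ => A)).symm
    isPiSystem_measurableCylinders (fun s hs => ?_) (by simp)
  have hmeas : MeasurableSet s := MeasurableSet.of_mem_measurableCylinders hs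
  obtain ⟨I, S, -, rfl⟩ := (mem_measurableCylinders s).1 hs
  obtain ⟨n, hn⟩ : ∃ n : ℕ, ∀ i ∈ I, i.natAbs < n :=
    ⟨I.sup Int.natAbs + 1, fun i hi => Nat.lt_succ_of_le (Finset.le_sup hi)⟩
  have key : ∀ v ∈ allWords A (2 * n),
      (∀ x : ℤ → A, window x (-n) (2 * n) = v → x ∉ MeasureTheory.cylinder I S) ∨
      (∀ x : ℤ → A, window x (-n) (2 * n) = v → x ∈ MeasureTheory.cylinder I S) := by
    intro v _
    by_contra! hcon
    obtain ⟨⟨x, hx, hxS⟩, y, hy, hyS⟩ := hcon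
    refine hyS ?_
    rw [mem_cylinder] at hxS ⊢
    convert hxS using 1
    funext i
    have hi := hn i i.2
    have h1 := (window_eq_iff.1 hx).2 (i + n : ℤ).toNat
      (by rw [(window_eq_iff.1 hx).1]; omega)
    have h2 := (window_eq_iff.1 hy).2 (i + n : ℤ).toNat
      (by rw [(window_eq_iff.1 hx).1]; omega)
    have e : (-n : ℤ) + ((i + n : ℤ).toNat : ℤ) = i := by omega
    rw [e] at h1 h2
    simp [Finset.restrict, h1, h2]
  have hreal : ν.real (MeasureTheory.cylinder I S) = μ.real (MeasureTheory.cylinder I S) := by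
    rw [← sum_measureReal_window (ν := ν) hmeas (-n) (2 * n),
      ← sum_measureReal_window (ν := μ) hmeas (-n) (2 * n)]
    refine Finset.sum_congr rfl fun v hv => ?_
    have hvl := mem_allWords.1 hv
    rcases key v hv with h0 | h1
    · have e : MeasureTheory.cylinder I S ∩ {x | window x (-n) (2 * n) = v} = ∅ := by
        ext x
        simp only [Set.mem_inter_iff, Set.mem_ofPred_eq, Set.mem_empty_iff_false, iff_false]
        exact fun hx => h0 x hx.2 hx.1
      rw [e]; simp
    · have e : MeasureTheory.cylinder I S ∩ {x | window x (-n) (2 * n) = v}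
          = cylinder v (-n) := by
        ext x
        simp only [Set.mem_inter_iff, Set.mem_ofPred_eq, cylinder, hvl]
        exact ⟨fun hx => hx.2, fun hx => ⟨h1 x hx, hx⟩⟩
      rw [e, measureReal_def, measureReal_def, h]
  exact (measureReal_eq_measureReal_iff).1 hreal

/-- A measure of maximal entropy is the law of the random substitution image, with uniform
probabilities, of another measure of maximal entropy. -/
theorem IsMaximalEntropyMeasure.exists_parent (hν : IsMaximalEntropyMeasure θ ν)
    (hrec : Recognisable θ) (hne : ∀ a, (θ a).Nonempty) (hℓ : 2 ≤ ℓ)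
    (hl : ∀ a, ∀ w ∈ θ a, w.length = ℓ)
    (hunif : ∀ a : A, ∀ s ∈ θ a, P a s = ((θ a).card : ℝ)⁻¹) {c : ℝ}
    (hc : UniformWeight θ (logCard θ) c) (htop : topEntropy θ = c / (ℓ - 1)) :
    ∃ ν', IsMaximalEntropyMeasure θ ν' ∧ ∀ (v : List A) (k : ℕ), ℓ + v.length ≤ ℓ * k →
      ℓ * (ν (cylinder v 0)).toReal = ∑ r ∈ Finset.range ℓ, ∑ u ∈ allWords A k,
        (ν' (cylinder u 0)).toReal * expOne θ P u (occAt v r) := by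
  obtain ⟨hpr, hinv, hsupp, hent⟩ := hν
  obtain ⟨ν', J, hpr', hinv', hsupp', hJ⟩ := exists_coupling hrec hne hl hℓ hinv hsupp
  have hℓ1 : (0 : ℝ) < ℓ - 1 := by
    have : (2 : ℝ) ≤ ℓ := by exact_mod_cast hℓ
    linarith
  have hℓ0 : (0 : ℝ) < ℓ := by linarith
  have htop' : topEntropy θ * ℓ = topEntropy θ + c := by
    rw [htop]; field_simp; ring
  have hle := measEntropy_le_topEntropy (θ := θ) hsupp'
  have hbound : ∀ k : ℕ, 0 < k →
      topEntropy θ + c ≤ measEntropy θ ν' + condEntropy ℓ ν' J k / k := fun k hk => by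
    have h1 := hJ.measEntropy_le hsupp hsupp' (by omega) hk
    rw [hent, le_div_iff₀ hℓ0] at h1
    linarith
  have hcond : ∀ k : ℕ, 0 < k → k * c ≤ condEntropy ℓ ν' J k := fun k hk => by
    have hk' : (0 : ℝ) < k := by exact_mod_cast hk
    have h1 := hbound k hk
    have h2 : c ≤ condEntropy ℓ ν' J k / k := by linarith
    rw [le_div_iff₀ hk'] at h2
    linarith
  refine ⟨ν', ⟨hpr', hinv', hsupp', le_antisymm hle ?_⟩, fun v k hk => ?_⟩
  · have h1 := hbound 1 one_pos
    have h2 := hJ.condEntropy_le hsupp' hne hl hc 1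
    simp only [Nat.cast_one, div_one, one_mul] at h1 h2
    linarith
  · have hk0 : 0 < k := by
      rcases Nat.eq_zero_or_pos k with rfl | h
      · omega
      · exact h
    rw [hJ.sum_occAt v k hk]
    refine Finset.sum_congr rfl fun r _ => Finset.sum_congr rfl fun u hu => ?_
    rw [hJ.sum_allWords_eq_sum_reals hl hu fun w hw => by rw [hw, zero_mul],
      expOne_uniform hl hunif, ← mul_assoc, Finset.mul_sum]
    refine Finset.sum_congr rfl fun w hw => ?_
    rw [hJ.eq_of_condEntropy_ge hsupp' hne hl hc (hcond k hk0) hu w hw, div_eq_mul_inv]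

theorem IsMaximalEntropyMeasure.exists_ancestor (hν : IsMaximalEntropyMeasure θ ν)
    (hrec : Recognisable θ) (hRS : IsRandomSubstitution θ P) (hℓ : 2 ≤ ℓ)
    (hl : ∀ a, ∀ w ∈ θ a, w.length = ℓ)
    (hunif : ∀ a : A, ∀ s ∈ θ a, P a s = ((θ a).card : ℝ)⁻¹) {c : ℝ}
    (hc : UniformWeight θ (logCard θ) c) (htop : topEntropy θ = c / (ℓ - 1)) (n : ℕ) :
    ∃ ν', IsMaximalEntropyMeasure θ ν' ∧ ∀ (v : List A) (k : ℕ), v.length + n ≤ k →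
      (ℓ : ℝ) ^ n * (ν (cylinder v 0)).toReal = ∑ t ∈ allWords A k,
        (ν' (cylinder t 0)).toReal * ∑ r ∈ Finset.range (ℓ ^ n), expIter θ P n t (occAt v r) := by
  induction n generalizing ν with
  | zero =>
    refine ⟨ν, hν, fun v k hk => ?_⟩
    obtain ⟨hpr, hinv, hsupp, hent⟩ := hν
    obtain ⟨b, rfl⟩ := Nat.exists_eq_add_of_le hk
    rw [add_zero, sum_allWords_add]
    have e : ∀ u ∈ allWords A v.length, ∀ w ∈ allWords A b,
        (ν (cylinder (u ++ w) 0)).toReal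
          * ∑ r ∈ Finset.range (ℓ ^ 0), expIter θ P 0 (u ++ w) (occAt v r)
        = if u = v then (ν (cylinder (u ++ w) 0)).toReal else 0 := by
      intro u hu w _
      have huv := mem_allWords.1 hu
      have : v <+: u ++ w ↔ u = v := by
        constructor
        · rintro ⟨z, hz⟩
          exact (List.append_inj_left hz huv.symm).symm
        · rintro rfl
          exact List.prefix_append _ _
      simp only [pow_zero, Finset.range_one, Finset.sum_singleton, expIter, occAt, List.drop_zero,
        this, mul_ite, mul_one, mul_zero]
    rw [Finset.sum_congr rfl fun u hu => Finset.sum_congr rfl fun w hw => e u hu w hw]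
    simp only [Finset.sum_ite_irrel, Finset.sum_const_zero, Finset.sum_ite_eq', mem_allWords,
      if_true, pow_zero, one_mul]
    rw [← measureReal_def, ← sum_measureReal_window (measurableSet_cylinder v 0) v.length b]
    refine Finset.sum_congr rfl fun w hw => ?_
    rw [measureReal_def]
    congr 2
    ext x
    simp only [Set.mem_inter_iff, Set.mem_ofPred_eq, cylinder, List.length_append,
      mem_allWords.1 hw, window_add, zero_add]
    constructor
    · rintro ⟨h1, h2⟩
      rw [h1, h2]
    · intro h
      exact List.append_inj h (by simp)
  | succ n ih =>
    obtain ⟨ν₁, hν₁, h₁⟩ := hν.exists_parent hrec hRS.1 hℓ hl hunif hc htop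
    obtain ⟨ν₂, hν₂, h₂⟩ := ih hν₁
    refine ⟨ν₂, hν₂, fun v k hk => ?_⟩
    have hs := hRS.2.2.2.2
    have hlen : ∀ r < ℓ, r + v.length ≤ ℓ * (v.length + 1) := fun r hr => by nlinarith
    have hstep := h₁ v (v.length + 1) (by nlinarith)
    have hin : ∀ q ∈ Finset.range (ℓ ^ n), ∀ r ∈ Finset.range ℓ, ∀ t ∈ allWords A k,
        ∑ u ∈ allWords A (v.length + 1),
          expIter θ P n t (occAt u q) * expOne θ P u (occAt v r)
        = expIter θ P (n + 1) t (occAt v (ℓ * q + r)) := by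
      intro q hq r hr t ht
      rw [expIter_comp, ← Finset.sum_congr rfl fun u _ => mul_comm _ _, ← expIter_sum]
      refine expIter_congr fun s hs' => ?_
      have hsl := length_of_mem_realsIter hl hs'
      rw [mem_allWords.1 ht] at hsl
      rw [Finset.mem_range] at hq hr
      have hqs : q + (v.length + 1) ≤ s.length := by
        have : 1 ≤ ℓ ^ n := Nat.one_le_pow _ _ (by omega)
        obtain ⟨d, rfl⟩ := Nat.exists_eq_add_of_le hk
        rw [hsl]
        nlinarith [Nat.zero_le (n + d)]
      rw [Finset.sum_congr rfl fun u _ => mul_comm _ _, sum_occAt_mul hqs fun u =>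
        expOne θ P u (occAt v r), expOne_drop_take_occAt hl hs hqs (hlen r hr), expIter_one]
    calc (ℓ : ℝ) ^ (n + 1) * (ν (cylinder v 0)).toReal
        = ∑ r ∈ Finset.range ℓ, ∑ u ∈ allWords A (v.length + 1),
            ((ℓ : ℝ) ^ n * (ν₁ (cylinder u 0)).toReal) * expOne θ P u (occAt v r) := by
          rw [pow_succ, mul_assoc, hstep]
          simp only [Finset.mul_sum, mul_assoc]
      _ = ∑ r ∈ Finset.range ℓ, ∑ u ∈ allWords A (v.length + 1), ∑ t ∈ allWords A k,
            ∑ q ∈ Finset.range (ℓ ^ n), (ν₂ (cylinder t 0)).toReal *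
              (expIter θ P n t (occAt u q) * expOne θ P u (occAt v r)) := by
          refine Finset.sum_congr rfl fun r _ => Finset.sum_congr rfl fun u hu => ?_
          rw [h₂ u k (by rw [mem_allWords.1 hu]; omega)]
          simp only [Finset.mul_sum, Finset.sum_mul, mul_assoc]
      _ = ∑ t ∈ allWords A k, ∑ q ∈ Finset.range (ℓ ^ n), ∑ r ∈ Finset.range ℓ,
            ∑ u ∈ allWords A (v.length + 1), (ν₂ (cylinder t 0)).toReal *
              (expIter θ P n t (occAt u q) * expOne θ P u (occAt v r)) := by
          rw [Finset.sum_congr rfl fun r _ => Finset.sum_comm, Finset.sum_comm]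
          refine Finset.sum_congr rfl fun t _ => ?_
          rw [Finset.sum_congr rfl fun r _ => Finset.sum_comm, Finset.sum_comm]
      _ = _ := by
          refine Finset.sum_congr rfl fun t ht => ?_
          rw [pow_succ', sum_range_mul_eq, Finset.mul_sum]
          refine Finset.sum_congr rfl fun q hq => ?_
          rw [Finset.mul_sum]
          refine Finset.sum_congr rfl fun r hr => ?_
          rw [← Finset.mul_sum, hin q hq r hr t ht]

theorem IsFrequencyMeasure.le_of_isMaximalEntropyMeasure (hμ : IsFrequencyMeasure θ P μ)
    (hν : IsMaximalEntropyMeasure θ ν)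
    (hrec : Recognisable θ) (hRS : IsRandomSubstitution θ P) (hℓ : 2 ≤ ℓ)
    (hl : ∀ a, ∀ w ∈ θ a, w.length = ℓ)
    (hunif : ∀ a : A, ∀ s ∈ θ a, P a s = ((θ a).card : ℝ)⁻¹) {c : ℝ}
    (hc : UniformWeight θ (logCard θ) c) (htop : topEntropy θ = c / (ℓ - 1)) {v : List A}
    (hv : Legal θ v) : (μ (cylinder v 0)).toReal ≤ (ν (cylinder v 0)).toReal := by
  refine le_of_forall_sub_le fun ε hε => ?_
  have hev : ∀ᶠ n : ℕ in atTop, ∀ a : A,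
      (μ (cylinder v 0)).toReal - ε ≤ expCount θ P n a v / (ℓ : ℝ) ^ n :=
    eventually_all.2 fun a =>
      ((hμ.tendsto hRS hl hv 0 a).eventually (lt_mem_nhds (sub_lt_self _ hε))).mono
        fun _ h => h.le
  obtain ⟨n, hn, hn1⟩ := (hev.and (eventually_ge_atTop 1)).exists
  obtain ⟨ν', hν', h⟩ := hν.exists_ancestor hrec hRS hℓ hl hunif hc htop n
  have hpr' := hν'.1
  have hpos : (0 : ℝ) < (ℓ : ℝ) ^ n := by positivity
  refine le_of_mul_le_mul_left ?_ hpos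
  rw [h v (v.length + n) le_rfl]
  calc (ℓ : ℝ) ^ n * ((μ (cylinder v 0)).toReal - ε)
      = ∑ t ∈ allWords A (v.length + n), (ν' (cylinder t 0)).toReal *
          ((ℓ : ℝ) ^ n * ((μ (cylinder v 0)).toReal - ε)) := by
        rw [← Finset.sum_mul, sum_cylinder, one_mul]
    _ ≤ _ := by
        refine Finset.sum_le_sum fun t ht => mul_le_mul_of_nonneg_left ?_ ENNReal.toReal_nonneg
        have htl := mem_allWords.1 ht
        obtain ⟨a, t', rfl⟩ := List.exists_cons_of_length_pos (l := t) (by omega)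
        refine le_trans ?_ (expCount_le_sum_occAt hl hRS.2.2.1 hRS.2.2.2.2 n a t' v)
        have := hn a
        rw [le_div_iff₀ hpos] at this
        linarith

theorem IsFrequencyMeasure.eq_of_isMaximalEntropyMeasure (hμ : IsFrequencyMeasure θ P μ)
    (hν : IsMaximalEntropyMeasure θ ν)
    (hrec : Recognisable θ) (hRS : IsRandomSubstitution θ P) (hℓ : 2 ≤ ℓ)
    (hl : ∀ a, ∀ w ∈ θ a, w.length = ℓ)
    (hunif : ∀ a : A, ∀ s ∈ θ a, P a s = ((θ a).card : ℝ)⁻¹) {c : ℝ}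
    (hc : UniformWeight θ (logCard θ) c) (htop : topEntropy θ = c / (ℓ - 1)) : ν = μ := by
  obtain ⟨hprμ, hinvμ, hsuppμ, -⟩ := id hμ
  obtain ⟨hprν, hinvν, hsuppν, -⟩ := id hν
  refine ext_of_cylinder fun v m => ?_
  rw [measure_cylinder_eq hinvν, measure_cylinder_eq hinvμ]
  by_cases hv : Legal θ v
  · have heq := (Finset.sum_eq_sum_iff_of_le fun w hw =>
      hμ.le_of_isMaximalEntropyMeasure hν hrec hRS hℓ hl hunif hc htop (mem_legalWords.1 hw).2).1
      ((sum_cylinder_legal hsuppμ 0 v.length).trans (sum_cylinder_legal hsuppν 0 v.length).symm)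
    exact ((ENNReal.toReal_eq_toReal_iff' (measure_ne_top _ _) (measure_ne_top _ _)).1
      (heq v (mem_legalWords.2 ⟨rfl, hv⟩))).symm
  · rw [cylinder_eq_zero hsuppν hv, cylinder_eq_zero hsuppμ hv]

end Uniqueness

theorem statement5 {A : Type*} [Fintype A] [DecidableEq A] [MeasurableSpace A]
    (θ : A → Finset (List A)) (P : A → List A → ℝ) (ℓ : ℕ) (μ : Measure (ℤ → A))
    (hRS : IsRandomSubstitution θ P) (hprim : IsPrimitive θ P)
    (hcl : ConstantLength θ ℓ) (hrec : Recognisable θ)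
    (hcase : (∀ a b : A, (θ a).card = (θ b).card) ∨
      (Compatible θ ∧
        ∀ z ∈ spectrum ℂ ((substM θ P).map Complex.ofReal), z = 0 ∨ z = (ℓ : ℂ)))
    (hunif : ∀ a : A, ∀ s ∈ θ a, P a s = ((θ a).card : ℝ)⁻¹)
    (hμ : IsFrequencyMeasure θ P μ) :
    measEntropy θ μ = topEntropy θ ∧
      ∀ ν : Measure (ℤ → A), IsProbabilityMeasure ν →
        (∀ s : Set (ℤ → A), MeasurableSet s → ν (shift ⁻¹' s) = ν s) →
          ν (Xtheta θ) = 1 → measEntropy θ ν = topEntropy θ → ν = μ := by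
  obtain ⟨hℓ, hl⟩ := hcl
  have hne := hRS.1
  have hA := hμ.nonempty
  have hsing := hμ.measurableSingletonClass hRS hprim hl hℓ
  have hext : ∀ u, Legal θ u → ∃ x ∈ Xtheta θ, window x 0 u.length = u := fun u hu =>
    hμ.exists_mem_Xtheta hRS hprim hl hℓ hu
  have hX : (Xtheta θ).Nonempty := by
    obtain ⟨x, hx, -⟩ := hext _ (legal_singleton hA.some)
    exact ⟨x, hx⟩
  have hpr := hμ.1
  obtain ⟨c, hc⟩ : ∃ c, UniformWeight θ (logCard θ) c := by
    rcases hcase with hcard | ⟨hcomp, -⟩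
    · exact ⟨logCard θ hA.some, uniformWeight_const fun a => by
        rw [logCard, logCard, hcard a hA.some]⟩
    · exact hμ.exists_uniformWeight hRS hrec hℓ hl hext hcomp _
  have hle := measEntropy_le_topEntropy (θ := θ) hμ.2.2.1
  have hge := hμ.le_measEntropy hrec hRS hℓ hl hunif hext hc
  have hup := topEntropy_le hrec hne hℓ hl hext hX hc
  refine ⟨le_antisymm hle (hup.trans hge), fun ν hνpr hνinv hνsupp hνent => ?_⟩
  exact hμ.eq_of_isMaximalEntropyMeasure ⟨hνpr, hνinv, hνsupp, hνent⟩ hrec hRS hℓ hl hunif hc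
    (le_antisymm hup (hge.trans hle))

end RandomSubstitutionTheory
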